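/- Let d ≥ 1, 0 < α < 1, 1 < p < ∞. Let k : ℝ^d ∖ {0} → ℝ be smooth away from the origin, positively homogeneous of degree −d, with zero mean on spheres centered at the origin, and let 𝕂 be the associated classical Calderón–Zygmund operator, (𝕂σ)(x) = lim_{ε→0} ∫_{|x−y|>ε} k(x−y) σ(y) dy. Then for every vector field η ∈ C^{1+α}(ℝ^d; ℝ^d) there is a constant C (depending only on k, α, p, d) such that the commutator [η·∇, 𝕂]σ = η·∇(𝕂σ) − 𝕂(η·∇σ), defined for smooth compactly supported σ, satisfies ‖[η·∇, 𝕂]σ‖_{α,p} ≤ C ‖η‖_{C^{1+α}(ℝ^d)} ‖σ‖_{α,p}; in particular it extends to a bounded linear operator on C^{α,p} = C^α(ℝ^d) ∩ L^p(ℝ^d). -/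

import Mathlib

open MeasureTheory Real Set Filter Topology

noncomputable section

/-- `ℝ^d` (with the sup norm). -/
abbrev Euc (d : ℕ) : Type := Fin d → ℝ

/-- `d × d` real matrices (with the sup norm). -/
abbrev Mat (d : ℕ) : Type := Fin d → Fin d → ℝ

/-- `f` belongs to `C^α(ℝ^d)` with (both components of the) norm bounded by `M`. -/
def InCa {d : ℕ} {F : Type*} [NormedAddCommGroup F] (α M : ℝ) (f : Euc d → F) : Prop :=
  (∀ x, ‖f x‖ ≤ M) ∧ ∀ x y, ‖f x - f y‖ ≤ M * ‖x - y‖ ^ α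

/-- `f` belongs to `C^{α,p} = C^α(ℝ^d) ∩ L^p(ℝ^d)` with norm bounded by `M`. -/
def InCap {d : ℕ} {F : Type*} [NormedAddCommGroup F] (α p M : ℝ) (f : Euc d → F) : Prop :=
  InCa α M f ∧ eLpNorm f (ENNReal.ofReal p) volume ≤ ENNReal.ofReal M

/-- `f` belongs to `C^{1+α}(ℝ^d)` with norm bounded by `M`. -/
def InC1a {d : ℕ} {F : Type*} [NormedAddCommGroup F] [NormedSpace ℝ F] (α M : ℝ)
    (f : Euc d → F) : Prop :=
  Differentiable ℝ f ∧ (∀ x, ‖f x‖ ≤ M) ∧ InCa α M (fderiv ℝ f)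

/-- `f` belongs to `C^{1+α,p} = C^{1+α}(ℝ^d) ∩ W^{1,p}(ℝ^d)` with norm bounded by `M`. -/
def InC1ap {d : ℕ} {F : Type*} [NormedAddCommGroup F] [NormedSpace ℝ F] (α p M : ℝ)
    (f : Euc d → F) : Prop :=
  Differentiable ℝ f ∧ (∀ x, ‖f x‖ ≤ M) ∧ InCap α p M (fderiv ℝ f) ∧
    eLpNorm f (ENNReal.ofReal p) volume ≤ ENNReal.ofReal M

/-- The heat kernel `g_t`. -/
def heatKer (d : ℕ) (t : ℝ) (x : Euc d) : ℝ :=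
  (4 * π * t) ^ (-(d : ℝ) / 2) * Real.exp (-(∑ i, x i ^ 2) / (4 * t))

/-- Convolution with the heat kernel. -/
def heatConv {d : ℕ} {F : Type*} [NormedAddCommGroup F] [NormedSpace ℝ F] [CompleteSpace F]
    (t : ℝ) (f : Euc d → F) (x : Euc d) : F :=
  ∫ y : Euc d, heatKer d t (x - y) • f y

/-- `𝕃(f)(t) = e^{tΔ} f` (with `e^{0Δ} = Id`). -/
def opL {d : ℕ} {F : Type*} [NormedAddCommGroup F] [NormedSpace ℝ F] [CompleteSpace F]
    (f : Euc d → F) (t : ℝ) : Euc d → F :=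
  if t = 0 then f else heatConv t f

/-- The kernel of `e^{tΔ}ℍ`, `ℍ = I + R ⊗ R` the Leray projector: the inverse Fourier
transform of the (real, even, integrable for `t > 0`) symbol
`(δ_{mn} - ξ_mξ_n/|ξ|²) e^{-4π²t|ξ|²}`. -/
def lerayHeatKer (d : ℕ) (t : ℝ) (x : Euc d) (m n : Fin d) : ℝ :=
  ∫ ξ : Euc d, ((if m = n then (1 : ℝ) else 0) - ξ m * ξ n / (∑ i, ξ i ^ 2)) *
    Real.exp (-(4 * π ^ 2) * t * (∑ i, ξ i ^ 2)) * Real.cos (2 * π * ∑ i, x i * ξ i)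

/-- `div σ` for a matrix-valued field, `(div σ)_n = ∑_j ∂_j σ_{jn}`. -/
def divMat {d : ℕ} (σ : Euc d → Mat d) (y : Euc d) (n : Fin d) : ℝ :=
  ∑ j, fderiv ℝ (fun z => σ z j n) y (Pi.single j 1)

/-- `div u` for a vector field. -/
def divVec {d : ℕ} (u : Euc d → Euc d) (x : Euc d) : ℝ :=
  ∑ j, fderiv ℝ u x (Pi.single j 1) j

/-- `(∇u)_{mn} = ∂_n u_m`, as a matrix. -/
def gradMat {d : ℕ} (u : Euc d → Euc d) (x : Euc d) : Mat d :=
  fun m n => fderiv ℝ u x (Pi.single n 1) m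

/-- `𝕌(σ)(t) = ∫₀ᵗ e^{(t-s)Δ} ℍ div σ(s) ds`. -/
def opU {d : ℕ} (σ : ℝ → Euc d → Mat d) (t : ℝ) (x : Euc d) : Euc d := fun m =>
  ∫ s in (0 : ℝ)..t, ∫ y : Euc d, ∑ n, lerayHeatKer d (t - s) (x - y) m n * divMat (σ s) y n

/-- `𝔾(σ)(t) = ∫₀ᵗ e^{(t-s)Δ} ∇ℍ div σ(s) ds`. -/
def opG {d : ℕ} (σ : ℝ → Euc d → Mat d) (t : ℝ) (x : Euc d) : Mat d := fun m j =>
  ∫ s in (0 : ℝ)..t, ∫ y : Euc d, ∑ n,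
    fderiv ℝ (fun z => lerayHeatKer d (t - s) z m n) (x - y) (Pi.single j 1) * divMat (σ s) y n

/-- Sup norm functional. -/
def supN {X : Type*} {F : Type*} [NormedAddCommGroup F] (f : X → F) : ℝ := ⨆ x, ‖f x‖

/-- Hölder seminorm functional. -/
def holN {d : ℕ} {F : Type*} [NormedAddCommGroup F] (α : ℝ) (f : Euc d → F) : ℝ :=
  ⨆ q : Euc d × Euc d, ‖f q.1 - f q.2‖ / ‖q.1 - q.2‖ ^ α

/-- The `C^{α,p}` norm functional. -/
def capN {d : ℕ} {F : Type*} [NormedAddCommGroup F] (α p : ℝ) (f : Euc d → F) : ℝ :=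
  supN f + holN α f + (eLpNorm f (ENNReal.ofReal p) volume).toReal

/-- The `C^{1+α,p}` norm functional. -/
def c1apN {d : ℕ} {F : Type*} [NormedAddCommGroup F] [NormedSpace ℝ F] (α p : ℝ)
    (f : Euc d → F) : ℝ :=
  supN f + capN α p (fderiv ℝ f) + (eLpNorm f (ENNReal.ofReal p) volume).toReal

/-- `L^∞(0,T;Y)` norm of a path, w.r.t. a norm functional `N` on `Y`. -/
def linfN {Y : Type*} (T : ℝ) (N : Y → ℝ) (f : ℝ → Y) : ℝ :=
  ⨆ t : Icc (0 : ℝ) T, N (f (t : ℝ))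

/-- `C^β(0,T;Y)` norm of a path, w.r.t. a norm functional `N` on `Y`. -/
def cbN {Y : Type*} [Sub Y] (T β : ℝ) (N : Y → ℝ) (f : ℝ → Y) : ℝ :=
  linfN T N f +
    ⨆ q : Icc (0 : ℝ) T × Icc (0 : ℝ) T,
      N (f (q.1 : ℝ) - f (q.2 : ℝ)) / |(q.1 : ℝ) - (q.2 : ℝ)| ^ β

/-- The (classical, principal value) convolution operator with kernel `k`. -/
def pvConv {d : ℕ} {F : Type*} [NormedAddCommGroup F] [NormedSpace ℝ F] [CompleteSpace F]
    (k : Euc d → ℝ) (f : Euc d → F) (x : Euc d) : F :=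
  limUnder (𝓝[>] (0 : ℝ)) fun ε => ∫ y in {y : Euc d | ε < ‖x - y‖}, k (x - y) • f y

/-- The (notional) spatial inverse of a flow map. -/
def invX {d : ℕ} (X : ℝ → Euc d → Euc d) (s : ℝ) : Euc d → Euc d := Function.invFun (X s)

/-- The Lagrangian nonlinearity `𝒰(X,τ) = 𝕃(u₀)∘X + 𝕌(τ∘X⁻¹)∘X`. -/
def calU {d : ℕ} (u₀ : Euc d → Euc d) (X : ℝ → Euc d → Euc d) (τ : ℝ → Euc d → Mat d)
    (t : ℝ) (a : Euc d) : Euc d :=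
  opL u₀ t (X t a) + opU (fun s y => τ s (invX X s y)) t (X t a)

/-- The Lagrangian velocity gradient `g = 𝕃(∇u₀)∘X + 𝔾(τ∘X⁻¹)∘X`. -/
def lagG {d : ℕ} (u₀ : Euc d → Euc d) (X : ℝ → Euc d → Euc d) (τ : ℝ → Euc d → Mat d)
    (t : ℝ) (a : Euc d) : Mat d :=
  opL (gradMat u₀) t (X t a) + opG (fun s y => τ s (invX X s y)) t (X t a)

/-- The Lagrangian nonlinearity `𝒯(X,τ) = F(g,τ)`. -/
def calT {d : ℕ} (F : Mat d → Mat d → Mat d) (u₀ : Euc d → Euc d) (X : ℝ → Euc d → Euc d)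
    (τ : ℝ → Euc d → Mat d) (t : ℝ) (a : Euc d) : Mat d :=
  F (lagG u₀ X τ t a) (τ t a)

/-- `v ⊗ v`. -/
def outer {d : ℕ} (w : Euc d) : Mat d := fun m n => w m * w n

/-- `𝕌(∇w)` for a time dependent matrix field `w`, assembled as a matrix. -/
def opUgrad {d : ℕ} (w : ℝ → Euc d → Mat d) (t : ℝ) (x : Euc d) : Mat d := fun m j =>
  opU (fun s y => fderiv ℝ (w s) y (Pi.single j 1)) t x m

/-- The Navier–Stokes Lagrangian nonlinearity
`𝒱(X,τ,v) = 𝕃(u₀)∘X + 𝕌(τ∘X⁻¹)∘X − 𝕌((v⊗v)∘X⁻¹)∘X`. -/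
def calV {d : ℕ} (u₀ : Euc d → Euc d) (X : ℝ → Euc d → Euc d) (τ : ℝ → Euc d → Mat d)
    (v : ℝ → Euc d → Euc d) (t : ℝ) (a : Euc d) : Euc d :=
  calU u₀ X τ t a - opU (fun s y => outer (v s (invX X s y))) t (X t a)

/-- The Navier–Stokes Lagrangian velocity gradient
`g = 𝕃(∇u₀)∘X + 𝔾(τ∘X⁻¹)∘X − 𝕌(∇((v⊗v)∘X⁻¹))∘X`. -/
def lagGns {d : ℕ} (u₀ : Euc d → Euc d) (X : ℝ → Euc d → Euc d) (τ : ℝ → Euc d → Mat d)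
    (v : ℝ → Euc d → Euc d) (t : ℝ) (a : Euc d) : Mat d :=
  lagG u₀ X τ t a - opUgrad (fun s y => outer (v s (invX X s y))) t (X t a)

/-- The Navier–Stokes Lagrangian nonlinearity `𝒯(X,τ,v) = F(g,τ)`. -/
def calTns {d : ℕ} (F : Mat d → Mat d → Mat d) (u₀ : Euc d → Euc d) (X : ℝ → Euc d → Euc d)
    (τ : ℝ → Euc d → Mat d) (v : ℝ → Euc d → Euc d) (t : ℝ) (a : Euc d) : Mat d :=
  F (lagGns u₀ X τ v t a) (τ t a)

/-- The space–time commutator `[η·∇, 𝔾](σ)`. -/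
def commG {d : ℕ} (η : ℝ → Euc d → Euc d) (σ : ℝ → Euc d → Mat d) (t : ℝ) (x : Euc d) :
    Mat d :=
  fderiv ℝ (opG σ t) x (η t x) - opG (fun s y => fderiv ℝ (σ s) y (η s y)) t x

/-- The space–time commutator `[η·∇, 𝕌](σ)`. -/
def commU {d : ℕ} (η : ℝ → Euc d → Euc d) (σ : ℝ → Euc d → Mat d) (t : ℝ) (x : Euc d) :
    Euc d :=
  fderiv ℝ (opU σ t) x (η t x) - opU (fun s y => fderiv ℝ (σ s) y (η s y)) t x

/-- Geometric summation over the dyadic scales below `a`. -/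
theorem exists_sum_scale_le (β : ℝ) (hβ : 0 < β) : ∃ C : ℝ, 0 < C ∧ ∀ a : ℝ, 0 < a →
    ∀ J : Finset ℤ, ∑ j ∈ J, (if (2 : ℝ) ^ j ≤ a then ((2 : ℝ) ^ j / a) ^ β else 0) ≤ C := by
  set r : ℝ := (2 : ℝ) ^ (-β) with hr
  have hr0 : 0 < r := by positivity
  have hr1 : r < 1 := Real.rpow_lt_one_of_one_lt_of_neg (by norm_num) (by linarith)
  refine ⟨(1 - r)⁻¹, by rw [inv_pos]; linarith, fun a ha J => ?_⟩
  set m : ℤ := Int.log 2 a with hm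
  have hma : (2 : ℝ) ^ m ≤ a := by simpa using Int.zpow_log_le_self (b := 2) (by norm_num) ha
  have hjm : ∀ j : ℤ, (2 : ℝ) ^ j ≤ a → j ≤ m := fun j hj =>
    (Int.zpow_le_iff_le_log (b := 2) (by norm_num) ha).1 (by simpa using hj)
  rw [← Finset.sum_filter]
  have hinj : Set.InjOn (fun j : ℤ => (m - j).toNat) (J.filter fun j => (2 : ℝ) ^ j ≤ a) := by
    intro i hi j hj hij
    simp only [Finset.coe_filter, mem_ofPred_eq] at hi hj
    have := hjm i hi.2
    have := hjm j hj.2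
    simp only at hij
    omega
  calc ∑ j ∈ J.filter fun j => (2 : ℝ) ^ j ≤ a, ((2 : ℝ) ^ j / a) ^ β
      ≤ ∑ j ∈ J.filter fun j => (2 : ℝ) ^ j ≤ a, r ^ (m - j).toNat := by
        refine Finset.sum_le_sum fun j hj => ?_
        have hj' := hjm j (Finset.mem_filter.1 hj).2
        have h1 : (2 : ℝ) ^ j / a ≤ (2 : ℝ) ^ (j - m) := by
          rw [zpow_sub₀ (by norm_num)]
          gcongr
        have h2 : r ^ (m - j).toNat = ((2 : ℝ) ^ (j - m)) ^ β := by
          rw [hr, ← Real.rpow_natCast, ← Real.rpow_intCast, ← Real.rpow_mul (by norm_num),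
            ← Real.rpow_mul (by norm_num)]
          congr 1
          have : (((m - j).toNat : ℤ) : ℝ) = ((m - j : ℤ) : ℝ) := by
            rw [Int.toNat_of_nonneg (by omega)]
          rw [Int.cast_natCast] at this
          rw [this]
          push_cast
          ring
        rw [h2]
        gcongr
    _ = ∑ n ∈ (J.filter fun j => (2 : ℝ) ^ j ≤ a).image (fun j => (m - j).toNat), r ^ n := by
        rw [Finset.sum_image hinj]
    _ ≤ ∑' n : ℕ, r ^ n :=
        (summable_geometric_of_lt_one hr0.le hr1).sum_le_tsum _ (fun _ _ => by positivity)
    _ = (1 - r)⁻¹ := tsum_geometric_of_lt_one hr0.le hr1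

/-- Geometric summation over the dyadic scales above `a`. -/
theorem exists_sum_scale_ge (β : ℝ) (hβ : 0 < β) : ∃ C : ℝ, 0 < C ∧ ∀ a : ℝ, 0 < a →
    ∀ J : Finset ℤ, ∑ j ∈ J, (if a ≤ (2 : ℝ) ^ j then (a / (2 : ℝ) ^ j) ^ β else 0) ≤ C := by
  obtain ⟨C, hC, h⟩ := exists_sum_scale_le β hβ
  refine ⟨C, hC, fun a ha J => ?_⟩
  have := h a⁻¹ (inv_pos.2 ha) (J.image fun j => -j)
  rw [Finset.sum_image (by simp)] at this
  refine le_trans (le_of_eq (Finset.sum_congr rfl fun j _ => ?_)) this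
  have h2 : (0 : ℝ) < 2 ^ j := by positivity
  simp only [zpow_neg, inv_le_inv₀ h2 ha]
  congr 2
  field_simp

/-- The `L¹`-normalized dilation of `φ` at scale `s`. -/
def dil {d : ℕ} (φ : Euc d → ℝ) (s : ℝ) (z : Euc d) : ℝ := s⁻¹ ^ d * φ (s⁻¹ • z)

/-- The sum of the dyadic dilations of `φ` over a finite set of scales. -/
def dyadicKer {d : ℕ} (φ : Euc d → ℝ) (J : Finset ℤ) (z : Euc d) : ℝ :=
  ∑ j ∈ J, dil φ ((2 : ℝ) ^ j) z

/-- Convolution with `dyadicKer φ J`. -/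
def dyadicConv {d : ℕ} (φ : Euc d → ℝ) (J : Finset ℤ) (f : Euc d → ℝ) (x : Euc d) : ℝ :=
  ∫ y, dyadicKer φ J (x - y) * f y

theorem integral_norm_le_of_support_subset_closedBall {d : ℕ} {F : Euc d → ℝ} {B r : ℝ}
    (c : Euc d) (hr : 0 ≤ r) (hB : ∀ z, |F z| ≤ B) (hF : ∀ z, r < ‖z - c‖ → F z = 0) :
    ∫ z, |F z| ≤ B * (2 * r) ^ d := by
  have hB0 : 0 ≤ B := (abs_nonneg _).trans (hB c)
  calc ∫ z, |F z| ≤ ∫ z, (Metric.closedBall c r).indicator (fun _ => B) z := by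
        refine integral_mono_of_nonneg (ae_of_all _ fun _ => abs_nonneg _)
          ((integrable_indicator_iff measurableSet_closedBall).2
            (by simp [measure_closedBall_lt_top])) (ae_of_all _ fun z => ?_)
        by_cases hz : z ∈ Metric.closedBall c r
        · simpa [hz] using hB z
        · have : r < ‖z - c‖ := by simpa [dist_eq_norm] using hz
          simp [hz, hF z this]
    _ = B * (2 * r) ^ d := by
        rw [integral_indicator measurableSet_closedBall, setIntegral_const, measureReal_def,
          Real.volume_pi_closedBall _ hr, ENNReal.toReal_ofReal (by positivity)]
        simp [mul_comm]

section dil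

variable {d : ℕ} {φ : Euc d → ℝ}

theorem dil_eq_zero (hφ : ∀ z, 2 < ‖z‖ → φ z = 0) {s : ℝ} (hs : 0 < s) {z : Euc d}
    (hz : 2 * s < ‖z‖) : dil φ s z = 0 := by
  unfold dil
  rw [hφ, mul_zero]
  rw [norm_smul, norm_inv, Real.norm_of_nonneg hs.le, inv_mul_eq_div, lt_div_iff₀ hs]
  exact hz

theorem contDiff_dil (hφ : ContDiff ℝ (⊤ : ℕ∞) φ) (s : ℝ) : ContDiff ℝ (⊤ : ℕ∞) (dil φ s) := by
  unfold dil
  exact contDiff_const.mul (hφ.comp (contDiff_const_smul _))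

theorem abs_dil_le {B : ℝ} (hB : ∀ z, |φ z| ≤ B) {s : ℝ} (hs : 0 < s) (z : Euc d) :
    |dil φ s z| ≤ s⁻¹ ^ d * B := by
  unfold dil
  rw [abs_mul, abs_of_nonneg (by positivity)]
  gcongr
  exact hB _

theorem abs_dil_sub_le {B : ℝ} (hB : ∀ z w, |φ z - φ w| ≤ B * ‖z - w‖) {s : ℝ} (hs : 0 < s)
    (z w : Euc d) : |dil φ s z - dil φ s w| ≤ s⁻¹ ^ d * (B * (s⁻¹ * ‖z - w‖)) := by
  unfold dil
  rw [← mul_sub, abs_mul, abs_of_nonneg (by positivity)]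
  gcongr
  refine (hB _ _).trans_eq ?_
  rw [← smul_sub, norm_smul, norm_inv, Real.norm_of_nonneg hs.le]

theorem hasCompactSupport_of_forall_norm {φ : Euc d → ℝ} {r : ℝ} (hφ : ∀ z, r < ‖z‖ → φ z = 0) :
    HasCompactSupport φ :=
  HasCompactSupport.intro (isCompact_closedBall 0 r) fun z hz => hφ z (by simpa using hz)

theorem hasCompactSupport_dil (hφ : ∀ z, 2 < ‖z‖ → φ z = 0) {s : ℝ} (hs : 0 < s) :
    HasCompactSupport (dil φ s) :=
  hasCompactSupport_of_forall_norm fun _ hz => dil_eq_zero hφ hs hz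

theorem integral_dil {s : ℝ} (hs : 0 < s) : ∫ z, dil φ s z = ∫ z, φ z := by
  unfold dil
  rw [integral_const_mul, Measure.integral_comp_smul]
  simp only [Module.finrank_fintype_fun_eq_card, Fintype.card_fin, smul_eq_mul]
  rw [abs_of_pos (by positivity), ← mul_assoc, mul_inv_cancel₀ (by positivity), one_mul]

theorem contDiff_dyadicKer (hφ : ContDiff ℝ (⊤ : ℕ∞) φ) (J : Finset ℤ) :
    ContDiff ℝ (⊤ : ℕ∞) (dyadicKer φ J) := by
  unfold dyadicKer
  exact ContDiff.sum fun j _ => contDiff_dil hφ _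

theorem hasCompactSupport_dyadicKer (hφ : ∀ z, 2 < ‖z‖ → φ z = 0) (J : Finset ℤ) :
    HasCompactSupport (dyadicKer φ J) := by
  classical
  induction J using Finset.induction_on with
  | empty =>
    have : dyadicKer φ ∅ = 0 := by ext; simp [dyadicKer]
    rw [this]; exact HasCompactSupport.zero
  | insert a s ha ih =>
    have : dyadicKer φ (insert a s) = dil φ ((2 : ℝ) ^ a) + dyadicKer φ s := by
      ext; simp [dyadicKer, Finset.sum_insert ha]
    rw [this]
    exact (hasCompactSupport_dil hφ (by positivity)).add ih

/-- The Hörmander condition for `dyadicKer`, uniform in the set of scales. -/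
theorem exists_hormander (hφ : ContDiff ℝ (⊤ : ℕ∞) φ) (hs : ∀ z, 2 < ‖z‖ → φ z = 0) :
    ∃ C : ℝ, 0 < C ∧ ∀ (J : Finset ℤ) (r : ℝ) (c y : Euc d), 0 < r → ‖y - c‖ ≤ r →
      ∫⁻ x in (Metric.closedBall c (2 * r))ᶜ,
        ENNReal.ofReal |dyadicKer φ J (x - y) - dyadicKer φ J (x - c)| ≤ ENNReal.ofReal C := by
  have hcs := hasCompactSupport_of_forall_norm hs
  obtain ⟨B, hB⟩ := ((hφ.of_le (by simp) : ContDiff ℝ 1 φ).lipschitzWith_of_hasCompactSupport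
    hcs (by simp))
  have hlip : ∀ z w, |φ z - φ w| ≤ B * ‖z - w‖ := fun z w => by
    simpa [dist_eq_norm] using hB.dist_le_mul z w
  obtain ⟨C, hC, hsum⟩ := exists_sum_scale_ge 1 one_pos
  refine ⟨B * 10 ^ d * (2 * C) + 1, by positivity, fun J r c y hr hy => ?_⟩
  have hscale : ∀ j ∈ J, ∫⁻ x in (Metric.closedBall c (2 * r))ᶜ,
      ENNReal.ofReal |dil φ (2 ^ j) (x - y) - dil φ (2 ^ j) (x - c)| ≤
      ENNReal.ofReal (B * 10 ^ d * (2 * if r / 2 ≤ 2 ^ j then ((r / 2) / 2 ^ j) ^ (1 : ℝ) else 0)) := by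
    intro j _
    have h2 : (0 : ℝ) < 2 ^ j := by positivity
    set s : ℝ := 2 ^ j with hsdef
    split_ifs with hj
    · refine (setLIntegral_le_lintegral _ _).trans ?_
      have hcont : Continuous fun x : Euc d => dil φ s (x - y) - dil φ s (x - c) :=
        ((contDiff_dil hφ s).continuous.comp (by fun_prop)).sub
          ((contDiff_dil hφ s).continuous.comp (by fun_prop))
      have hsupp : ∀ x, 2 * s + r < ‖x - c‖ → dil φ s (x - y) - dil φ s (x - c) = 0 := by
        intro x hx
        rw [dil_eq_zero hs h2, dil_eq_zero hs h2, sub_zero]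
        · linarith
        · have : ‖x - c‖ ≤ ‖x - y‖ + ‖y - c‖ := by
            simpa using norm_add_le (x - y) (y - c)
          linarith
      have hcomp : HasCompactSupport fun x : Euc d => dil φ s (x - y) - dil φ s (x - c) :=
        HasCompactSupport.intro (isCompact_closedBall c (2 * s + r)) fun z hz =>
          hsupp z (by simpa [dist_eq_norm] using hz)
      rw [← ofReal_integral_eq_lintegral_ofReal
        (hcont.integrable_of_hasCompactSupport hcomp).abs (ae_of_all _ fun _ => abs_nonneg _)]
      apply ENNReal.ofReal_le_ofReal
      refine (integral_norm_le_of_support_subset_closedBall (B := s⁻¹ ^ d * (B * (s⁻¹ * r)))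
        c (by positivity) (fun x => ?_) hsupp).trans ?_
      · refine (abs_dil_sub_le hlip h2 _ _).trans ?_
        gcongr
        rw [sub_sub_sub_cancel_left, norm_sub_rev]
        exact hy
      · rw [Real.rpow_one]
        calc s⁻¹ ^ d * (B * (s⁻¹ * r)) * (2 * (2 * s + r)) ^ d
            ≤ s⁻¹ ^ d * (B * (s⁻¹ * r)) * (10 * s) ^ d := by
              have : 2 * (2 * s + r) ≤ 10 * s := by linarith
              gcongr ?_ * ?_ ^ d
          _ = (s⁻¹ * s) ^ d * (B * 10 ^ d * (s⁻¹ * r)) := by rw [mul_pow, mul_pow]; ring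
          _ = _ := by rw [inv_mul_cancel₀ h2.ne']; field_simp; ring
    · have : ∀ x ∈ (Metric.closedBall c (2 * r))ᶜ,
          ENNReal.ofReal |dil φ s (x - y) - dil φ s (x - c)| = 0 := by
        intro x hx
        have hx' : 2 * r < ‖x - c‖ := by simpa [dist_eq_norm] using hx
        have : ‖x - c‖ ≤ ‖x - y‖ + ‖y - c‖ := by
          simpa using norm_add_le (x - y) (y - c)
        rw [dil_eq_zero hs h2, dil_eq_zero hs h2]
        · simp
        · linarith
        · linarith
      rw [setLIntegral_congr_fun (g := fun _ => 0) measurableSet_closedBall.compl this]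
      simp
  calc ∫⁻ x in (Metric.closedBall c (2 * r))ᶜ,
        ENNReal.ofReal |dyadicKer φ J (x - y) - dyadicKer φ J (x - c)|
      ≤ ∫⁻ x in (Metric.closedBall c (2 * r))ᶜ,
        ∑ j ∈ J, ENNReal.ofReal |dil φ (2 ^ j) (x - y) - dil φ (2 ^ j) (x - c)| := by
        refine lintegral_mono fun x => ?_
        rw [← ENNReal.ofReal_sum_of_nonneg fun _ _ => abs_nonneg _]
        apply ENNReal.ofReal_le_ofReal
        unfold dyadicKer
        rw [← Finset.sum_sub_distrib]
        exact Finset.abs_sum_le_sum_abs _ _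
    _ = ∑ j ∈ J, ∫⁻ x in (Metric.closedBall c (2 * r))ᶜ,
        ENNReal.ofReal |dil φ (2 ^ j) (x - y) - dil φ (2 ^ j) (x - c)| := by
        refine lintegral_finsetSum _ fun j _ => ?_
        have := (contDiff_dil hφ ((2 : ℝ) ^ j)).continuous
        fun_prop
    _ ≤ ∑ j ∈ J, ENNReal.ofReal
          (B * 10 ^ d * (2 * if r / 2 ≤ 2 ^ j then ((r / 2) / 2 ^ j) ^ (1 : ℝ) else 0)) :=
        Finset.sum_le_sum hscale
    _ ≤ _ := by
        rw [← ENNReal.ofReal_sum_of_nonneg fun _ _ => by positivity]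
        apply ENNReal.ofReal_le_ofReal
        rw [← Finset.mul_sum, ← Finset.mul_sum]
        have := hsum (r / 2) (by positivity) J
        have : B * 10 ^ d * (2 * ∑ j ∈ J, if r / 2 ≤ 2 ^ j then ((r / 2) / 2 ^ j) ^ (1 : ℝ) else 0) ≤
          B * 10 ^ d * (2 * C) := by gcongr
        linarith

end dil

section L2

open scoped FourierTransform SchwartzMap Convolution

theorem SchwartzMap.exists_norm_le_of_apply_zero {V : Type*} [NormedAddCommGroup V]
    [NormedSpace ℝ V] (Ψ : 𝓢(V, ℂ)) (h0 : Ψ 0 = 0) :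
    ∃ C : ℝ, 0 < C ∧ ∀ ξ, ‖Ψ ξ‖ ≤ C * ‖ξ‖ ∧ ‖ξ‖ * ‖Ψ ξ‖ ≤ C := by
  obtain ⟨C₁, hC₁, h1⟩ := Ψ.decay 0 1
  obtain ⟨C₂, hC₂, h2⟩ := Ψ.decay 1 0
  refine ⟨C₁ + C₂, by positivity, fun ξ => ⟨?_, ?_⟩⟩
  · have : ‖Ψ ξ - Ψ 0‖ ≤ C₁ * ‖ξ - 0‖ := by
      refine Convex.norm_image_sub_le_of_norm_fderiv_le (𝕜 := ℝ) (f := Ψ) (s := univ)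
        (fun x _ => Ψ.differentiableAt) (fun x _ => ?_) convex_univ trivial trivial
      simpa [norm_iteratedFDeriv_one] using h1 x
    rw [h0, sub_zero, sub_zero] at this
    refine this.trans ?_
    gcongr
    linarith
  · have := h2 ξ
    simp only [pow_one, norm_iteratedFDeriv_zero] at this
    linarith

variable {V : Type*} [NormedAddCommGroup V] [InnerProductSpace ℝ V] [FiniteDimensional ℝ V]
  [MeasurableSpace V] [BorelSpace V]

theorem SchwartzMap.eLpNorm_two_fourier (f : 𝓢(V, ℂ)) :
    eLpNorm (𝓕 f : 𝓢(V, ℂ)) 2 volume = eLpNorm f 2 volume := by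
  have h1 := SchwartzMap.norm_fourier_toL2_eq f
  rw [SchwartzMap.norm_toLp, SchwartzMap.norm_toLp] at h1
  have h2 : eLpNorm (𝓕 f : 𝓢(V, ℂ)) 2 volume ≠ ⊤ := (SchwartzMap.memLp (𝓕 f) 2 volume).2.ne
  have h3 : eLpNorm f 2 volume ≠ ⊤ := (SchwartzMap.memLp f 2 volume).2.ne
  exact (ENNReal.toReal_eq_toReal_iff' h2 h3).1 h1

theorem SchwartzMap.eLpNorm_convolution_le {C : ℝ} (K g : 𝓢(V, ℂ))
    (hK : ∀ ξ, ‖𝓕 K ξ‖ ≤ C) :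
    eLpNorm ((K : V → ℂ) ⋆[ContinuousLinearMap.mul ℂ ℂ] g) 2 volume ≤
      ENNReal.ofReal C * eLpNorm g 2 volume := by
  set h := SchwartzMap.convolution (ContinuousLinearMap.mul ℂ ℂ) K g with hh
  have h1 : ((K : V → ℂ) ⋆[ContinuousLinearMap.mul ℂ ℂ] g) = h := by
    ext x
    rw [hh, SchwartzMap.convolution_apply]
  rw [h1, ← SchwartzMap.eLpNorm_two_fourier h, ← SchwartzMap.eLpNorm_two_fourier g]
  refine eLpNorm_le_mul_eLpNorm_of_ae_le_mul (ae_of_all _ fun ξ => ?_) 2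
  rw [hh, SchwartzMap.fourier_convolution]
  simp only [SchwartzMap.pairing_apply_apply, ContinuousLinearMap.mul_apply', norm_mul]
  gcongr
  exact hK ξ

theorem fourier_dilation (Φ : V → ℂ) {s : ℝ} (hs : 0 < s) (ξ : V) :
    𝓕 (fun v => ((s⁻¹ ^ Module.finrank ℝ V : ℝ) : ℂ) * Φ (s⁻¹ • v)) ξ = 𝓕 Φ (s • ξ) := by
  rw [Real.fourier_eq, Real.fourier_eq]
  have := Measure.integral_comp_smul (volume : Measure V)
    (fun v => 𝐞 (-(inner ℝ v (s • ξ))) • Φ v) s⁻¹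
  have h2 : ∀ v, 𝐞 (-(inner ℝ v ξ)) • (((s⁻¹ ^ Module.finrank ℝ V : ℝ) : ℂ) * Φ (s⁻¹ • v)) =
      ((s⁻¹ ^ Module.finrank ℝ V : ℝ) : ℂ) *
        (𝐞 (-(inner ℝ (s⁻¹ • v) (s • ξ))) • Φ (s⁻¹ • v)) := by
    intro v
    rw [real_inner_smul_left, real_inner_smul_right, ← mul_assoc, inv_mul_cancel₀ hs.ne', one_mul]
    simp only [Circle.smul_def, smul_eq_mul]
    ring
  simp_rw [h2]
  rw [integral_const_mul, this, abs_of_pos (by positivity), Complex.real_smul, ← mul_assoc,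
    ← Complex.ofReal_mul, mul_inv_cancel₀ (by positivity), Complex.ofReal_one, one_mul]

end L2

section L2

open scoped FourierTransform SchwartzMap Convolution

variable {d : ℕ} {φ : Euc d → ℝ}

/-- A real function on `Fin d → ℝ`, regarded as a complex function on `EuclideanSpace`. -/
def liftC (f : Euc d → ℝ) (v : EuclideanSpace ℝ (Fin d)) : ℂ := (f (WithLp.ofLp v) : ℂ)

theorem contDiff_liftC {f : Euc d → ℝ} (hf : ContDiff ℝ (⊤ : ℕ∞) f) :
    ContDiff ℝ (⊤ : ℕ∞) (liftC f) := by
  unfold liftC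
  exact Complex.ofRealCLM.contDiff.comp
    (hf.comp (PiLp.continuousLinearEquiv 2 ℝ (fun _ : Fin d => ℝ)).contDiff)

theorem hasCompactSupport_liftC {f : Euc d → ℝ} (hf : HasCompactSupport f) :
    HasCompactSupport (liftC f) :=
  (hf.comp_homeomorph (PiLp.continuousLinearEquiv 2 ℝ (fun _ : Fin d => ℝ)).toHomeomorph).comp_left
    (g := fun r : ℝ => (r : ℂ)) Complex.ofReal_zero

theorem integral_liftC (f : Euc d → ℝ) : ∫ v, liftC f v = ((∫ x, f x : ℝ) : ℂ) := by
  unfold liftC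
  rw [integral_complex_ofReal]
  congr 1
  exact (PiLp.volume_preserving_ofLp (Fin d)).integral_comp
    (PiLp.continuousLinearEquiv 2 ℝ (fun _ : Fin d => ℝ)).toHomeomorph.measurableEmbedding f

theorem eLpNorm_liftC (f : Euc d → ℝ) (p : ENNReal) :
    eLpNorm (liftC f) p volume = eLpNorm f p volume := by
  have : eLpNorm (liftC f) p volume = eLpNorm (f ∘ WithLp.ofLp) p volume :=
    eLpNorm_congr_norm_ae (ae_of_all _ fun v => by simp [liftC])
  have h2 := (PiLp.continuousLinearEquiv 2 ℝ
    (fun _ : Fin d => ℝ)).toHomeomorph.measurableEmbedding.eLpNorm_map_measure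
      (p := p) (g := f) (μ := volume)
  have h3 := (PiLp.volume_preserving_ofLp (Fin d)).map_eq
  rw [this]
  exact h2.symm.trans (congrArg (fun μ => eLpNorm f p μ) h3)

theorem exists_norm_fourier_dyadicKer_le (hφ : ContDiff ℝ (⊤ : ℕ∞) φ)
    (hs : ∀ z, 2 < ‖z‖ → φ z = 0) (h0 : ∫ z, φ z = 0) :
    ∃ C : ℝ, 0 < C ∧ ∀ (J : Finset ℤ) ξ, ‖𝓕 (liftC (dyadicKer φ J)) ξ‖ ≤ C := by
  set Φ : 𝓢(EuclideanSpace ℝ (Fin d), ℂ) :=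
    (hasCompactSupport_liftC (hasCompactSupport_of_forall_norm hs)).toSchwartzMap
      (contDiff_liftC hφ) with hΦ
  have hΦc : (Φ : EuclideanSpace ℝ (Fin d) → ℂ) = liftC φ := by ext; simp [hΦ]
  have hz : 𝓕 Φ 0 = 0 := by
    rw [SchwartzMap.fourier_coe, hΦc, Real.fourier_eq]
    simp [integral_liftC, h0]
  obtain ⟨C, hC, hb⟩ := SchwartzMap.exists_norm_le_of_apply_zero (𝓕 Φ) hz
  obtain ⟨C₁, hC₁, h1⟩ := exists_sum_scale_le 1 one_pos
  obtain ⟨C₂, hC₂, h2⟩ := exists_sum_scale_ge 1 one_pos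
  refine ⟨C * (C₁ + C₂), by positivity, fun J ξ => ?_⟩
  have hdil : ∀ j : ℤ, 𝓕 (liftC (dil φ ((2 : ℝ) ^ j))) ξ = 𝓕 Φ ((2 : ℝ) ^ j • ξ) := by
    intro j
    rw [SchwartzMap.fourier_coe, ← fourier_dilation _ (by positivity), hΦc]
    have : liftC (dil φ ((2 : ℝ) ^ j)) = fun v =>
        (((((2 : ℝ) ^ j)⁻¹ ^ Module.finrank ℝ (EuclideanSpace ℝ (Fin d)) : ℝ)) : ℂ) *
          liftC φ (((2 : ℝ) ^ j)⁻¹ • v) := by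
      ext v
      simp [liftC, dil]
    rw [this]
  have hsum : 𝓕 (liftC (dyadicKer φ J)) ξ = ∑ j ∈ J, 𝓕 Φ ((2 : ℝ) ^ j • ξ) := by
    simp_rw [← hdil, Real.fourier_eq]
    rw [← integral_finsetSum]
    · congr 1
      ext v
      simp [liftC, dyadicKer, Finset.smul_sum]
    · intro j _
      rw [Real.fourierIntegral_convergent_iff]
      exact (contDiff_liftC (contDiff_dil hφ _)).continuous.integrable_of_hasCompactSupport
        (hasCompactSupport_liftC (hasCompactSupport_dil hs (by positivity)))
  rw [hsum]
  rcases eq_or_ne ξ 0 with rfl | hξ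
  · simp [hz]; positivity
  have hξ' : 0 < ‖ξ‖ := norm_pos_iff.2 hξ
  calc ‖∑ j ∈ J, 𝓕 Φ ((2 : ℝ) ^ j • ξ)‖ ≤ ∑ j ∈ J, ‖𝓕 Φ ((2 : ℝ) ^ j • ξ)‖ := norm_sum_le _ _
    _ ≤ ∑ j ∈ J, C * ((if (2 : ℝ) ^ j ≤ ‖ξ‖⁻¹ then ((2 : ℝ) ^ j / ‖ξ‖⁻¹) ^ (1 : ℝ) else 0) +
          (if ‖ξ‖⁻¹ ≤ (2 : ℝ) ^ j then (‖ξ‖⁻¹ / (2 : ℝ) ^ j) ^ (1 : ℝ) else 0)) := by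
        refine Finset.sum_le_sum fun j _ => ?_
        have h2 : (0 : ℝ) < 2 ^ j := by positivity
        obtain ⟨hb1, hb2⟩ := hb ((2 : ℝ) ^ j • ξ)
        simp only [norm_smul, Real.norm_of_nonneg h2.le] at hb1 hb2
        simp only [Real.rpow_one]
        rcases le_or_gt ((2 : ℝ) ^ j) ‖ξ‖⁻¹ with h | h
        · rw [if_pos h]
          refine hb1.trans ?_
          rw [div_inv_eq_mul]
          gcongr
          refine le_add_of_nonneg_right ?_
          positivity
        · rw [if_neg (not_le.2 h), if_pos h.le, zero_add]
          have h3 : C * (‖ξ‖⁻¹ / (2 : ℝ) ^ j) = C / ((2 : ℝ) ^ j * ‖ξ‖) := by field_simp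
          rw [h3, le_div_iff₀ (by positivity)]
          linarith
    _ ≤ C * (C₁ + C₂) := by
        rw [← Finset.mul_sum, Finset.sum_add_distrib]
        gcongr
        · exact h1 _ (by positivity) J
        · exact h2 _ (by positivity) J

/-- `L²` boundedness of `dyadicConv`, uniform in the set of scales. -/
theorem exists_eLpNorm_two_dyadicConv_le (hφ : ContDiff ℝ (⊤ : ℕ∞) φ)
    (hs : ∀ z, 2 < ‖z‖ → φ z = 0) (h0 : ∫ z, φ z = 0) :
    ∃ C : ℝ, 0 < C ∧ ∀ (J : Finset ℤ) (g : Euc d → ℝ), MemLp g 2 volume →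
      eLpNorm (dyadicConv φ J g) 2 volume ≤ ENNReal.ofReal C * eLpNorm g 2 volume := by
  obtain ⟨C, hC, hb⟩ := exists_norm_fourier_dyadicKer_le hφ hs h0
  have smooth : ∀ (J : Finset ℤ) (g : Euc d → ℝ), HasCompactSupport g → ContDiff ℝ (⊤ : ℕ∞) g →
      eLpNorm (dyadicConv φ J g) 2 volume ≤ ENNReal.ofReal C * eLpNorm g 2 volume := by
    intro J g hg1 hg2
    have := SchwartzMap.eLpNorm_convolution_le
      ((hasCompactSupport_liftC (hasCompactSupport_dyadicKer hs J)).toSchwartzMap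
        (contDiff_liftC (contDiff_dyadicKer hφ J)))
      ((hasCompactSupport_liftC hg1).toSchwartzMap (contDiff_liftC hg2)) (hb J)
    rw [← eLpNorm_liftC, ← eLpNorm_liftC g]
    convert! this using 2
    ext v
    have h1 := integral_liftC (fun y => dyadicKer φ J y * g (WithLp.ofLp v - y))
    have h2 : dyadicConv φ J g (WithLp.ofLp v) =
        ∫ y, dyadicKer φ J y * g (WithLp.ofLp v - y) := by
      unfold dyadicConv
      rw [← integral_sub_left_eq_self _ _ (WithLp.ofLp v)]
      simp
    rw [liftC, h2, ← h1, convolution_def]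
    simp [liftC]
  refine ⟨C, hC, fun J g hg => ?_⟩
  have happ : ∀ n : ℕ, ∃ u : Euc d → ℝ, HasCompactSupport u ∧ ContDiff ℝ (⊤ : ℕ∞) u ∧
      eLpNorm (g - u) 2 volume ≤ ENNReal.ofReal (1 / (n + 1 : ℝ)) := fun n =>
    MemLp.exist_eLpNorm_sub_le (by simp) (by simp) hg (by positivity)
  choose u hu1 hu2 hu3 using happ
  have hKc := (contDiff_dyadicKer hφ J).continuous
  have hK2 : MemLp (dyadicKer φ J) 2 volume :=
    hKc.memLp_of_hasCompactSupport (hasCompactSupport_dyadicKer hs J)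
  have hum : ∀ n, MemLp (u n) 2 volume := fun n =>
    (hu2 n).continuous.memLp_of_hasCompactSupport (hu1 n)
  have hKx : ∀ x, MemLp (fun y => dyadicKer φ J (x - y)) 2 volume := fun x =>
    hK2.comp_measurePreserving (volume.measurePreserving_sub_left x)
  have hlim0 : Tendsto (fun n : ℕ => ENNReal.ofReal (1 / (n + 1 : ℝ))) atTop (𝓝 0) := by
    simpa using ENNReal.tendsto_ofReal tendsto_one_div_add_atTop_nhds_zero_nat
  have hlim : ∀ x, Tendsto (fun n => dyadicConv φ J (u n) x) atTop (𝓝 (dyadicConv φ J g x)) := by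
    intro x
    rw [tendsto_iff_edist_tendsto_0]
    have hbound : ∀ n, edist (dyadicConv φ J (u n) x) (dyadicConv φ J g x) ≤
        eLpNorm (fun y => dyadicKer φ J (x - y)) 2 volume * ENNReal.ofReal (1 / (n + 1 : ℝ)) := by
      intro n
      rw [edist_comm, edist_eq_enorm_sub]
      have i1 : Integrable (fun y => dyadicKer φ J (x - y) * g y) volume :=
        (hKx x).integrable_mul hg
      have i2 : Integrable (fun y => dyadicKer φ J (x - y) * u n y) volume :=
        (hKx x).integrable_mul (hum n)
      unfold dyadicConv
      rw [← integral_sub i1 i2]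
      refine (enorm_integral_le_lintegral_enorm _).trans ?_
      rw [← eLpNorm_one_eq_lintegral_enorm]
      refine le_trans (le_of_eq ?_) ((eLpNorm_smul_le_mul_eLpNorm (p := 2) (q := 2) (r := 1)
        (hg.sub (hum n)).1 (hKx x).1).trans ?_)
      · congr 1
        ext y
        simp [mul_sub]
      · gcongr
        exact hu3 n
    refine tendsto_of_tendsto_of_tendsto_of_le_of_le tendsto_const_nhds ?_ (fun _ => zero_le)
      hbound
    have := ENNReal.Tendsto.const_mul (a := eLpNorm (fun y => dyadicKer φ J (x - y)) 2 volume)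
      hlim0 (Or.inr (hKx x).eLpNorm_ne_top)
    simpa using this
  have hconvm : ∀ n, AEStronglyMeasurable (dyadicConv φ J (u n)) volume := by
    intro n
    unfold dyadicConv
    have h1 : Continuous fun q : Euc d × Euc d => dyadicKer φ J (q.1 - q.2) * u n q.2 :=
      (hKc.comp (by fun_prop)).mul ((hu2 n).continuous.comp continuous_snd)
    exact h1.stronglyMeasurable.integral_prod_right.aestronglyMeasurable
  refine (Lp.eLpNorm_lim_le_liminf_eLpNorm hconvm _ (ae_of_all _ hlim)).trans ?_
  have hle : ∀ n, eLpNorm (dyadicConv φ J (u n)) 2 volume ≤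
      ENNReal.ofReal C * (eLpNorm g 2 volume + ENNReal.ofReal (1 / (n + 1 : ℝ))) := by
    intro n
    refine (smooth J (u n) (hu1 n) (hu2 n)).trans ?_
    gcongr
    have h1 : u n = g - (g - u n) := by simp
    calc eLpNorm (u n) 2 volume = eLpNorm (g - (g - u n)) 2 volume := by rw [← h1]
      _ ≤ eLpNorm g 2 volume + eLpNorm (g - u n) 2 volume :=
        eLpNorm_sub_le hg.1 (hg.sub (hum n)).1 (by simp)
      _ ≤ _ := by gcongr; exact hu3 n
  refine (liminf_le_liminf (Eventually.of_forall hle)).trans (le_of_eq ?_)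
  apply Tendsto.liminf_eq
  have := ENNReal.Tendsto.const_mul (a := ENNReal.ofReal C)
    (hlim0.const_add (eLpNorm g 2 volume)) (Or.inr ENNReal.ofReal_ne_top)
  simpa using this

end L2

section CZDecomposition

variable {d : ℕ}

/-- The lattice index of the dyadic cube of side `2 ^ j` containing `y`. -/
def dyadicIndex (j : ℤ) (y : Euc d) : Fin d → ℤ := fun i => ⌊y i / (2 : ℝ) ^ j⌋

theorem dyadicIndex_succ (j : ℤ) (y : Euc d) :
    dyadicIndex (j + 1) y = fun i => dyadicIndex j y i / 2 := by
  ext i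
  have h : y i / (2 : ℝ) ^ (j + 1) = y i / (2 : ℝ) ^ j / ((2 : ℕ) : ℝ) := by
    rw [zpow_add_one₀ two_ne_zero]
    push_cast
    rw [div_div]
  simp only [dyadicIndex, h, Int.floor_div_natCast]
  rfl

theorem dyadicIndex_eq_of_le {j j' : ℤ} (h : j ≤ j') {y z : Euc d}
    (hyz : dyadicIndex j y = dyadicIndex j z) : dyadicIndex j' y = dyadicIndex j' z := by
  induction j', h using Int.leInduction with
  | base => exact hyz
  | succ n _ ih => rw [dyadicIndex_succ, dyadicIndex_succ, ih]

/-- The dyadic cube of side `2 ^ j` with lattice index `m`. -/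
def dyadicCube (j : ℤ) (m : Fin d → ℤ) : Set (Euc d) := {y | dyadicIndex j y = m}

theorem dyadicCube_eq_pi (j : ℤ) (m : Fin d → ℤ) :
    dyadicCube j m = univ.pi fun i => Ico ((m i : ℝ) * 2 ^ j) ((m i + 1) * 2 ^ j) := by
  ext y
  have h2 : (0 : ℝ) < 2 ^ j := by positivity
  simp only [dyadicCube, Set.mem_ofPred_eq, mem_univ_pi, funext_iff, dyadicIndex, Int.floor_eq_iff,
    mem_Ico, le_div_iff₀ h2, div_lt_iff₀ h2]

theorem measurableSet_dyadicCube (j : ℤ) (m : Fin d → ℤ) : MeasurableSet (dyadicCube j m) := by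
  rw [dyadicCube_eq_pi]
  exact MeasurableSet.univ_pi fun i => measurableSet_Ico

theorem volume_dyadicCube (j : ℤ) (m : Fin d → ℤ) :
    volume (dyadicCube j m) = ENNReal.ofReal (((2 : ℝ) ^ j) ^ d) := by
  rw [dyadicCube_eq_pi, Real.volume_pi_Ico]
  have : ∀ i, ((m i + 1 : ℝ) * 2 ^ j) - (m i : ℝ) * 2 ^ j = 2 ^ j := fun i => by ring
  simp_rw [this]
  rw [ENNReal.ofReal_pow (by positivity)]
  simp

theorem dyadicCube_subset_closedBall (j : ℤ) (m : Fin d → ℤ) :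
    dyadicCube j m ⊆ Metric.closedBall (fun i => ((m i : ℝ) + 1 / 2) * 2 ^ j) (2 ^ j / 2) := by
  intro y hy
  rw [dyadicCube_eq_pi, mem_univ_pi] at hy
  rw [mem_closedBall_iff_norm, pi_norm_le_iff_of_nonneg (by positivity)]
  intro i
  obtain ⟨h1, h2⟩ := hy i
  rw [Pi.sub_apply, Real.norm_eq_abs, abs_le]
  constructor <;> linarith

theorem dyadicCube_subset_closedBall_of_mem {j : ℤ} {m : Fin d → ℤ} {y : Euc d}
    (hy : y ∈ dyadicCube j m) : dyadicCube j m ⊆ Metric.closedBall y (2 ^ j) := by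
  intro z hz
  have h1 := dyadicCube_subset_closedBall j m hy
  have h2 := dyadicCube_subset_closedBall j m hz
  rw [Metric.mem_closedBall] at *
  calc dist z y ≤ _ := dist_triangle_right _ _ _
    _ ≤ 2 ^ j / 2 + 2 ^ j / 2 := add_le_add h2 h1
    _ = 2 ^ j := by ring

/-- Calderón–Zygmund selection of dyadic cubes at height `l`. -/
theorem exists_cz_cubes (hd : 1 ≤ d) {F : Euc d → ℝ} (hc : Continuous F)
    (hcs : HasCompactSupport F) (h0 : ∀ x, 0 ≤ F x) {l : ℝ} (hl : 0 < l) :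
    ∃ (ι : Type) (_ : Countable ι) (Q : ι → Set (Euc d)) (c : ι → Euc d) (r : ι → ℝ),
      (∀ i, 0 < r i) ∧ (∀ i, MeasurableSet (Q i)) ∧ Pairwise (Function.onFun Disjoint Q) ∧
      (∀ i, Q i ⊆ Metric.closedBall (c i) (r i)) ∧
      (∀ i, volume (Q i) = ENNReal.ofReal ((2 * r i) ^ d)) ∧
      (∀ i, l * (2 * r i) ^ d ≤ ∫ y in Q i, F y) ∧
      (∀ i, ∫ y in Q i, F y ≤ 2 ^ d * l * (2 * r i) ^ d) ∧
      (∀ y, (∀ i, y ∉ Q i) → F y ≤ l) := by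
  have hInt : Integrable F volume := hc.integrable_of_hasCompactSupport hcs
  have hmono : ∀ {s t : Set (Euc d)}, s ⊆ t → ∫ y in s, F y ≤ ∫ y in t, F y := fun {s t} hst =>
    setIntegral_mono_set hInt.integrableOn (ae_of_all _ h0) hst.eventuallyLE
  set bad : ℤ → (Fin d → ℤ) → Prop := fun j m =>
    l * ((2 : ℝ) ^ j) ^ d < ∫ y in dyadicCube j m, F y with hbad
  -- no cube of large side is bad
  obtain ⟨N, hN⟩ : ∃ N : ℕ, (∫ y, F y) / l ≤ (2 : ℝ) ^ N := by
    obtain ⟨N, hN⟩ := pow_unbounded_of_one_lt ((∫ y, F y) / l) one_lt_two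
    exact ⟨N, hN.le⟩
  have hlarge : ∀ j m, bad j m → j ≤ N := by
    intro j m hjm
    by_contra! hj
    have h1 : (2 : ℝ) ^ N ≤ ((2 : ℝ) ^ j) ^ d := by
      have h2 : (2 : ℝ) ^ (N : ℤ) ≤ (2 : ℝ) ^ j := zpow_le_zpow_right₀ one_le_two hj.le
      have h3 : (1 : ℝ) ≤ (2 : ℝ) ^ j := one_le_zpow₀ one_le_two (by omega)
      calc (2 : ℝ) ^ N ≤ (2 : ℝ) ^ j := by exact_mod_cast h2
        _ = ((2 : ℝ) ^ j) ^ 1 := (pow_one _).symm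
        _ ≤ _ := pow_le_pow_right₀ h3 hd
    have h4 : (∫ y, F y) ≤ l * ((2 : ℝ) ^ j) ^ d := by
      rw [div_le_iff₀' hl] at hN
      exact hN.trans (by gcongr)
    have h5 : ∫ y in dyadicCube j m, F y ≤ ∫ y, F y :=
      setIntegral_le_integral hInt (ae_of_all _ h0)
    simp only [hbad] at hjm
    linarith
  let I : Set (ℤ × (Fin d → ℤ)) := {q | bad q.1 q.2 ∧
    ∀ j', q.1 < j' → ∀ y ∈ dyadicCube q.1 q.2, ¬ bad j' (dyadicIndex j' y)}
  refine ⟨I, inferInstance, fun q => dyadicCube q.1.1 q.1.2,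
    fun q i => ((q.1.2 i : ℝ) + 1 / 2) * 2 ^ q.1.1, fun q => 2 ^ q.1.1 / 2,
    fun q => by positivity, fun q => measurableSet_dyadicCube _ _, ?_,
    fun q => dyadicCube_subset_closedBall _ _, fun q => ?_, fun q => ?_, fun q => ?_, ?_⟩
  · rintro ⟨⟨j, m⟩, hb, hs⟩ ⟨⟨j', m'⟩, hb', hs'⟩ hne
    refine Set.disjoint_left.2 fun y hy hy' => hne ?_
    have e1 : dyadicIndex j y = m := hy
    have e2 : dyadicIndex j' y = m' := hy'
    have : j = j' := by
      rcases lt_trichotomy j j' with h | h | h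
      · exact absurd (by rw [e2]; exact hb') (hs j' h y hy)
      · exact h
      · exact absurd (by rw [e1]; exact hb) (hs' j h y hy')
    subst this
    subst e1
    subst e2
    rfl
  · rw [volume_dyadicCube]
    congr 2
    ring
  · have := q.2.1
    simp only [hbad] at this
    rw [mul_div_cancel₀ _ two_ne_zero]
    exact this.le
  · rw [mul_div_cancel₀ _ two_ne_zero]
    obtain ⟨⟨j, m⟩, hb, hs⟩ := q
    simp only at hs ⊢
    set y : Euc d := fun i => (m i : ℝ) * 2 ^ j
    have hy : y ∈ dyadicCube j m := by
      rw [dyadicCube_eq_pi, mem_univ_pi]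
      intro i
      have h2 : (0 : ℝ) < 2 ^ j := by positivity
      constructor <;> simp only [y] <;> linarith
    have h1 := hs (j + 1) (by omega) y hy
    simp only [hbad, not_lt] at h1
    refine (hmono (t := dyadicCube (j + 1) (dyadicIndex (j + 1) y)) ?_).trans (h1.trans ?_)
    · intro z hz
      exact dyadicIndex_eq_of_le (by omega) (hz.trans hy.symm)
    · rw [zpow_add_one₀ two_ne_zero, mul_pow]
      exact le_of_eq (by ring)
  · intro y hy
    have hnb : ∀ j, ¬ bad j (dyadicIndex j y) := by
      intro j hj
      obtain ⟨n, hn1, hn2⟩ := Int.exists_greatest_of_bdd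
        (P := fun j => bad j (dyadicIndex j y)) ⟨N, fun z hz => hlarge z _ hz⟩ ⟨j, hj⟩
      refine hy ⟨(n, dyadicIndex n y), hn1, fun j' hj' z hz hb => ?_⟩ rfl
      have h1 : dyadicIndex j' z = dyadicIndex j' y := dyadicIndex_eq_of_le hj'.le hz
      rw [h1] at hb
      have := hn2 j' hb
      simp only at hj'
      omega
    by_contra! hlt
    obtain ⟨δ, hδ, hball⟩ := Metric.continuousAt_iff.1 (hc.continuousAt (x := y))
      ((F y - l) / 2) (by linarith)
    obtain ⟨n, hn⟩ := exists_pow_lt_of_lt_one hδ (by norm_num : (2 : ℝ)⁻¹ < 1)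
    have hn' : (2 : ℝ) ^ (-n : ℤ) < δ := by rwa [zpow_neg, zpow_natCast, ← inv_pow]
    have hvol := volume_dyadicCube (-n : ℤ) (dyadicIndex (-n : ℤ) y)
    have h1 := setIntegral_ge_of_const_le_real (c := (F y + l) / 2)
      (measurableSet_dyadicCube (-n : ℤ) (dyadicIndex (-n : ℤ) y))
      (by rw [hvol]; exact ENNReal.ofReal_ne_top) (fun z hz => by
        have h3 := dyadicCube_subset_closedBall_of_mem (y := y) rfl hz
        have h4 := hball (lt_of_le_of_lt (Metric.mem_closedBall.1 h3) hn')
        rw [Real.dist_eq, abs_lt] at h4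
        linarith [h4.1]) hInt.integrableOn
    have h2 := hnb (-n : ℤ)
    simp only [hbad, not_lt] at h2
    rw [Measure.real, hvol, ENNReal.toReal_ofReal (by positivity)] at h1
    have h3 : (0 : ℝ) < ((2 : ℝ) ^ (-n : ℤ)) ^ d := by positivity
    nlinarith

end CZDecomposition

section CZDecomposition

variable {d : ℕ}

/-- Calderón–Zygmund decomposition of a continuous compactly supported function at height `l`,
described through its good part `g`. -/
theorem exists_cz_decomposition (hd : 1 ≤ d) {f : Euc d → ℝ} (hc : Continuous f)
    (hcs : HasCompactSupport f) {l : ℝ} (hl : 0 < l) :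
    ∃ (ι : Type) (_ : Countable ι) (Q : ι → Set (Euc d)) (c : ι → Euc d) (r : ι → ℝ)
      (g : Euc d → ℝ),
      (∀ i, 0 < r i) ∧ (∀ i, MeasurableSet (Q i)) ∧ Pairwise (Function.onFun Disjoint Q) ∧
      (∀ i, Q i ⊆ Metric.closedBall (c i) (r i)) ∧
      (∀ i, volume (Q i) = ENNReal.ofReal ((2 * r i) ^ d)) ∧
      AEStronglyMeasurable g volume ∧
      (∀ y, |g y| ≤ 2 ^ d * l) ∧
      (∀ y, (∀ i, y ∉ Q i) → g y = f y ∧ |f y| ≤ l) ∧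
      (∀ i, ∫ y in Q i, (f y - g y) = 0) ∧
      (∀ i, ∫⁻ y in Q i, ‖f y - g y‖ₑ ≤ ENNReal.ofReal (2 * (2 ^ d * l)) * volume (Q i)) ∧
      volume (⋃ i, Q i) ≠ ⊤ ∧
      ENNReal.ofReal (l / 2) * volume (⋃ i, Q i) ≤ ∫⁻ y in {y | l / 2 < |f y|}, ‖f y‖ₑ := by
  obtain ⟨ι, hι, Q, c, r, hr, hQm, hQd, hQb, hQv, hlow, hup, hoff⟩ :=
    exists_cz_cubes hd hc.abs hcs.abs (fun x => abs_nonneg _) hl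
  have hInt : Integrable f volume := hc.integrable_of_hasCompactSupport hcs
  have hpos : ∀ i, 0 < (2 * r i) ^ d := fun i => by have := hr i; positivity
  have hreal : ∀ i, volume.real (Q i) = (2 * r i) ^ d := fun i => by
    rw [Measure.real, hQv, ENNReal.toReal_ofReal (hpos i).le]
  set a : ι → ℝ := fun i => (∫ y in Q i, f y) / (2 * r i) ^ d with ha
  classical
  set g : Euc d → ℝ := fun y => if h : ∃ i, y ∈ Q i then a h.choose else f y with hg
  have hgQ : ∀ i, ∀ y ∈ Q i, g y = a i := by
    intro i y hy
    have h : ∃ i, y ∈ Q i := ⟨i, hy⟩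
    have h1 : h.choose = i := by
      by_contra hne
      exact Set.disjoint_left.1 (hQd hne) h.choose_spec hy
    simp only [hg, dif_pos h, h1]
  have hgf : ∀ y, (∀ i, y ∉ Q i) → g y = f y := by
    intro y hy
    simp only [hg, dif_neg (not_exists.2 hy)]
  have habs : ∀ i, |∫ y in Q i, f y| ≤ ∫ y in Q i, |f y| := fun i => by
    simpa only [Real.norm_eq_abs] using norm_integral_le_integral_norm (μ := volume.restrict (Q i)) f
  have hab : ∀ i, |a i| ≤ 2 ^ d * l := by
    intro i
    simp only [ha]
    rw [abs_div, abs_of_pos (hpos i), div_le_iff₀ (hpos i)]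
    exact (habs i).trans (hup i)
  have hgi : ∀ i, IntegrableOn g (Q i) volume := fun i =>
    (integrableOn_const (C := a i) (by rw [hQv]; exact ENNReal.ofReal_ne_top)).congr_fun
      (fun y hy => (hgQ i y hy).symm) (hQm i)
  have hUm : MeasurableSet (⋃ i, Q i) := MeasurableSet.iUnion hQm
  have hgm : AEStronglyMeasurable g volume := by
    rw [← Measure.restrict_univ (μ := volume), ← union_compl_self (⋃ i, Q i),
      aestronglyMeasurable_union_iff, aestronglyMeasurable_iUnion_iff]
    refine ⟨fun i => (hgi i).aestronglyMeasurable, ?_⟩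
    refine (hc.aestronglyMeasurable (μ := volume.restrict (⋃ i, Q i)ᶜ)).congr ?_
    filter_upwards [ae_restrict_mem hUm.compl] with y hy
    rw [hgf y]
    simpa using hy
  have hfin : ∫⁻ y, ‖f y‖ₑ ≠ ⊤ := hInt.2.ne
  have hvolQ : ∀ i, ENNReal.ofReal l * volume (Q i) ≤ ∫⁻ y in Q i, ‖f y‖ₑ := by
    intro i
    rw [hQv, ← ENNReal.ofReal_mul hl.le, ← ofReal_integral_norm_eq_lintegral_enorm hInt.integrableOn]
    exact ENNReal.ofReal_le_ofReal (hlow i)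
  have hvolU : ENNReal.ofReal l * volume (⋃ i, Q i) ≤ ∫⁻ y in ⋃ i, Q i, ‖f y‖ₑ := by
    rw [measure_iUnion hQd hQm, lintegral_iUnion hQm hQd, ← ENNReal.tsum_mul_left]
    exact ENNReal.tsum_le_tsum hvolQ
  have hUfin : volume (⋃ i, Q i) ≠ ⊤ := by
    intro htop
    rw [htop, ENNReal.mul_top (by simpa using hl), top_le_iff] at hvolU
    exact hfin (top_le_iff.1 (hvolU ▸ setLIntegral_le_lintegral _ _))
  refine ⟨ι, hι, Q, c, r, g, hr, hQm, hQd, hQb, hQv, hgm, fun y => ?_,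
    fun y hy => ⟨hgf y hy, hoff y hy⟩, fun i => ?_, fun i => ?_, hUfin, ?_⟩
  · by_cases h : ∃ i, y ∈ Q i
    · obtain ⟨i, hi⟩ := h
      rw [hgQ i y hi]
      exact hab i
    · push Not at h
      rw [hgf y h]
      refine (hoff y h).trans (le_mul_of_one_le_left hl.le (one_le_pow₀ one_le_two))
  · rw [integral_sub hInt.integrableOn (hgi i),
      setIntegral_congr_fun (hQm i) (fun y hy => hgQ i y hy), setIntegral_const, hreal]
    simp only [ha, smul_eq_mul]
    rw [mul_div_cancel₀ _ (hpos i).ne', sub_self]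
  · have h1 : ∫⁻ y in Q i, ‖f y - g y‖ₑ ≤ ∫⁻ y in Q i, (‖f y‖ₑ + ENNReal.ofReal (2 ^ d * l)) := by
      refine setLIntegral_mono' (hQm i) fun y hy => ?_
      refine (enorm_sub_le).trans ?_
      gcongr
      rw [hgQ i y hy, Real.enorm_eq_ofReal_abs]
      exact ENNReal.ofReal_le_ofReal (hab i)
    refine h1.trans ?_
    rw [lintegral_add_right _ measurable_const, setLIntegral_const, two_mul,
      ENNReal.ofReal_add (by positivity) (by positivity), add_mul]
    gcongr
    rw [hQv, ← ENNReal.ofReal_mul (by positivity),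
      ← ofReal_integral_norm_eq_lintegral_enorm hInt.integrableOn]
    exact ENNReal.ofReal_le_ofReal (hup i)
  · have hsm : MeasurableSet {y | l / 2 < |f y|} := measurableSet_lt measurable_const hc.abs.measurable
    have h1 : ∫⁻ y in ⋃ i, Q i, ‖f y‖ₑ ≤ (∫⁻ y in {y | l / 2 < |f y|}, ‖f y‖ₑ) +
        ENNReal.ofReal (l / 2) * volume (⋃ i, Q i) := by
      rw [← setLIntegral_const, ← lintegral_indicator hsm,
        ← lintegral_indicator hUm, ← lintegral_indicator hUm, ← lintegral_add_right]
      · refine lintegral_mono fun y => ?_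
        by_cases hy : l / 2 < |f y|
        · rw [indicator_of_mem (s := {y | l / 2 < |f y|}) hy]
          exact (indicator_le_self _ _ _).trans le_self_add
        · refine le_trans ?_ le_add_self
          refine indicator_le_indicator ?_
          rw [Real.enorm_eq_ofReal_abs]
          exact ENNReal.ofReal_le_ofReal (not_lt.1 hy)
      · exact measurable_const.indicator hUm
    have h2 := hvolU.trans h1
    have h3 : ENNReal.ofReal l = ENNReal.ofReal (l / 2) + ENNReal.ofReal (l / 2) := by
      rw [← ENNReal.ofReal_add (by positivity) (by positivity), add_halves]
    rw [h3, add_mul] at h2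
    exact (ENNReal.add_le_add_iff_right (ENNReal.mul_ne_top ENNReal.ofReal_ne_top hUfin)).1 h2

end CZDecomposition

section WeakType

variable {d : ℕ}

/-- Off the doubled balls, a sum of mean-zero pieces is mapped into `L¹` by a kernel
satisfying Hörmander's condition. -/
theorem lintegral_convolution_compl_le {K : Euc d → ℝ} (hK : Continuous K)
    (hKs : HasCompactSupport K) {C : ENNReal}
    (hH : ∀ (r : ℝ) (c y : Euc d), 0 < r → ‖y - c‖ ≤ r →
      ∫⁻ x in (Metric.closedBall c (2 * r))ᶜ, ENNReal.ofReal |K (x - y) - K (x - c)| ≤ C)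
    {ι : Type} [Countable ι] {Q : ι → Set (Euc d)} {c : ι → Euc d} {r : ι → ℝ} {b : Euc d → ℝ}
    (hr : ∀ i, 0 < r i) (hQm : ∀ i, MeasurableSet (Q i))
    (hQd : Pairwise (Function.onFun Disjoint Q))
    (hQb : ∀ i, Q i ⊆ Metric.closedBall (c i) (r i)) (hb : Integrable b volume)
    (hb0 : ∀ y, (∀ i, y ∉ Q i) → b y = 0) (hbm : ∀ i, ∫ y in Q i, b y = 0) :
    ∫⁻ x in (⋃ i, Metric.closedBall (c i) (2 * r i))ᶜ, ‖∫ y, K (x - y) * b y‖ₑ ≤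
      C * ∑' i, ∫⁻ y in Q i, ‖b y‖ₑ := by
  obtain ⟨B, hB⟩ := hK.bounded_above_of_compact_support hKs
  have hInt : ∀ x, Integrable (fun y => K (x - y) * b y) volume := fun x =>
    hb.bdd_mul (c := B) (hK.comp (by fun_prop)).aestronglyMeasurable (ae_of_all _ fun y => hB _)
  have hpt : ∀ x, ‖∫ y, K (x - y) * b y‖ₑ ≤
      ∑' i, ∫⁻ y in Q i, ENNReal.ofReal |K (x - y) - K (x - c i)| * ‖b y‖ₑ := by
    intro x
    have h1 : ∫ y, K (x - y) * b y = ∫ y in ⋃ i, Q i, K (x - y) * b y := by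
      rw [setIntegral_eq_integral_of_forall_compl_eq_zero]
      intro y hy
      rw [hb0 y (by simpa using hy), mul_zero]
    have h2 : HasSum (fun i => ∫ y in Q i, K (x - y) * b y) (∫ y in ⋃ i, Q i, K (x - y) * b y) :=
      hasSum_integral_iUnion hQm hQd (hInt x).integrableOn
    rw [h1, ← h2.tsum_eq]
    refine (enorm_tsum_le_tsum_enorm).trans ?_
    refine ENNReal.tsum_le_tsum fun i => ?_
    have h3 : ∫ y in Q i, K (x - y) * b y = ∫ y in Q i, (K (x - y) - K (x - c i)) * b y := by
      simp_rw [sub_mul]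
      rw [integral_sub (hInt x).integrableOn (hb.const_mul _).integrableOn, integral_const_mul,
        hbm i, mul_zero, sub_zero]
    rw [h3]
    refine (enorm_integral_le_lintegral_enorm _).trans (le_of_eq ?_)
    simp_rw [enorm_mul, Real.enorm_eq_ofReal_abs]
  have hm : ∀ i, AEMeasurable (Function.uncurry fun x y =>
      ENNReal.ofReal |K (x - y) - K (x - c i)| * ‖b y‖ₑ)
      ((volume.restrict (⋃ i, Metric.closedBall (c i) (2 * r i))ᶜ).prod (volume.restrict (Q i))) := by
    intro i
    have h0 : Continuous fun q : Euc d × Euc d => ENNReal.ofReal |K (q.1 - q.2) - K (q.1 - c i)| :=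
      ENNReal.continuous_ofReal.comp (continuous_abs.comp
        ((hK.comp (by fun_prop)).sub (hK.comp (by fun_prop))))
    have h1 : AEMeasurable (fun y => ‖b y‖ₑ) (volume.restrict (Q i)) := hb.1.enorm.restrict
    exact h0.aemeasurable.mul h1.comp_snd
  calc _ ≤ ∫⁻ x in (⋃ i, Metric.closedBall (c i) (2 * r i))ᶜ,
        ∑' i, ∫⁻ y in Q i, ENNReal.ofReal |K (x - y) - K (x - c i)| * ‖b y‖ₑ :=
        lintegral_mono hpt
    _ = ∑' i, ∫⁻ x in (⋃ i, Metric.closedBall (c i) (2 * r i))ᶜ,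
        ∫⁻ y in Q i, ENNReal.ofReal |K (x - y) - K (x - c i)| * ‖b y‖ₑ :=
        lintegral_tsum fun i => (hm i).lintegral_prod_right'
    _ ≤ ∑' i, C * ∫⁻ y in Q i, ‖b y‖ₑ := by
        refine ENNReal.tsum_le_tsum fun i => ?_
        rw [lintegral_lintegral_swap (hm i), ← lintegral_const_mul'' _ hb.1.enorm.restrict]
        refine setLIntegral_mono_ae' (hQm i) (ae_of_all _ fun y hy => ?_)
        rw [lintegral_mul_const']
        · gcongr
          refine le_trans ?_ (hH (r i) (c i) y (hr i) (mem_closedBall_iff_norm.1 (hQb i hy)))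
          refine lintegral_mono_set ?_
          exact compl_subset_compl.2 (subset_iUnion (fun i => Metric.closedBall (c i) (2 * r i)) i)
        · exact enorm_ne_top
    _ = _ := ENNReal.tsum_mul_left

end WeakType

section WeakType

variable {d : ℕ}

theorem eLpNorm_two_sq_eq_lintegral {X : Type*} [MeasurableSpace X] {μ : Measure X} (f : X → ℝ) :
    eLpNorm f 2 μ ^ 2 = ∫⁻ x, ‖f x‖ₑ ^ 2 ∂μ := by
  have h := eLpNorm_nnreal_pow_eq_lintegral (μ := μ) (f := f) (p := 2) two_ne_zero
  have h2 : ((2 : NNReal) : ℝ) = (2 : ℕ) := by norm_num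
  simp only [h2, ENNReal.rpow_natCast] at h
  exact h

theorem aestronglyMeasurable_convolution {K g : Euc d → ℝ} (hK : Continuous K)
    (hg : AEStronglyMeasurable g volume) :
    AEStronglyMeasurable (fun x => ∫ y, K (x - y) * g y) volume := by
  have h1 : Continuous fun q : Euc d × Euc d => K (q.1 - q.2) := hK.comp (by fun_prop)
  exact (h1.aestronglyMeasurable.mul hg.comp_snd).integral_prod_right'

/-- The weak-type estimate behind the Marcinkiewicz argument. -/
theorem exists_measure_lt_convolution_le (hd : 1 ≤ d) {C : ENNReal} (hC : C ≠ ⊤) :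
    ∃ A : ENNReal, A ≠ ⊤ ∧ ∀ K : Euc d → ℝ, Continuous K → HasCompactSupport K →
      (∀ (r : ℝ) (c y : Euc d), 0 < r → ‖y - c‖ ≤ r →
        ∫⁻ x in (Metric.closedBall c (2 * r))ᶜ, ENNReal.ofReal |K (x - y) - K (x - c)| ≤ C) →
      (∀ g : Euc d → ℝ, MemLp g 2 volume →
        eLpNorm (fun x => ∫ y, K (x - y) * g y) 2 volume ≤ C * eLpNorm g 2 volume) →
      ∀ f : Euc d → ℝ, Continuous f → HasCompactSupport f → ∀ l : ℝ, 0 < l →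
        volume {x | 2 * l < |∫ y, K (x - y) * f y|} ≤
          A * ((ENNReal.ofReal l)⁻¹ ^ 2 * (∫⁻ y in {y | |f y| ≤ l}, ‖f y‖ₑ ^ 2) +
            (ENNReal.ofReal l)⁻¹ * ∫⁻ y in {y | l / 2 < |f y|}, ‖f y‖ₑ) := by
  set B : ENNReal := C ^ 2 * (2 ^ d) ^ 2 + 2 ^ d + C * (2 * 2 ^ d) with hB
  have hBt : B ≠ ⊤ := by
    simp only [hB]
    finiteness
  refine ⟨C ^ 2 + B * 2, by finiteness, fun K hK hKs hH h2 f hf hfs l hl => ?_⟩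
  obtain ⟨ι, hι, Q, c, r, g, hr, hQm, hQd, hQb, hQv, hgm, hgb, hoff, hmean, hbQ, hUfin, hU⟩ :=
    exists_cz_decomposition hd hf hfs hl
  set U := ⋃ i, Q i with hUdef
  set V := volume U with hV
  set L := ENNReal.ofReal l with hL
  have hL0 : L ≠ 0 := by simpa [hL] using hl
  have hLt : L ≠ ⊤ := ENNReal.ofReal_ne_top
  have hUm : MeasurableSet U := MeasurableSet.iUnion hQm
  have hVsum : V = ∑' i, volume (Q i) := measure_iUnion hQd hQm
  have hfi : Integrable f volume := hf.integrable_of_hasCompactSupport hfs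
  have hpowL : ENNReal.ofReal (2 ^ d * l) = 2 ^ d * L := by
    rw [ENNReal.ofReal_mul (by positivity), ENNReal.ofReal_pow (by norm_num)]
    simp [hL]
  have hbsum : ∑' i, ∫⁻ y in Q i, ‖f y - g y‖ₑ ≤ 2 * (2 ^ d * L) * V := by
    rw [hVsum, ← ENNReal.tsum_mul_left]
    refine ENNReal.tsum_le_tsum fun i => (hbQ i).trans (le_of_eq ?_)
    rw [ENNReal.ofReal_mul (by norm_num), hpowL]
    simp
  have hbz : ∀ y, (∀ i, y ∉ Q i) → f y - g y = 0 := fun y hy => by rw [(hoff y hy).1, sub_self]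
  have hbi : Integrable (fun y => f y - g y) volume := by
    refine ⟨hfi.1.sub hgm, ?_⟩
    have h1 : ∫⁻ y, ‖f y - g y‖ₑ = ∫⁻ y in U, ‖f y - g y‖ₑ := by
      rw [setLIntegral_eq_of_support_subset]
      intro y hy
      by_contra hyU
      exact hy (by simp [hbz y (by simpa [hUdef] using hyU)])
    rw [hasFiniteIntegral_iff_enorm, h1, hUdef, lintegral_iUnion hQm hQd]
    exact hbsum.trans_lt (lt_top_iff_ne_top.2 (by finiteness))
  have hgi : Integrable g volume := by
    have h1 := hfi.sub hbi
    have h3 : (f - fun y => f y - g y) = g := by ext y; simp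
    rwa [h3] at h1
  have hg2 : ∫⁻ y, ‖g y‖ₑ ^ 2 ≤ (∫⁻ y in {y | |f y| ≤ l}, ‖f y‖ₑ ^ 2) + (2 ^ d * L) ^ 2 * V := by
    have hsm : MeasurableSet {y | |f y| ≤ l} := measurableSet_le hf.abs.measurable measurable_const
    rw [hV, ← setLIntegral_const, ← lintegral_indicator hsm, ← lintegral_indicator hUm,
      ← lintegral_add_right _ (measurable_const.indicator hUm)]
    refine lintegral_mono fun y => ?_
    by_cases hy : y ∈ U
    · refine le_trans ?_ le_add_self
      rw [indicator_of_mem hy, ← hpowL, Real.enorm_eq_ofReal_abs]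
      gcongr
      exact hgb y
    · refine le_trans ?_ le_self_add
      have := hoff y (by simpa [hUdef] using hy)
      rw [indicator_of_mem (s := {y | |f y| ≤ l}) this.2, this.1]
  have hfl2 : ∫⁻ y in {y | |f y| ≤ l}, ‖f y‖ₑ ^ 2 ≠ ⊤ := by
    have h1 : eLpNorm f 2 volume ^ 2 ≠ ⊤ :=
      ENNReal.pow_ne_top (hf.memLp_of_hasCompactSupport hfs).2.ne
    rw [eLpNorm_two_sq_eq_lintegral] at h1
    exact ne_top_of_le_ne_top h1 (setLIntegral_le_lintegral _ _)
  have hgL2 : MemLp g 2 volume := by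
    refine ⟨hgm, ?_⟩
    have h1 : eLpNorm g 2 volume ^ 2 < ⊤ := by
      rw [eLpNorm_two_sq_eq_lintegral]
      exact hg2.trans_lt (lt_top_iff_ne_top.2 (by finiteness))
    by_contra hne
    rw [not_lt, top_le_iff] at hne
    simp [hne] at h1
  obtain ⟨BK, hBK⟩ := hK.bounded_above_of_compact_support hKs
  have hInt : ∀ {u : Euc d → ℝ}, Integrable u volume → ∀ x,
      Integrable (fun y => K (x - y) * u y) volume := fun {u} hu x =>
    hu.bdd_mul (c := BK) (hK.comp (by fun_prop)).aestronglyMeasurable (ae_of_all _ fun y => hBK _)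
  set Tg : Euc d → ℝ := fun x => ∫ y, K (x - y) * g y with hTg
  set Tb : Euc d → ℝ := fun x => ∫ y, K (x - y) * (f y - g y) with hTb
  have hsplit : ∀ x, ∫ y, K (x - y) * f y = Tg x + Tb x := by
    intro x
    rw [hTg, hTb, ← integral_add (hInt hgi x) (hInt hbi x)]
    congr 1
    ext y
    ring
  have hTgm : AEStronglyMeasurable Tg volume := aestronglyMeasurable_convolution hK hgm
  have hTbm : AEStronglyMeasurable Tb volume := aestronglyMeasurable_convolution hK hbi.1
  set W := ⋃ i, Metric.closedBall (c i) (2 * r i) with hW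
  have hWm : MeasurableSet W := MeasurableSet.iUnion fun i => measurableSet_closedBall
  have e1 : volume {x | L ≤ ‖Tg x‖ₑ} ≤ L⁻¹ ^ 2 * (C ^ 2 * ∫⁻ y, ‖g y‖ₑ ^ 2) := by
    have h1 := mul_meas_ge_le_lintegral₀ (μ := volume) (hTgm.enorm.pow_const 2) (L ^ 2)
    have h3 : {x | L ^ 2 ≤ ‖Tg x‖ₑ ^ 2} = {x | L ≤ ‖Tg x‖ₑ} := by
      ext x
      simp only [Set.mem_ofPred_eq]
      exact ENNReal.pow_le_pow_left_iff two_ne_zero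
    rw [h3, ← eLpNorm_two_sq_eq_lintegral] at h1
    have h4 := h1.trans (pow_le_pow_left' (h2 g hgL2) 2)
    rw [mul_pow, eLpNorm_two_sq_eq_lintegral, mul_comm] at h4
    rw [← ENNReal.inv_pow, mul_comm, ← div_eq_mul_inv]
    exact (ENNReal.le_div_iff_mul_le (Or.inl (pow_ne_zero _ hL0)) (Or.inl (by finiteness))).2 h4
  have e2 : volume W ≤ 2 ^ d * V := by
    rw [hVsum, ← ENNReal.tsum_mul_left]
    refine (measure_iUnion_le _).trans (ENNReal.tsum_le_tsum fun i => ?_)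
    rw [Real.volume_pi_closedBall _ (by have := hr i; positivity), hQv,
      Fintype.card_fin, ← mul_assoc]
    have h1 : (2 * 2 * r i) ^ d = 2 ^ d * (2 * r i) ^ d := by
      rw [mul_assoc, mul_pow]
    rw [h1, ENNReal.ofReal_mul (by positivity), ENNReal.ofReal_pow (by norm_num)]
    simp
  have e3 : volume ({x | L ≤ ‖Tb x‖ₑ} ∩ Wᶜ) ≤ L⁻¹ * (C * (2 * (2 ^ d * L) * V)) := by
    have h1 := mul_meas_ge_le_lintegral₀ (μ := volume.restrict Wᶜ) hTbm.enorm.restrict L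
    have h3 := lintegral_convolution_compl_le hK hKs hH hr hQm hQd hQb hbi hbz hmean
    rw [Measure.restrict_apply' hWm.compl, mul_comm] at h1
    have h4 := h1.trans (h3.trans (mul_le_mul_right hbsum C))
    rw [mul_comm, ← div_eq_mul_inv]
    exact (ENNReal.le_div_iff_mul_le (Or.inl hL0) (Or.inl hLt)).2 h4
  have hsub : {x | 2 * l < |∫ y, K (x - y) * f y|} ⊆
      {x | L ≤ ‖Tg x‖ₑ} ∪ (W ∪ ({x | L ≤ ‖Tb x‖ₑ} ∩ Wᶜ)) := by
    intro x hx
    simp only [Set.mem_ofPred_eq, hsplit] at hx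
    by_cases h1 : l ≤ |Tg x|
    · left
      simp only [Set.mem_ofPred_eq, Real.enorm_eq_ofReal_abs]
      exact ENNReal.ofReal_le_ofReal h1
    · right
      by_cases hxW : x ∈ W
      · exact Or.inl hxW
      · refine Or.inr ⟨?_, hxW⟩
        simp only [Set.mem_ofPred_eq, Real.enorm_eq_ofReal_abs]
        refine ENNReal.ofReal_le_ofReal ?_
        have := abs_add_le (Tg x) (Tb x)
        linarith
  have hVH : V ≤ 2 * (L⁻¹ * ∫⁻ y in {y | l / 2 < |f y|}, ‖f y‖ₑ) := by
    have h1 : ENNReal.ofReal (l / 2) = L / 2 := by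
      rw [ENNReal.ofReal_div_of_pos two_pos]; simp [hL]
    rw [h1] at hU
    have h3 : V = 2 * (L⁻¹ * (L / 2 * V)) := by
      calc V = (L⁻¹ * L) * (2 * 2⁻¹) * V := by
            rw [ENNReal.inv_mul_cancel hL0 hLt, ENNReal.mul_inv_cancel two_ne_zero (by simp)]
            simp
        _ = _ := by rw [div_eq_mul_inv]; ring
    calc V = _ := h3
      _ ≤ _ := by gcongr
  have hLL : L⁻¹ * L = 1 := ENNReal.inv_mul_cancel hL0 hLt
  set P := ∫⁻ y in {y | |f y| ≤ l}, ‖f y‖ₑ ^ 2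
  set H := ∫⁻ y in {y | l / 2 < |f y|}, ‖f y‖ₑ
  calc volume {x | 2 * l < |∫ y, K (x - y) * f y|}
      ≤ volume {x | L ≤ ‖Tg x‖ₑ} + (volume W + volume ({x | L ≤ ‖Tb x‖ₑ} ∩ Wᶜ)) :=
        (measure_mono hsub).trans ((measure_union_le _ _).trans
          (add_le_add le_rfl (measure_union_le _ _)))
    _ ≤ L⁻¹ ^ 2 * (C ^ 2 * (P + (2 ^ d * L) ^ 2 * V)) +
          (2 ^ d * V + L⁻¹ * (C * (2 * (2 ^ d * L) * V))) := by
        refine add_le_add (e1.trans ?_) (add_le_add e2 e3)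
        gcongr
    _ = C ^ 2 * (L⁻¹ ^ 2 * P) + ((L⁻¹ * L) ^ 2 * (C ^ 2 * (2 ^ d) ^ 2) + 2 ^ d +
          (L⁻¹ * L) * (C * (2 * 2 ^ d))) * V := by ring
    _ = C ^ 2 * (L⁻¹ ^ 2 * P) + B * V := by rw [hLL, hB]; simp
    _ ≤ C ^ 2 * (L⁻¹ ^ 2 * P) + B * (2 * (L⁻¹ * H)) := by gcongr
    _ ≤ _ := by
        rw [← mul_assoc B, mul_add]
        gcongr
        · exact le_self_add
        · exact le_add_self

end WeakType

section Interpolation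

theorem lintegral_rpow_tail_le {p a : ℝ} (hp : p < 2) (ha : 0 < a) :
    ∫⁻ t in Ioi (0 : ℝ), (if a ≤ t / 2 then (ENNReal.ofReal (t / 2))⁻¹ ^ 2 else 0) *
      ENNReal.ofReal (t ^ (p - 1)) ≤ ENNReal.ofReal (4 * (2 : ℝ) ^ (p - 2) / (2 - p) * a ^ (p - 2)) := by
  have h1 : ∀ t ∈ Ioi (0 : ℝ), (if a ≤ t / 2 then (ENNReal.ofReal (t / 2))⁻¹ ^ 2 else 0) *
      ENNReal.ofReal (t ^ (p - 1)) ≤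
      (Ici (2 * a)).indicator (fun t => ENNReal.ofReal (4 * t ^ (p - 3))) t := by
    intro t ht
    rw [mem_Ioi] at ht
    split_ifs with h
    · rw [indicator_of_mem (by rw [mem_Ici]; linarith), ← ENNReal.ofReal_inv_of_pos (by positivity),
        ← ENNReal.ofReal_pow (by positivity), ← ENNReal.ofReal_mul (by positivity)]
      refine le_of_eq (congrArg _ ?_)
      have : t ^ (p - 1) = t ^ (p - 3) * t ^ 2 := by
        rw [← Real.rpow_natCast t 2, ← Real.rpow_add ht]
        congr 1
        push_cast
        ring
      rw [this]
      field_simp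
      norm_num
    · simp
  calc _ ≤ ∫⁻ t in Ioi (0 : ℝ), (Ici (2 * a)).indicator
        (fun t => ENNReal.ofReal (4 * t ^ (p - 3))) t :=
        setLIntegral_mono' measurableSet_Ioi h1
    _ ≤ ∫⁻ t, (Ici (2 * a)).indicator (fun t => ENNReal.ofReal (4 * t ^ (p - 3))) t :=
        setLIntegral_le_lintegral _ _
    _ = ∫⁻ t in Ioi (2 * a), ENNReal.ofReal (4 * t ^ (p - 3)) := by
        rw [lintegral_indicator measurableSet_Ici, restrict_Ioi_eq_restrict_Ici]
    _ = ENNReal.ofReal (∫ t in Ioi (2 * a), 4 * t ^ (p - 3)) := by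
        rw [ofReal_integral_eq_lintegral_ofReal]
        · exact (integrableOn_Ioi_rpow_of_lt (by linarith) (by positivity)).const_mul _
        · filter_upwards [ae_restrict_mem measurableSet_Ioi] with t ht
          have : 0 < t := lt_trans (by positivity) ht
          positivity
    _ = _ := by
        rw [integral_const_mul, integral_Ioi_rpow_of_lt (by linarith) (by positivity),
          Real.mul_rpow (by norm_num) ha.le]
        congr 1
        have h3 : p - 3 + 1 = p - 2 := by ring
        rw [h3]
        have h4 : p - 2 ≠ 0 := by linarith
        have h5 : 2 - p ≠ 0 := by linarith
        have h6 : p - 2 = -(2 - p) := by ring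
        field_simp
        rw [h6]

theorem lintegral_rpow_head_le {p a : ℝ} (hp : 1 < p) (ha : 0 ≤ a) :
    ∫⁻ t in Ioi (0 : ℝ), (if t / 2 / 2 < a then (ENNReal.ofReal (t / 2))⁻¹ else 0) *
      ENNReal.ofReal (t ^ (p - 1)) ≤ ENNReal.ofReal (2 * (4 : ℝ) ^ (p - 1) / (p - 1) * a ^ (p - 1)) := by
  have h1 : ∀ t ∈ Ioi (0 : ℝ), (if t / 2 / 2 < a then (ENNReal.ofReal (t / 2))⁻¹ else 0) *
      ENNReal.ofReal (t ^ (p - 1)) ≤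
      (Iic (4 * a)).indicator (fun t => ENNReal.ofReal (2 * t ^ (p - 2))) t := by
    intro t ht
    rw [mem_Ioi] at ht
    split_ifs with h
    · rw [indicator_of_mem (by rw [mem_Iic]; linarith), ← ENNReal.ofReal_inv_of_pos (by positivity),
        ← ENNReal.ofReal_mul (by positivity)]
      refine le_of_eq (congrArg _ ?_)
      have : t ^ (p - 1) = t ^ (p - 2) * t := by
        rw [← Real.rpow_add_one ht.ne']
        congr 1
        ring
      rw [this]
      field_simp
    · simp
  have hii : IntervalIntegrable (fun t : ℝ => 2 * t ^ (p - 2)) volume 0 (4 * a) :=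
    (intervalIntegral.intervalIntegrable_rpow' (by linarith)).const_mul _
  rw [intervalIntegrable_iff_integrableOn_Ioc_of_le (by positivity)] at hii
  calc _ ≤ ∫⁻ t in Ioi (0 : ℝ), (Iic (4 * a)).indicator
        (fun t => ENNReal.ofReal (2 * t ^ (p - 2))) t :=
        setLIntegral_mono' measurableSet_Ioi h1
    _ = ∫⁻ t in Ioc 0 (4 * a), ENNReal.ofReal (2 * t ^ (p - 2)) := by
        rw [lintegral_indicator measurableSet_Iic, Measure.restrict_restrict measurableSet_Iic,
          inter_comm, Ioi_inter_Iic]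
    _ = ENNReal.ofReal (∫ t in Ioc 0 (4 * a), 2 * t ^ (p - 2)) := by
        rw [ofReal_integral_eq_lintegral_ofReal hii]
        filter_upwards [ae_restrict_mem measurableSet_Ioc] with t ht
        have : 0 < t := ht.1
        positivity
    _ = _ := by
        rw [← intervalIntegral.integral_of_le (by positivity), intervalIntegral.integral_const_mul,
          integral_rpow (Or.inl (by linarith))]
        have h3 : p - 2 + 1 = p - 1 := by ring
        rw [h3, Real.mul_rpow (by norm_num) ha, Real.zero_rpow (by linarith)]
        congr 1
        ring

variable {d : ℕ}

/-- Integration in `t` of the weak-type bound. -/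
theorem exists_lintegral_weak_bound_le {p : ℝ} (hp1 : 1 < p) (hp2 : p < 2) :
    ∃ c : ENNReal, c ≠ ⊤ ∧ ∀ f : Euc d → ℝ, Measurable f →
      ∫⁻ t in Ioi (0 : ℝ), ((ENNReal.ofReal (t / 2))⁻¹ ^ 2 * (∫⁻ y in {y | |f y| ≤ t / 2}, ‖f y‖ₑ ^ 2) +
          (ENNReal.ofReal (t / 2))⁻¹ * ∫⁻ y in {y | t / 2 / 2 < |f y|}, ‖f y‖ₑ) *
            ENNReal.ofReal (t ^ (p - 1)) ≤
        c * ∫⁻ y, ‖f y‖ₑ ^ p := by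
  set c₁ : ℝ := 4 * (2 : ℝ) ^ (p - 2) / (2 - p)
  set c₂ : ℝ := 2 * (4 : ℝ) ^ (p - 1) / (p - 1)
  have hc₁ : 0 ≤ c₁ := by have : 0 < 2 - p := by linarith
                          positivity
  have hc₂ : 0 ≤ c₂ := by have : 0 < p - 1 := by linarith
                          positivity
  refine ⟨ENNReal.ofReal c₁ + ENNReal.ofReal c₂, by finiteness, fun f hf => ?_⟩
  set k₁ : ℝ → Euc d → ENNReal := fun t y =>
    (if |f y| ≤ t / 2 then (ENNReal.ofReal (t / 2))⁻¹ ^ 2 else 0) * ENNReal.ofReal (t ^ (p - 1)) *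
      ‖f y‖ₑ ^ 2 with hk₁
  set k₂ : ℝ → Euc d → ENNReal := fun t y =>
    (if t / 2 / 2 < |f y| then (ENNReal.ofReal (t / 2))⁻¹ else 0) * ENNReal.ofReal (t ^ (p - 1)) *
      ‖f y‖ₑ with hk₂
  have hm₁ : Measurable (Function.uncurry k₁) := by
    refine Measurable.mul (Measurable.mul (Measurable.ite ?_ (by fun_prop) measurable_const)
      (by fun_prop)) (by fun_prop)
    exact measurableSet_le (by fun_prop) (by fun_prop)
  have hm₂ : Measurable (Function.uncurry k₂) := by
    refine Measurable.mul (Measurable.mul (Measurable.ite ?_ (by fun_prop) measurable_const)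
      (by fun_prop)) (by fun_prop)
    exact measurableSet_lt (by fun_prop) (by fun_prop)
  have hrw : ∀ t : ℝ, ((ENNReal.ofReal (t / 2))⁻¹ ^ 2 *
      (∫⁻ y in {y | |f y| ≤ t / 2}, ‖f y‖ₑ ^ 2) +
      (ENNReal.ofReal (t / 2))⁻¹ * ∫⁻ y in {y | t / 2 / 2 < |f y|}, ‖f y‖ₑ) *
        ENNReal.ofReal (t ^ (p - 1)) = (∫⁻ y, k₁ t y) + ∫⁻ y, k₂ t y := by
    intro t
    rw [add_mul]
    congr 1
    · rw [← lintegral_indicator (measurableSet_le hf.abs measurable_const),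
        mul_assoc, mul_comm (lintegral _ _), ← mul_assoc, ← lintegral_const_mul _
          ((hf.enorm.pow_const 2).indicator (measurableSet_le hf.abs measurable_const))]
      refine lintegral_congr fun y => ?_
      by_cases h : |f y| ≤ t / 2
      · simp [hk₁, indicator, h]
      · simp [hk₁, indicator, h]
    · rw [← lintegral_indicator (measurableSet_lt measurable_const hf.abs),
        mul_assoc, mul_comm (lintegral _ _), ← mul_assoc, ← lintegral_const_mul _
          (hf.enorm.indicator (measurableSet_lt measurable_const hf.abs))]
      refine lintegral_congr fun y => ?_
      by_cases h : t / 2 / 2 < |f y|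
      · simp [hk₂, indicator, h]
      · simp [hk₂, indicator, h]
  simp_rw [hrw]
  rw [lintegral_add_left hm₁.lintegral_prod_right, lintegral_lintegral_swap hm₁.aemeasurable,
    lintegral_lintegral_swap hm₂.aemeasurable, add_mul, ← lintegral_const_mul _ (by fun_prop),
    ← lintegral_const_mul _ (by fun_prop)]
  have hfe : ∀ y, ‖f y‖ₑ = ENNReal.ofReal |f y| := fun y => Real.enorm_eq_ofReal_abs _
  refine add_le_add (lintegral_mono fun y => ?_) (lintegral_mono fun y => ?_)
  · simp only [hk₁]
    rw [lintegral_mul_const' _ _ (by finiteness)]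
    rcases eq_or_ne (f y) 0 with h0 | h0
    · simp [h0]
    have hpos : 0 < |f y| := abs_pos.2 h0
    refine (mul_le_mul_left (lintegral_rpow_tail_le hp2 hpos) _).trans (le_of_eq ?_)
    rw [hfe, ENNReal.ofReal_rpow_of_pos hpos, ← ENNReal.ofReal_pow hpos.le,
      ← ENNReal.ofReal_mul (by positivity), ← ENNReal.ofReal_mul (by positivity), mul_assoc]
    congr 2
    rw [← Real.rpow_natCast, ← Real.rpow_add hpos]
    congr 1
    push_cast
    ring
  · simp only [hk₂]
    rw [lintegral_mul_const' _ _ (by finiteness)]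
    rcases eq_or_ne (f y) 0 with h0 | h0
    · simp [h0]
    have hpos : 0 < |f y| := abs_pos.2 h0
    refine (mul_le_mul_left (lintegral_rpow_head_le hp1 hpos.le) _).trans (le_of_eq ?_)
    rw [hfe, ENNReal.ofReal_rpow_of_pos hpos,
      ← ENNReal.ofReal_mul (by positivity), ← ENNReal.ofReal_mul (by positivity), mul_assoc]
    congr 2
    rw [← Real.rpow_add_one hpos.ne']
    congr 1
    ring

theorem exists_lintegral_rpow_convolution_le (hd : 1 ≤ d) {p : ℝ} (hp1 : 1 < p) (hp2 : p < 2)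
    {C : ENNReal} (hC : C ≠ ⊤) :
    ∃ A : ENNReal, A ≠ ⊤ ∧ ∀ K : Euc d → ℝ, Continuous K → HasCompactSupport K →
      (∀ (r : ℝ) (c y : Euc d), 0 < r → ‖y - c‖ ≤ r →
        ∫⁻ x in (Metric.closedBall c (2 * r))ᶜ, ENNReal.ofReal |K (x - y) - K (x - c)| ≤ C) →
      (∀ g : Euc d → ℝ, MemLp g 2 volume →
        eLpNorm (fun x => ∫ y, K (x - y) * g y) 2 volume ≤ C * eLpNorm g 2 volume) →
      ∀ f : Euc d → ℝ, Continuous f → HasCompactSupport f →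
        ∫⁻ x, ‖∫ y, K (x - y) * f y‖ₑ ^ p ≤ A * ∫⁻ y, ‖f y‖ₑ ^ p := by
  obtain ⟨A, hA, hweak⟩ := exists_measure_lt_convolution_le hd hC
  obtain ⟨c, hc, hInt⟩ := exists_lintegral_weak_bound_le (d := d) hp1 hp2
  refine ⟨ENNReal.ofReal p * (A * c), by finiteness, fun K hK hKs hH h2 f hf hfs => ?_⟩
  have hm : AEStronglyMeasurable (fun x => ∫ y, K (x - y) * f y) volume :=
    aestronglyMeasurable_convolution hK hf.aestronglyMeasurable
  have h1 := lintegral_rpow_eq_lintegral_meas_lt_mul (volume : Measure (Euc d))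
    (f := fun x => |∫ y, K (x - y) * f y|) (ae_of_all _ fun x => abs_nonneg _)
    hm.norm.aemeasurable (lt_trans one_pos hp1)
  have h3 : ∀ x, ‖∫ y, K (x - y) * f y‖ₑ ^ p = ENNReal.ofReal (|∫ y, K (x - y) * f y| ^ p) := by
    intro x
    rw [Real.enorm_eq_ofReal_abs, ENNReal.ofReal_rpow_of_nonneg (abs_nonneg _) (by linarith)]
  simp_rw [h3]
  rw [h1, mul_assoc, mul_assoc]
  refine mul_le_mul_right ?_ _
  calc _ ≤ ∫⁻ t in Ioi (0 : ℝ), A * (((ENNReal.ofReal (t / 2))⁻¹ ^ 2 *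
        (∫⁻ y in {y | |f y| ≤ t / 2}, ‖f y‖ₑ ^ 2) +
          (ENNReal.ofReal (t / 2))⁻¹ * ∫⁻ y in {y | t / 2 / 2 < |f y|}, ‖f y‖ₑ) *
            ENNReal.ofReal (t ^ (p - 1))) := by
        refine setLIntegral_mono' measurableSet_Ioi fun t ht => ?_
        rw [mem_Ioi] at ht
        rw [← mul_assoc]
        refine mul_le_mul_left ?_ _
        have := hweak K hK hKs hH h2 f hf hfs (t / 2) (by positivity)
        rwa [mul_div_cancel₀ _ two_ne_zero] at this
    _ ≤ _ := by
        rw [lintegral_const_mul' _ _ hA]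
        refine mul_le_mul_right (hInt f hf.measurable) _

end Interpolation

section Lp

open scoped Convolution

variable {d : ℕ} {φ : Euc d → ℝ}

theorem eLpNorm_ofReal_eq_lintegral {X E : Type*} [MeasurableSpace X] [NormedAddCommGroup E]
    {μ : Measure X} {p : ℝ} (hp : 0 < p) (f : X → E) :
    eLpNorm f (ENNReal.ofReal p) μ = (∫⁻ x, ‖f x‖ₑ ^ p ∂μ) ^ (1 / p) := by
  rw [eLpNorm_eq_lintegral_rpow_enorm_toReal (by simpa using hp) ENNReal.ofReal_ne_top,
    ENNReal.toReal_ofReal hp.le]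

theorem dyadicConv_eq_convolution (J : Finset ℤ) (f : Euc d → ℝ) :
    dyadicConv φ J f = dyadicKer φ J ⋆[ContinuousLinearMap.mul ℝ ℝ] f := by
  ext x
  rw [convolution_def, dyadicConv, ← integral_sub_left_eq_self _ _ x]
  simp

theorem continuous_dyadicConv (hφ : ContDiff ℝ (⊤ : ℕ∞) φ) (hs : ∀ z, 2 < ‖z‖ → φ z = 0)
    (J : Finset ℤ) {f : Euc d → ℝ} (hf : Continuous f) : Continuous (dyadicConv φ J f) := by
  rw [dyadicConv_eq_convolution]
  exact (hasCompactSupport_dyadicKer hs J).continuous_convolution_left _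
    (contDiff_dyadicKer hφ J).continuous hf.locallyIntegrable

theorem hasCompactSupport_dyadicConv (hs : ∀ z, 2 < ‖z‖ → φ z = 0)
    (J : Finset ℤ) {f : Euc d → ℝ} (hf : HasCompactSupport f) :
    HasCompactSupport (dyadicConv φ J f) := by
  rw [dyadicConv_eq_convolution]
  exact (hasCompactSupport_dyadicKer hs J).convolution _ hf

/-- The transpose of `dyadicConv φ J` is `dyadicConv` of the reflected kernel. -/
theorem integral_dyadicConv_mul (hφ : ContDiff ℝ (⊤ : ℕ∞) φ) (hs : ∀ z, 2 < ‖z‖ → φ z = 0)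
    (J : Finset ℤ) {f h : Euc d → ℝ} (hf : Integrable f volume) (hh : Integrable h volume) :
    ∫ x, dyadicConv φ J f x * h x = ∫ y, f y * dyadicConv (fun z => φ (-z)) J h y := by
  have hK := (contDiff_dyadicKer hφ J).continuous
  obtain ⟨B, hB⟩ := hK.bounded_above_of_compact_support (hasCompactSupport_dyadicKer hs J)
  have hrefl : ∀ z, dyadicKer (fun z => φ (-z)) J z = dyadicKer φ J (-z) := fun z => by
    simp [dyadicKer, dil]
  have hInt : Integrable (Function.uncurry fun x y => dyadicKer φ J (x - y) * (h x * f y))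
      (volume.prod volume) := by
    have h1 : Continuous fun q : Euc d × Euc d => dyadicKer φ J (q.1 - q.2) :=
      hK.comp (by fun_prop)
    exact (hh.mul_prod hf).bdd_mul (c := B) h1.aestronglyMeasurable (ae_of_all _ fun q => hB _)
  calc ∫ x, dyadicConv φ J f x * h x = ∫ x, ∫ y, dyadicKer φ J (x - y) * (h x * f y) := by
        refine integral_congr_ae (ae_of_all _ fun x => ?_)
        simp only [dyadicConv]
        rw [← integral_mul_const]
        refine integral_congr_ae (ae_of_all _ fun y => ?_)
        simp only
        ring
    _ = ∫ y, ∫ x, dyadicKer φ J (x - y) * (h x * f y) := integral_integral_swap hInt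
    _ = _ := by
        refine integral_congr_ae (ae_of_all _ fun y => ?_)
        simp only [dyadicConv]
        rw [← integral_const_mul]
        refine integral_congr_ae (ae_of_all _ fun x => ?_)
        simp only [hrefl, neg_sub]
        ring

theorem exists_lintegral_rpow_dyadicConv_le_of_lt_two (hd : 1 ≤ d) {p : ℝ} (hp1 : 1 < p)
    (hp2 : p < 2) (hφ : ContDiff ℝ (⊤ : ℕ∞) φ) (hs : ∀ z, 2 < ‖z‖ → φ z = 0)
    (h0 : ∫ z, φ z = 0) :
    ∃ A : ENNReal, A ≠ ⊤ ∧ ∀ (J : Finset ℤ) (f : Euc d → ℝ), Continuous f → HasCompactSupport f →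
      ∫⁻ x, ‖dyadicConv φ J f x‖ₑ ^ p ≤ A * ∫⁻ y, ‖f y‖ₑ ^ p := by
  obtain ⟨C₁, hC₁, h1⟩ := exists_hormander hφ hs
  obtain ⟨C₂, hC₂, h2⟩ := exists_eLpNorm_two_dyadicConv_le hφ hs h0
  obtain ⟨A, hA, h3⟩ := exists_lintegral_rpow_convolution_le hd hp1 hp2
    (C := ENNReal.ofReal (C₁ + C₂)) ENNReal.ofReal_ne_top
  refine ⟨A, hA, fun J f hf hfs => h3 (dyadicKer φ J) (contDiff_dyadicKer hφ J).continuous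
    (hasCompactSupport_dyadicKer hs J) (fun r c y hr hy => (h1 J r c y hr hy).trans ?_)
    (fun g hg => (h2 J g hg).trans ?_) f hf hfs⟩
  · exact ENNReal.ofReal_le_ofReal (by linarith)
  · gcongr
    linarith

theorem exists_lintegral_rpow_dyadicConv_le_of_two_lt (hd : 1 ≤ d) {p : ℝ} (hp2 : 2 < p)
    (hφ : ContDiff ℝ (⊤ : ℕ∞) φ) (hs : ∀ z, 2 < ‖z‖ → φ z = 0) (h0 : ∫ z, φ z = 0) :
    ∃ A : ENNReal, A ≠ ⊤ ∧ ∀ (J : Finset ℤ) (f : Euc d → ℝ), Continuous f → HasCompactSupport f →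
      ∫⁻ x, ‖dyadicConv φ J f x‖ₑ ^ p ≤ A * ∫⁻ y, ‖f y‖ₑ ^ p := by
  set q : ℝ := p / (p - 1) with hq
  have hpq : p.HolderConjugate q := Real.HolderConjugate.conjExponent (by linarith)
  have hp0 : 0 < p := by linarith
  have hq1 : 1 < q := hpq.symm.lt
  have hq2 : q < 2 := by
    rw [hq, div_lt_iff₀ (by linarith)]
    linarith
  have hφ' : ContDiff ℝ (⊤ : ℕ∞) fun z => φ (-z) := hφ.comp contDiff_neg
  have hs' : ∀ z, 2 < ‖z‖ → φ (-z) = 0 := fun z hz => hs _ (by rwa [norm_neg])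
  have h0' : ∫ z, φ (-z) = 0 := by rw [integral_neg_eq_self, h0]
  obtain ⟨A, hA, hdual⟩ := exists_lintegral_rpow_dyadicConv_le_of_lt_two hd hq1 hq2 hφ' hs' h0'
  refine ⟨(A ^ (1 / q)) ^ p, by finiteness, fun J f hf hfs => ?_⟩
  set F := dyadicConv φ J f with hF
  have hFc : Continuous F := continuous_dyadicConv hφ hs J hf
  have hFs : HasCompactSupport F := hasCompactSupport_dyadicConv hs J hfs
  set h : Euc d → ℝ := fun x => F x * |F x| ^ (p - 2) with hh
  have hhc : Continuous h :=
    hFc.mul (hFc.abs.rpow_const fun x => Or.inr (by linarith))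
  have hhs : HasCompactSupport h := hFs.mul_right
  set X := ∫⁻ x, ‖F x‖ₑ ^ p with hX
  set Y := ∫⁻ x, ‖f x‖ₑ ^ p with hY
  have habs : ∀ x, |F x| ^ (p - 2) * |F x| = |F x| ^ (p - 1) := fun x => by
    rw [← Real.rpow_add_one' (abs_nonneg _) (by linarith)]
    congr 1
    ring
  have hhq : ∫⁻ x, ‖h x‖ₑ ^ q = X := by
    refine lintegral_congr fun x => ?_
    rw [Real.enorm_eq_ofReal_abs, Real.enorm_eq_ofReal_abs,
      ENNReal.ofReal_rpow_of_nonneg (abs_nonneg _) (by linarith),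
      ENNReal.ofReal_rpow_of_nonneg (abs_nonneg _) (by linarith)]
    congr 1
    rw [hh, abs_mul, abs_of_nonneg (Real.rpow_nonneg (abs_nonneg (F x)) _), mul_comm, habs,
      ← Real.rpow_mul (abs_nonneg _)]
    congr 1
    rw [hq]
    have : p - 1 ≠ 0 := by linarith
    field_simp
  have hXint : X = ‖∫ x, F x * h x‖ₑ := by
    have h1 : ∀ x, F x * h x = |F x| ^ p := fun x => by
      have h2 : |F x| ^ p = |F x| ^ (p - 1) * |F x| := by
        rw [← Real.rpow_add_one' (abs_nonneg _) (by linarith)]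
        congr 1
        ring
      rw [h2, ← habs, mul_assoc, abs_mul_abs_self, hh]
      ring
    have h2 : ∀ x, ‖F x‖ₑ ^ p = ENNReal.ofReal (F x * h x) := fun x => by
      rw [h1, Real.enorm_eq_ofReal_abs, ENNReal.ofReal_rpow_of_nonneg (abs_nonneg _) (by linarith)]
    have h3 : ∀ x, 0 ≤ F x * h x := fun x => by rw [h1]; positivity
    rw [hX, Real.enorm_eq_ofReal_abs, abs_of_nonneg (integral_nonneg h3),
      ofReal_integral_eq_lintegral_ofReal _ (ae_of_all _ h3)]
    · exact lintegral_congr h2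
    · exact (hFc.mul hhc).integrable_of_hasCompactSupport hFs.mul_right
  have hXfin : X ≠ ⊤ := by
    have := (hFc.memLp_of_hasCompactSupport (p := ENNReal.ofReal p) (μ := volume) hFs).2
    rw [eLpNorm_ofReal_eq_lintegral hp0] at this
    intro htop
    rw [← hX, htop, ENNReal.top_rpow_of_pos (by positivity)] at this
    exact lt_irrefl _ this
  have hmain : X ≤ Y ^ (1 / p) * (A * X) ^ (1 / q) := by
    have h1 := integral_dyadicConv_mul hφ hs J (hf.integrable_of_hasCompactSupport hfs)
      (hhc.integrable_of_hasCompactSupport hhs)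
    refine (hXint.le.trans (le_of_eq (congrArg _ h1))).trans ?_
    refine (enorm_integral_le_lintegral_enorm _).trans ?_
    simp_rw [enorm_mul]
    refine (ENNReal.lintegral_mul_le_Lp_mul_Lq volume hpq hf.enorm.aemeasurable
      (continuous_dyadicConv hφ' hs' J hhc).enorm.aemeasurable).trans ?_
    have := hdual J h hhc hhs
    rw [hhq] at this
    gcongr
  rcases eq_or_ne X 0 with hX0 | hX0
  · rw [hX0]; exact zero_le
  have hsplit : X = X ^ (1 / p) * X ^ (1 / q) := by
    rw [← ENNReal.rpow_add _ _ hX0 hXfin, one_div, one_div, hpq.inv_add_inv_eq_one,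
      ENNReal.rpow_one]
  have hq' : X ^ (1 / q) ≠ 0 := by simp [hX0, hXfin]
  have hq'' : X ^ (1 / q) ≠ ⊤ := by finiteness
  have h5 : X ^ (1 / p) ≤ Y ^ (1 / p) * A ^ (1 / q) := by
    have h6 : X ^ (1 / p) * X ^ (1 / q) ≤ (Y ^ (1 / p) * A ^ (1 / q)) * X ^ (1 / q) := by
      rw [← hsplit, mul_assoc, ← ENNReal.mul_rpow_of_nonneg _ _ (by positivity)]
      exact hmain
    exact (ENNReal.mul_le_mul_iff_left hq' hq'').1 h6
  have h7 := ENNReal.rpow_le_rpow h5 hp0.le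
  rw [ENNReal.mul_rpow_of_nonneg _ _ hp0.le, ← ENNReal.rpow_mul, ← ENNReal.rpow_mul,
    one_div_mul_cancel hp0.ne', ENNReal.rpow_one, ENNReal.rpow_one, mul_comm] at h7
  exact h7

/-- Calderón–Zygmund `L^p` boundedness of `dyadicConv`, uniform in the set of scales. -/
theorem exists_eLpNorm_dyadicConv_le (hd : 1 ≤ d) {p : ℝ} (hp : 1 < p)
    (hφ : ContDiff ℝ (⊤ : ℕ∞) φ) (hs : ∀ z, 2 < ‖z‖ → φ z = 0) (h0 : ∫ z, φ z = 0) :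
    ∃ C : ℝ, 0 < C ∧ ∀ (J : Finset ℤ) (f : Euc d → ℝ), Continuous f → HasCompactSupport f →
      eLpNorm (dyadicConv φ J f) (ENNReal.ofReal p) volume ≤
        ENNReal.ofReal C * eLpNorm f (ENNReal.ofReal p) volume := by
  have hp0 : 0 < p := by linarith
  rcases eq_or_ne p 2 with rfl | hne
  · obtain ⟨C, hC, h⟩ := exists_eLpNorm_two_dyadicConv_le hφ hs h0
    refine ⟨C, hC, fun J f hf hfs => ?_⟩
    have h2 : ENNReal.ofReal 2 = 2 := by simp
    rw [h2]
    exact h J f (hf.memLp_of_hasCompactSupport hfs)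
  obtain ⟨A, hA, h⟩ : ∃ A : ENNReal, A ≠ ⊤ ∧ ∀ (J : Finset ℤ) (f : Euc d → ℝ), Continuous f →
      HasCompactSupport f → ∫⁻ x, ‖dyadicConv φ J f x‖ₑ ^ p ≤ A * ∫⁻ y, ‖f y‖ₑ ^ p := by
    rcases lt_or_gt_of_ne hne with hlt | hgt
    · exact exists_lintegral_rpow_dyadicConv_le_of_lt_two hd hp hlt hφ hs h0
    · exact exists_lintegral_rpow_dyadicConv_le_of_two_lt hd hgt hφ hs h0
  refine ⟨(A ^ (1 / p)).toReal + 1, by positivity, fun J f hf hfs => ?_⟩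
  rw [eLpNorm_ofReal_eq_lintegral hp0, eLpNorm_ofReal_eq_lintegral hp0]
  refine (ENNReal.rpow_le_rpow (h J f hf hfs) (by positivity)).trans ?_
  rw [ENNReal.mul_rpow_of_nonneg _ _ (by positivity)]
  gcongr
  rw [ENNReal.ofReal_add ENNReal.toReal_nonneg zero_le_one, ENNReal.ofReal_toReal (by finiteness)]
  exact le_self_add

end Lp

section Kernel

variable {d : ℕ} {k : Euc d → ℝ}

theorem aestronglyMeasurable_of_contDiffOn_ne_zero (hd : 1 ≤ d)
    (hk : ContDiffOn ℝ (⊤ : ℕ∞) k {x : Euc d | x ≠ 0}) : AEStronglyMeasurable k volume := by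
  have : Nonempty (Fin d) := ⟨⟨0, hd⟩⟩
  have h := hk.continuousOn.aestronglyMeasurable (μ := volume)
    (isOpen_ne (x := (0 : Euc d))).measurableSet
  have h2 : volume.restrict {x : Euc d | x ≠ 0} = volume := by
    rw [Measure.restrict_eq_self_of_ae_mem]
    rw [ae_iff]
    simp
  rwa [h2] at h

theorem norm_inv_smul_self {z : Euc d} (hz : z ≠ 0) : ‖‖z‖⁻¹ • z‖ = 1 := by
  rw [norm_smul, norm_inv, norm_norm, inv_mul_cancel₀ (norm_ne_zero_iff.2 hz)]

theorem exists_abs_le_inv_norm_pow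
    (hk : ContDiffOn ℝ (⊤ : ℕ∞) k {x : Euc d | x ≠ 0})
    (hk_hom : ∀ c : ℝ, 0 < c → ∀ x : Euc d, x ≠ 0 → k (c • x) = c ^ (-(d : ℝ)) * k x) :
    ∃ B : ℝ, 0 < B ∧ ∀ z, z ≠ 0 → |k z| ≤ B * (‖z‖ ^ d)⁻¹ := by
  have hc : ContinuousOn k (Metric.sphere 0 1) := hk.continuousOn.mono fun z hz => by
    rintro rfl
    simp at hz
  obtain ⟨B, hB⟩ := (isCompact_sphere (0 : Euc d) 1).exists_bound_of_continuousOn hc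
  refine ⟨max B 1, by positivity, fun z hz => ?_⟩
  have hz' := norm_pos_iff.2 hz
  have h1 := hk_hom (‖z‖⁻¹) (by positivity) z hz
  have h2 := hB (‖z‖⁻¹ • z) (by simpa using norm_inv_smul_self hz)
  rw [h1, Real.rpow_neg (by positivity), Real.rpow_natCast, Real.norm_eq_abs, abs_mul,
    abs_of_pos (by positivity), inv_pow, inv_inv] at h2
  rw [← div_eq_mul_inv, le_div_iff₀ (by positivity), mul_comm]
  exact h2.trans (le_max_left _ _)

/-- A smooth cutoff equal to one on the unit ball and supported in the ball of radius two. -/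
def cutoff (d : ℕ) : ContDiffBump (0 : Euc d) := ⟨1, 2, one_pos, one_lt_two⟩

theorem cutoff_eq_one {z : Euc d} (hz : ‖z‖ ≤ 1) : cutoff d z = 1 :=
  (cutoff d).one_of_mem_closedBall (by simpa [cutoff] using hz)

theorem cutoff_eq_zero {z : Euc d} (hz : 2 ≤ ‖z‖) : cutoff d z = 0 :=
  (cutoff d).zero_of_le_dist (by simpa [cutoff] using hz)

/-- The unit-scale piece of the dyadic decomposition of a homogeneous kernel. -/
def kerPiece (k : Euc d → ℝ) (z : Euc d) : ℝ := k z * (cutoff d z - cutoff d ((2 : ℝ) • z))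

theorem kerPiece_eq_zero {z : Euc d} (hz : 2 < ‖z‖) : kerPiece k z = 0 := by
  rw [kerPiece, cutoff_eq_zero hz.le, cutoff_eq_zero, sub_self, mul_zero]
  rw [norm_smul, Real.norm_of_nonneg zero_le_two]
  linarith

theorem contDiff_kerPiece (hk : ContDiffOn ℝ (⊤ : ℕ∞) k {x : Euc d | x ≠ 0}) :
    ContDiff ℝ (⊤ : ℕ∞) (kerPiece k) := by
  rw [contDiff_iff_contDiffAt]
  intro z
  by_cases hz : z = 0
  · have h : kerPiece k =ᶠ[𝓝 z] fun _ => 0 := by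
      filter_upwards [Metric.ball_mem_nhds z (show (0 : ℝ) < 1 / 2 by norm_num)] with w hw
      have hw' : ‖w‖ < 1 / 2 := by simpa [hz] using hw
      rw [kerPiece, cutoff_eq_one (by linarith), cutoff_eq_one, sub_self, mul_zero]
      rw [norm_smul, Real.norm_of_nonneg zero_le_two]
      linarith
    exact contDiffAt_const.congr_of_eventuallyEq h
  · have h1 : ContDiffAt ℝ (⊤ : ℕ∞) k z := hk.contDiffAt (isOpen_ne.mem_nhds hz)
    exact h1.mul ((cutoff d).contDiff.contDiffAt.sub
      ((cutoff d).contDiff.contDiffAt.comp z (contDiff_const_smul (2 : ℝ)).contDiffAt))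

theorem dil_kerPiece
    (hk_hom : ∀ c : ℝ, 0 < c → ∀ x : Euc d, x ≠ 0 → k (c • x) = c ^ (-(d : ℝ)) * k x)
    {s : ℝ} (hs : 0 < s) (z : Euc d) :
    dil (kerPiece k) s z = k z * (cutoff d (s⁻¹ • z) - cutoff d ((2 * s⁻¹) • z)) := by
  rw [dil, kerPiece, smul_smul]
  by_cases hz : z = 0
  · simp [hz]
  · rw [hk_hom _ (by positivity) z hz, Real.rpow_neg (by positivity), Real.rpow_natCast, inv_pow,
      inv_inv]
    field_simp

theorem dyadicKer_kerPiece
    (hk_hom : ∀ c : ℝ, 0 < c → ∀ x : Euc d, x ≠ 0 → k (c • x) = c ^ (-(d : ℝ)) * k x)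
    (N : ℕ) (z : Euc d) :
    dyadicKer (kerPiece k) (Finset.Icc (-(N : ℤ)) N) z =
      k z * (cutoff d (((2 : ℝ) ^ N)⁻¹ • z) - cutoff d ((2 : ℝ) ^ (N + 1) • z)) := by
  rw [dyadicKer]
  induction N with
  | zero => simp [dil_kerPiece hk_hom]
  | succ n ih =>
    have h : Finset.Icc (-((n + 1 : ℕ) : ℤ)) ((n + 1 : ℕ) : ℤ) =
        insert (-((n : ℤ) + 1)) (insert ((n : ℤ) + 1) (Finset.Icc (-(n : ℤ)) n)) := by
      ext j
      simp only [Finset.mem_Icc, Finset.mem_insert]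
      omega
    rw [h, Finset.sum_insert (by simp; omega), Finset.sum_insert (by simp), ih,
      dil_kerPiece hk_hom (by positivity), dil_kerPiece hk_hom (by positivity)]
    have e1 : ((2 : ℝ) ^ (-((n : ℤ) + 1)))⁻¹ = 2 ^ (n + 1) := by
      rw [zpow_neg, inv_inv]; norm_cast
    have e2 : ((2 : ℝ) ^ ((n : ℤ) + 1))⁻¹ = (2 ^ (n + 1))⁻¹ := by norm_cast
    have e3 : (2 : ℝ) * (2 ^ (n + 1))⁻¹ = (2 ^ n)⁻¹ := by
      rw [pow_succ]; field_simp
    have e4 : (2 : ℝ) * 2 ^ (n + 1) = 2 ^ (n + 1 + 1) := by ring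
    rw [e1, e2, e3, e4]
    ring

theorem abs_dyadicKer_kerPiece_le
    (hk_hom : ∀ c : ℝ, 0 < c → ∀ x : Euc d, x ≠ 0 → k (c • x) = c ^ (-(d : ℝ)) * k x)
    (N : ℕ) (z : Euc d) :
    |dyadicKer (kerPiece k) (Finset.Icc (-(N : ℤ)) N) z| ≤ |k z| := by
  rw [dyadicKer_kerPiece hk_hom, abs_mul]
  refine mul_le_of_le_one_right (abs_nonneg _) (abs_le.2 ⟨?_, ?_⟩)
  · linarith [(cutoff d).nonneg (x := (((2 : ℝ) ^ N)⁻¹ • z)),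
      (cutoff d).le_one (x := ((2 : ℝ) ^ (N + 1) • z))]
  · linarith [(cutoff d).le_one (x := (((2 : ℝ) ^ N)⁻¹ • z)),
      (cutoff d).nonneg (x := ((2 : ℝ) ^ (N + 1) • z))]

theorem tendsto_dyadicKer_kerPiece
    (hk_hom : ∀ c : ℝ, 0 < c → ∀ x : Euc d, x ≠ 0 → k (c • x) = c ^ (-(d : ℝ)) * k x)
    {z : Euc d} (hz : z ≠ 0) :
    Tendsto (fun N : ℕ => dyadicKer (kerPiece k) (Finset.Icc (-(N : ℤ)) N) z) atTop
      (𝓝 (k z)) := by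
  have hz' := norm_pos_iff.2 hz
  refine tendsto_const_nhds.congr' ?_
  have h2 := tendsto_pow_atTop_atTop_of_one_lt (one_lt_two (α := ℝ))
  filter_upwards [h2.eventually_ge_atTop ‖z‖, h2.eventually_ge_atTop (2 / ‖z‖)] with N h3 h4
  rw [dyadicKer_kerPiece hk_hom, cutoff_eq_one, cutoff_eq_zero, sub_zero, mul_one]
  · rw [norm_smul, Real.norm_of_nonneg (by positivity), pow_succ]
    rw [div_le_iff₀ hz'] at h4
    nlinarith
  · rw [norm_smul, norm_inv, Real.norm_of_nonneg (by positivity), inv_mul_le_one₀ (by positivity)]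
    exact h3

theorem integral_kerPiece (hd : 1 ≤ d)
    (hk : ContDiffOn ℝ (⊤ : ℕ∞) k {x : Euc d | x ≠ 0})
    (hk_hom : ∀ c : ℝ, 0 < c → ∀ x : Euc d, x ≠ 0 → k (c • x) = c ^ (-(d : ℝ)) * k x)
    (hk_mean : ∀ r₁ r₂ : ℝ, 0 < r₁ → r₁ ≤ r₂ →
      (∫ z in {z : Euc d | r₁ ≤ ‖z‖ ∧ ‖z‖ ≤ r₂}, k z) = 0) :
    ∫ z, kerPiece k z = 0 := by
  have : Nonempty (Fin d) := ⟨⟨0, hd⟩⟩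
  obtain ⟨B, hB0, hB⟩ := exists_abs_le_inv_norm_pow hk hk_hom
  have hkm := aestronglyMeasurable_of_contDiffOn_ne_zero hd hk
  set χ : Euc d → ℝ := (Metric.closedBall 0 1).indicator fun _ => 1 with hχ
  have hχ1 : ∀ z : Euc d, ‖z‖ ≤ 1 → χ z = 1 := fun z hz => by simp [hχ, hz]
  have hχ0 : ∀ z : Euc d, 1 < ‖z‖ → χ z = 0 := fun z hz => by simp [hχ, hz]
  have hχm : AEStronglyMeasurable χ volume :=
    (stronglyMeasurable_const.indicator measurableSet_closedBall).aestronglyMeasurable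
  set u : Euc d → ℝ := fun z => k z * (cutoff d z - χ z) with hu
  have hubd : ∀ z, |u z| ≤ (Metric.closedBall (0 : Euc d) 2).indicator (fun _ => B) z := by
    intro z
    simp only [hu]
    rcases le_or_gt ‖z‖ 1 with h | h
    · rw [cutoff_eq_one h, hχ1 z h, sub_self, mul_zero, abs_zero]
      exact indicator_nonneg (fun _ _ => hB0.le) _
    · rcases le_or_gt ‖z‖ 2 with h2 | h2
      · rw [indicator_of_mem (by simpa using h2), hχ0 z h, sub_zero, abs_mul]
        have hz : z ≠ 0 := by rintro rfl; simp at h; linarith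
        have h3 := hB z hz
        have h4 : (‖z‖ ^ d)⁻¹ ≤ 1 := inv_le_one_of_one_le₀ (one_le_pow₀ h.le)
        have h5 : |cutoff d z| ≤ 1 := by
          rw [abs_of_nonneg (cutoff d).nonneg]; exact (cutoff d).le_one
        calc |k z| * |cutoff d z| ≤ B * (‖z‖ ^ d)⁻¹ * 1 := by gcongr
          _ ≤ B * 1 * 1 := by gcongr
          _ = B := by ring
      · rw [cutoff_eq_zero h2.le, hχ0 z h, sub_self, mul_zero, abs_zero]
        exact indicator_nonneg (fun _ _ => hB0.le) _
  have hui : Integrable u := by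
    refine Integrable.mono' ((integrable_indicator_iff measurableSet_closedBall).2
      (integrableOn_const (measure_closedBall_lt_top.ne)))
      (hkm.mul ((cutoff d).continuous.aestronglyMeasurable.sub hχm)) (ae_of_all _ hubd)
  set v : Euc d → ℝ := fun z => 2 ^ d * u ((2 : ℝ) • z) with hv
  have hvi : Integrable v := (hui.comp_smul two_ne_zero).const_mul _
  have huv : ∫ z, v z = ∫ z, u z := by
    simpa [dil, hv] using integral_dil (φ := u) (s := (2 : ℝ)⁻¹) (by norm_num)
  have hae : kerPiece k =ᵐ[volume] fun z => u z - v z +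
      ({z : Euc d | 1 / 2 ≤ ‖z‖ ∧ ‖z‖ ≤ 1}).indicator k z := by
    have hs : ∀ᵐ z : Euc d, ‖z‖ ≠ 1 / 2 := by
      have := Measure.addHaar_sphere_of_ne_zero (volume : Measure (Euc d)) 0
        (show (1 / 2 : ℝ) ≠ 0 by norm_num)
      rw [ae_iff]
      refine measure_mono_null (fun z hz => ?_) this
      simpa using hz
    have h0 : ∀ᵐ z : Euc d, z ≠ 0 := by rw [ae_iff]; simp
    filter_upwards [hs, h0] with z hz hz0
    have e : k ((2 : ℝ) • z) * 2 ^ d = k z := by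
      rw [hk_hom 2 two_pos z hz0, Real.rpow_neg two_pos.le, Real.rpow_natCast]
      field_simp
    have hvz : v z = k z * (cutoff d ((2 : ℝ) • z) - χ ((2 : ℝ) • z)) := by
      rw [← e]; simp only [hv, hu]; ring
    have hn : ‖(2 : ℝ) • z‖ = 2 * ‖z‖ := by rw [norm_smul, Real.norm_of_nonneg zero_le_two]
    rw [hvz, kerPiece]
    simp only [hu]
    rcases le_or_gt ‖z‖ 1 with h | h
    · rcases lt_or_gt_of_ne hz with h' | h'
      · rw [hχ1 z h, hχ1 _ (by rw [hn]; linarith), indicator_of_notMem (by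
          simp only [mem_ofPred_eq, not_and]; intro; linarith)]
        ring
      · rw [hχ1 z h, hχ0 _ (by rw [hn]; linarith), indicator_of_mem (by
          simp only [mem_ofPred_eq]; constructor <;> linarith)]
        ring
    · rw [hχ0 z h, hχ0 _ (by rw [hn]; linarith), indicator_of_notMem (by
          simp only [mem_ofPred_eq, not_and]; intro; linarith)]
      ring
  have hms : MeasurableSet {z : Euc d | 1 / 2 ≤ ‖z‖ ∧ ‖z‖ ≤ 1} :=
    ((isClosed_le continuous_const continuous_norm).inter
      (isClosed_le continuous_norm continuous_const)).measurableSet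
  have hki : Integrable (({z : Euc d | 1 / 2 ≤ ‖z‖ ∧ ‖z‖ ≤ 1}).indicator k) := by
    have h1 : Integrable (kerPiece k) :=
      (contDiff_kerPiece hk).continuous.integrable_of_hasCompactSupport
        (hasCompactSupport_of_forall_norm fun z => kerPiece_eq_zero)
    refine (h1.sub (hui.sub hvi)).congr ?_
    filter_upwards [hae] with z hz
    simp only [Pi.sub_apply, hz]
    ring
  have huvi : Integrable fun z => u z - v z := hui.sub hvi
  rw [integral_congr_ae hae, integral_add huvi hki, integral_sub hui hvi, huv,
    integral_indicator hms, hk_mean _ _ (by norm_num) (by norm_num)]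
  simp

end Kernel

section Commutator

variable {d : ℕ} {φ : Euc d → ℝ}

theorem integral_fderiv_eq_zero {g : Euc d → ℝ} (hg : ContDiff ℝ 1 g) (hc : HasCompactSupport g)
    (v : Euc d) : ∫ y, fderiv ℝ g y v = 0 := by
  have hi : Integrable (fun y => fderiv ℝ g y v) :=
    ((hg.continuous_fderiv one_ne_zero).clm_apply continuous_const).integrable_of_hasCompactSupport
      (hc.fderiv_apply ℝ v)
  have h := integral_mul_fderiv_eq_neg_fderiv_mul_of_integrable (μ := (volume : Measure (Euc d)))
    (f := fun _ => (1 : ℝ)) (g := g) (v := v) (by simp) (by simpa using hi)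
    (by simpa using hg.continuous.integrable_of_hasCompactSupport hc)
    (fun x _ => differentiableAt_const _) (fun x _ => hg.differentiable one_ne_zero x)
  simpa using h

theorem fderiv_apply_coord {V : Euc d → Euc d} {y : Euc d} (hV : DifferentiableAt ℝ V y) (j : Fin d)
    (v : Euc d) : fderiv ℝ (fun y => V y j) y v = fderiv ℝ V y v j := by
  rw [fderiv_apply hV]
  rfl

theorem integral_divVec_eq_zero {V : Euc d → Euc d} (hV : ContDiff ℝ 1 V)
    (hc : HasCompactSupport V) : ∫ y, divVec V y = 0 := by
  have hVj : ∀ j, ContDiff ℝ 1 fun y => V y j := fun j => contDiff_pi.1 hV j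
  have hcj : ∀ j, HasCompactSupport fun y => V y j := fun j => 
    hc.comp_left (g := fun v : Euc d => v j) rfl
  have h : ∀ y, divVec V y = ∑ j, fderiv ℝ (fun y => V y j) y (Pi.single j 1) := fun y =>
    Finset.sum_congr rfl fun j _ =>
      (fderiv_apply_coord (hV.differentiable one_ne_zero y) j _).symm
  simp only [h]
  rw [integral_finsetSum]
  · exact Finset.sum_eq_zero fun j _ => integral_fderiv_eq_zero (hVj j) (hcj j) _
  · exact fun j _ => (((hVj j).continuous_fderiv one_ne_zero).clm_apply
      continuous_const).integrable_of_hasCompactSupport ((hcj j).fderiv_apply ℝ _)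

theorem clm_apply_eq_sum (A : Euc d →L[ℝ] ℝ) (v : Euc d) :
    A v = ∑ j, A (Pi.single j 1) * v j := by
  conv_lhs => rw [pi_eq_sum_univ' v]
  simp [mul_comm]

theorem divVec_smul {g : Euc d → ℝ} {W : Euc d → Euc d} {y : Euc d} (hg : DifferentiableAt ℝ g y)
    (hW : DifferentiableAt ℝ W y) :
    divVec (fun y => g y • W y) y = g y * divVec W y + fderiv ℝ g y (W y) := by
  have h : fderiv ℝ (fun y => g y • W y) y =
      g y • fderiv ℝ W y + (fderiv ℝ g y).smulRight (W y) := fderiv_smul hg hW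
  rw [clm_apply_eq_sum, divVec, h, divVec, Finset.mul_sum, ← Finset.sum_add_distrib]
  simp

variable {α M : ℝ} {η : Euc d → Euc d}

theorem InC1a.nonneg (hη : InC1a α M η) : 0 ≤ M := (norm_nonneg _).trans (hη.2.1 0)

theorem InCa.continuous {F : Type*} [NormedAddCommGroup F] {f : Euc d → F} (hα : 0 < α)
    (hf : InCa α M f) : Continuous f := by
  rw [continuous_iff_continuousAt]
  intro x
  rw [ContinuousAt, tendsto_iff_norm_sub_tendsto_zero]
  have h : Tendsto (fun y : Euc d => M * ‖y - x‖ ^ α) (𝓝 x) (𝓝 0) := by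
    have : Continuous fun y : Euc d => M * ‖y - x‖ ^ α :=
      continuous_const.mul ((continuous_norm.comp (continuous_id.sub continuous_const)).rpow_const
        fun _ => Or.inr hα.le)
    simpa [Real.zero_rpow hα.ne'] using this.tendsto x
  exact squeeze_zero (fun _ => norm_nonneg _) (fun y => hf.2 y x) h

theorem InC1a.contDiff (hα : 0 < α) (hη : InC1a α M η) : ContDiff ℝ 1 η :=
  contDiff_one_iff_fderiv.2 ⟨hη.1, hη.2.2.continuous hα⟩

theorem InC1a.norm_sub_le (hη : InC1a α M η) (x y : Euc d) : ‖η x - η y‖ ≤ M * ‖x - y‖ :=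
  convex_univ.norm_image_sub_le_of_norm_fderiv_le (fun z _ => hη.1 z) (fun z _ => hη.2.2.1 z)
    (mem_univ y) (mem_univ x)

theorem InC1a.norm_sub_sub_le (hα : 0 < α) (hη : InC1a α M η) (x y : Euc d) :
    ‖η x - η y - fderiv ℝ η y (x - y)‖ ≤ M * ‖x - y‖ ^ α * ‖x - y‖ := by
  refine (convex_closedBall y ‖x - y‖).norm_image_sub_le_of_norm_fderiv_le' (fun z _ => hη.1 z)
    (fun z hz => (hη.2.2.2 z y).trans ?_) (by simp) (by simp [dist_eq_norm])
  have := hη.nonneg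
  gcongr
  simpa [dist_eq_norm] using hz

theorem InC1a.abs_fderiv_single_le (hη : InC1a α M η) (y : Euc d) (j i : Fin d) :
    |fderiv ℝ η y (Pi.single j 1) i| ≤ M := by
  refine (norm_le_pi_norm (fderiv ℝ η y (Pi.single j 1)) i).trans
    (((fderiv ℝ η y).le_opNorm _).trans ?_)
  have h1 : ‖(Pi.single j 1 : Euc d)‖ = 1 := by rw [Pi.norm_single, norm_one]
  rw [h1, mul_one]
  exact hη.2.2.1 y

theorem InC1a.abs_divVec_le (hη : InC1a α M η) (y : Euc d) : |divVec η y| ≤ d * M := by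
  refine (Finset.abs_sum_le_sum_abs _ _).trans ?_
  refine (Finset.sum_le_sum fun j _ => hη.abs_fderiv_single_le y j j).trans_eq ?_
  simp

theorem InC1a.continuous_fderiv_single (hα : 0 < α) (hη : InC1a α M η) (j i : Fin d) :
    Continuous fun y => fderiv ℝ η y (Pi.single j 1) i :=
  (continuous_apply i).comp ((hη.2.2.continuous hα).clm_apply continuous_const)

theorem InC1a.continuous_divVec (hα : 0 < α) (hη : InC1a α M η) : Continuous (divVec η) :=
  continuous_finsetSum _ fun j _ => hη.continuous_fderiv_single hα j j

/-- The kernel of the commutator of `η · ∇` with convolution by `dil φ s`. -/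
def commKer (φ : Euc d → ℝ) (η : Euc d → Euc d) (s : ℝ) (x y : Euc d) : ℝ :=
  fderiv ℝ (dil φ s) (x - y) (η x - η y) + dil φ s (x - y) * divVec η y

theorem fderiv_dil (hφ : ContDiff ℝ (⊤ : ℕ∞) φ) (s : ℝ) (z : Euc d) :
    fderiv ℝ (dil φ s) z = (s⁻¹ ^ d * s⁻¹) • fderiv ℝ φ (s⁻¹ • z) := by
  have h1 : HasFDerivAt (fun z : Euc d => s⁻¹ • z) (s⁻¹ • ContinuousLinearMap.id ℝ (Euc d)) z :=
    (hasFDerivAt_id z).const_smul s⁻¹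
  have h2 := ((hφ.differentiable (by simp)) (s⁻¹ • z)).hasFDerivAt.comp z h1
  have h3 := (h2.const_mul (s⁻¹ ^ d)).fderiv
  have : dil φ s = fun z => s⁻¹ ^ d * (φ ∘ fun z => s⁻¹ • z) z := rfl
  rw [this, h3]
  ext v
  simp
  ring

theorem fderiv_comp_const_sub_left {g : Euc d → ℝ} (hg : Differentiable ℝ g) (x y v : Euc d) :
    fderiv ℝ (fun y => g (x - y)) y v = -fderiv ℝ g (x - y) v := by
  have h1 : HasFDerivAt (fun y : Euc d => x - y) (-ContinuousLinearMap.id ℝ (Euc d)) y :=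
    (hasFDerivAt_id y).const_sub x
  have h2 := (hg (x - y)).hasFDerivAt.comp y h1
  have h3 : fderiv ℝ (fun y => g (x - y)) y = _ := h2.fderiv
  rw [h3]
  simp

theorem hasCompactSupport_dil_sub (hs : ∀ z, 2 < ‖z‖ → φ z = 0) {s : ℝ} (hs0 : 0 < s) (x : Euc d) :
    HasCompactSupport fun y => dil φ s (x - y) :=
  HasCompactSupport.intro (isCompact_closedBall x (2 * s)) fun y hy =>
    dil_eq_zero hs hs0 (by simpa [dist_eq_norm, norm_sub_rev] using hy)

theorem fderiv_dil_eq_zero (hs : ∀ z, 2 < ‖z‖ → φ z = 0) {s : ℝ} (hs0 : 0 < s) {z : Euc d}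
    (hz : 2 * s < ‖z‖) : fderiv ℝ (dil φ s) z = 0 := by
  have h : dil φ s =ᶠ[𝓝 z] fun _ => 0 := by
    filter_upwards [(isOpen_lt continuous_const continuous_norm).mem_nhds hz] with w hw
    exact dil_eq_zero hs hs0 hw
  rw [h.fderiv_eq]
  simp

theorem commKer_eq_zero (hs : ∀ z, 2 < ‖z‖ → φ z = 0) {s : ℝ} (hs0 : 0 < s) {x y : Euc d}
    (hxy : 2 * s < ‖x - y‖) : commKer φ η s x y = 0 := by
  rw [commKer, fderiv_dil_eq_zero hs hs0 hxy, dil_eq_zero hs hs0 hxy]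
  simp

theorem continuous_fderiv_dil (hφ : ContDiff ℝ (⊤ : ℕ∞) φ) (s : ℝ) :
    Continuous (fderiv ℝ (dil φ s)) :=
  (contDiff_dil hφ s).continuous_fderiv (by simp)

theorem continuous_commKer (hα : 0 < α) (hη : InC1a α M η) (hφ : ContDiff ℝ (⊤ : ℕ∞) φ) (s : ℝ)
    (x : Euc d) : Continuous (commKer φ η s x) := by
  have h1 : Continuous fun y : Euc d => x - y := continuous_const.sub continuous_id
  exact (((continuous_fderiv_dil hφ s).comp h1).clm_apply
    (continuous_const.sub (hη.contDiff hα).continuous)).add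
      (((contDiff_dil hφ s).continuous.comp h1).mul (hη.continuous_divVec hα))

theorem hasCompactSupport_commKer (hs : ∀ z, 2 < ‖z‖ → φ z = 0) {s : ℝ} (hs0 : 0 < s) (x : Euc d) :
    HasCompactSupport (commKer φ η s x) :=
  HasCompactSupport.intro (isCompact_closedBall x (2 * s)) fun y hy =>
    commKer_eq_zero hs hs0 (by simpa [dist_eq_norm, norm_sub_rev] using hy)

theorem integrable_commKer_mul (hα : 0 < α) (hη : InC1a α M η) (hφ : ContDiff ℝ (⊤ : ℕ∞) φ)
    (hs : ∀ z, 2 < ‖z‖ → φ z = 0) {s : ℝ} (hs0 : 0 < s) (x : Euc d) {σ : Euc d → ℝ}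
    (hσ : Continuous σ) : Integrable fun y => commKer φ η s x y * σ y :=
  ((continuous_commKer hα hη hφ s x).mul hσ).integrable_of_hasCompactSupport
    (hasCompactSupport_commKer hs hs0 x).mul_right

/-- Integration by parts moves the derivative from `σ` onto the commutator kernel. -/
theorem integral_dil_mul_fderiv_eq (hα : 0 < α) (hη : InC1a α M η) (hφ : ContDiff ℝ (⊤ : ℕ∞) φ)
    (hs : ∀ z, 2 < ‖z‖ → φ z = 0) {s : ℝ} (hs0 : 0 < s) {σ : Euc d → ℝ} (hσ : ContDiff ℝ 1 σ)
    (x : Euc d) :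
    ∫ y, dil φ s (x - y) * fderiv ℝ σ y (η x - η y) = ∫ y, commKer φ η s x y * σ y := by
  have hκ1 : ContDiff ℝ 1 (dil φ s) := (contDiff_dil hφ s).of_le (by simp)
  have hκ : ContDiff ℝ 1 fun y => dil φ s (x - y) := hκ1.comp (contDiff_const.sub contDiff_id)
  have hη1 := hη.contDiff hα
  have hW : ContDiff ℝ 1 fun y => η x - η y := contDiff_const.sub hη1
  have hκc := hasCompactSupport_dil_sub hs hs0 x
  have hV : ContDiff ℝ 1 fun y => (dil φ s (x - y) * σ y) • (η x - η y) := (hκ.mul hσ).smul hW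
  have hVc : HasCompactSupport fun y => (dil φ s (x - y) * σ y) • (η x - η y) :=
    (hκc.mul_right (f' := σ)).smul_right
  have h0 := integral_divVec_eq_zero hV hVc
  have hdW : ∀ y, divVec (fun y => η x - η y) y = -divVec η y := fun y => by
    simp [divVec, fderiv_const_sub]
  have key : ∀ y, divVec (fun y => (dil φ s (x - y) * σ y) • (η x - η y)) y =
      dil φ s (x - y) * fderiv ℝ σ y (η x - η y) - commKer φ η s x y * σ y := fun y => by
    have hd1 := hκ.differentiable one_ne_zero y
    have hd2 := hσ.differentiable one_ne_zero y
    rw [divVec_smul (hd1.fun_mul hd2) (hW.differentiable one_ne_zero y), hdW, fderiv_fun_mul hd1 hd2]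
    simp only [add_apply, smul_apply, smul_eq_mul]
    rw [fderiv_comp_const_sub_left (hκ1.differentiable one_ne_zero), commKer]
    ring
  simp only [key] at h0
  rw [integral_sub] at h0
  · linarith
  · refine (hκ.continuous.mul ((hσ.continuous_fderiv one_ne_zero).clm_apply
      hW.continuous)).integrable_of_hasCompactSupport hκc.mul_right
  · exact integrable_commKer_mul hα hη hφ hs hs0 x hσ.continuous

theorem integral_commKer_eq_zero (hα : 0 < α) (hη : InC1a α M η) (hφ : ContDiff ℝ (⊤ : ℕ∞) φ)
    (hs : ∀ z, 2 < ‖z‖ → φ z = 0) {s : ℝ} (hs0 : 0 < s) (x : Euc d) :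
    ∫ y, commKer φ η s x y = 0 := by
  have := integral_dil_mul_fderiv_eq hα hη hφ hs hs0 (σ := fun _ => 1) contDiff_const x
  simpa using this.symm

end Commutator

section Pointwise

variable {d : ℕ} {φ : Euc d → ℝ}

/-- `B` bounds `φ`, its first derivative and the Lipschitz constants of both. -/
structure SmoothBound (φ : Euc d → ℝ) (B : ℝ) : Prop where
  pos : 0 < B
  abs_le : ∀ z, |φ z| ≤ B
  abs_sub_le : ∀ z w, |φ z - φ w| ≤ B * ‖z - w‖
  norm_fderiv_le : ∀ z, ‖fderiv ℝ φ z‖ ≤ B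
  norm_fderiv_sub_le : ∀ z w, ‖fderiv ℝ φ z - fderiv ℝ φ w‖ ≤ B * ‖z - w‖

theorem exists_smoothBound (hφ : ContDiff ℝ (⊤ : ℕ∞) φ) (hc : HasCompactSupport φ) :
    ∃ B, SmoothBound φ B := by
  have hf : ContDiff ℝ 1 (fderiv ℝ φ) := hφ.fderiv_right (WithTop.coe_le_coe.2 le_top)
  obtain ⟨B₁, h₁⟩ := hφ.continuous.bounded_above_of_compact_support hc
  obtain ⟨B₂, h₂⟩ := hf.continuous.bounded_above_of_compact_support (hc.fderiv ℝ)
  obtain ⟨B₃, h₃⟩ := (hφ.of_le (by simp) : ContDiff ℝ 1 φ).lipschitzWith_of_hasCompactSupport hc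
    (by simp)
  obtain ⟨B₄, h₄⟩ := hf.lipschitzWith_of_hasCompactSupport (hc.fderiv ℝ) (by simp)
  refine ⟨max 1 (max (max B₁ B₂) (max B₃ B₄)), by positivity, fun z => ?_, fun z w => ?_,
    fun z => ?_, fun z w => ?_⟩
  · exact (h₁ z).trans (by simp)
  · have := h₃.dist_le_mul z w
    rw [dist_eq_norm, dist_eq_norm] at this
    refine this.trans ?_
    gcongr
    simp
  · exact (h₂ z).trans (by simp)
  · have := h₄.dist_le_mul z w
    rw [dist_eq_norm, dist_eq_norm] at this
    refine this.trans ?_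
    gcongr
    simp

variable {B s : ℝ}

theorem SmoothBound.norm_fderiv_dil_le (hB : SmoothBound φ B) (hφ : ContDiff ℝ (⊤ : ℕ∞) φ)
    (hs : 0 < s) (z : Euc d) : ‖fderiv ℝ (dil φ s) z‖ ≤ s⁻¹ ^ d * s⁻¹ * B := by
  rw [fderiv_dil hφ, norm_smul, Real.norm_of_nonneg (by positivity)]
  gcongr
  exact hB.norm_fderiv_le _

theorem SmoothBound.norm_fderiv_dil_sub_le (hB : SmoothBound φ B) (hφ : ContDiff ℝ (⊤ : ℕ∞) φ)
    (hs : 0 < s) (z w : Euc d) :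
    ‖fderiv ℝ (dil φ s) z - fderiv ℝ (dil φ s) w‖ ≤ s⁻¹ ^ d * s⁻¹ * (B * (s⁻¹ * ‖z - w‖)) := by
  have e : fderiv ℝ (dil φ s) z - fderiv ℝ (dil φ s) w =
      (s⁻¹ ^ d * s⁻¹) • (fderiv ℝ φ (s⁻¹ • z) - fderiv ℝ φ (s⁻¹ • w)) := by
    rw [fderiv_dil hφ, fderiv_dil hφ]
    exact (smul_sub _ _ _).symm
  rw [e, norm_smul, Real.norm_of_nonneg (by positivity)]
  gcongr
  refine (hB.norm_fderiv_sub_le _ _).trans_eq ?_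
  rw [← smul_sub, norm_smul, norm_inv, Real.norm_of_nonneg hs.le]

variable {α M : ℝ} {η : Euc d → Euc d}

theorem abs_commKer_le (hη : InC1a α M η) (hB : SmoothBound φ B) (hφ : ContDiff ℝ (⊤ : ℕ∞) φ)
    (hsupp : ∀ z, 2 < ‖z‖ → φ z = 0) (hs : 0 < s) (x y : Euc d) :
    |commKer φ η s x y| ≤ (2 + d) * B * M * s⁻¹ ^ d := by
  have hM := hη.nonneg
  have hB0 := hB.pos
  rcases lt_or_ge (2 * s) ‖x - y‖ with h | h
  · rw [commKer_eq_zero hsupp hs h, abs_zero]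
    positivity
  · have h1 : |fderiv ℝ (dil φ s) (x - y) (η x - η y)| ≤ s⁻¹ ^ d * s⁻¹ * B * (M * (2 * s)) := by
      refine ((fderiv ℝ (dil φ s) (x - y)).le_opNorm _).trans ?_
      gcongr
      · exact hB.norm_fderiv_dil_le hφ hs _
      · exact (hη.norm_sub_le x y).trans (by gcongr)
    have h2 : |dil φ s (x - y) * divVec η y| ≤ s⁻¹ ^ d * B * (d * M) := by
      rw [abs_mul]
      gcongr
      · exact abs_dil_le hB.abs_le hs _
      · exact hη.abs_divVec_le y
    rw [commKer]
    refine (abs_add_le _ _).trans ((add_le_add h1 h2).trans_eq ?_)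
    have : s⁻¹ * s = 1 := inv_mul_cancel₀ hs.ne'
    linear_combination 2 * s⁻¹ ^ d * B * M * this

theorem abs_commKer_sub_le (hη : InC1a α M η) (hB : SmoothBound φ B) (hφ : ContDiff ℝ (⊤ : ℕ∞) φ)
    (hsupp : ∀ z, 2 < ‖z‖ → φ z = 0) (hs : 0 < s) {x x' : Euc d} (hx : ‖x - x'‖ ≤ s) (y : Euc d) :
    |commKer φ η s x y - commKer φ η s x' y| ≤
      (4 + d) * B * M * (s⁻¹ ^ d * (s⁻¹ * ‖x - x'‖)) := by
  have hM := hη.nonneg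
  have hB0 := hB.pos
  have htri : ‖x - y‖ ≤ ‖x - x'‖ + ‖x' - y‖ := by
    simpa using norm_add_le (x - x') (x' - y)
  rcases lt_or_ge (3 * s) ‖x - y‖ with h | h
  · rw [commKer_eq_zero hsupp hs (by linarith), commKer_eq_zero hsupp hs (by linarith), sub_self,
      abs_zero]
    positivity
  · have hxy : x - y - (x' - y) = x - x' := by abel
    have h1 : |(fderiv ℝ (dil φ s) (x - y) - fderiv ℝ (dil φ s) (x' - y)) (η x - η y)| ≤
        s⁻¹ ^ d * s⁻¹ * (B * (s⁻¹ * ‖x - x'‖)) * (M * (3 * s)) := by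
      refine ((fderiv ℝ (dil φ s) (x - y) - fderiv ℝ (dil φ s) (x' - y)).le_opNorm _).trans ?_
      gcongr
      · simpa [hxy] using hB.norm_fderiv_dil_sub_le hφ hs (x - y) (x' - y)
      · exact (hη.norm_sub_le x y).trans (by gcongr)
    have h2 : |fderiv ℝ (dil φ s) (x' - y) (η x - η x')| ≤
        s⁻¹ ^ d * s⁻¹ * B * (M * ‖x - x'‖) := by
      refine ((fderiv ℝ (dil φ s) (x' - y)).le_opNorm _).trans ?_
      gcongr
      · exact hB.norm_fderiv_dil_le hφ hs _
      · exact hη.norm_sub_le x x'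
    have h3 : |(dil φ s (x - y) - dil φ s (x' - y)) * divVec η y| ≤
        s⁻¹ ^ d * (B * (s⁻¹ * ‖x - x'‖)) * (d * M) := by
      rw [abs_mul]
      gcongr
      · simpa [hxy] using abs_dil_sub_le hB.abs_sub_le hs (x - y) (x' - y)
      · exact hη.abs_divVec_le y
    have e : commKer φ η s x y - commKer φ η s x' y =
        (fderiv ℝ (dil φ s) (x - y) - fderiv ℝ (dil φ s) (x' - y)) (η x - η y) +
        fderiv ℝ (dil φ s) (x' - y) (η x - η x') +
        (dil φ s (x - y) - dil φ s (x' - y)) * divVec η y := by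
      simp only [commKer, sub_apply, map_sub]
      ring
    rw [e]
    refine (abs_add_le _ _).trans ((add_le_add ((abs_add_le _ _).trans (add_le_add h1 h2))
      h3).trans_eq ?_)
    have : s⁻¹ * s = 1 := inv_mul_cancel₀ hs.ne'
    linear_combination 3 * s⁻¹ ^ d * s⁻¹ * B * M * ‖x - x'‖ * this

/-- The commutator of `η · ∇` with convolution by `dil φ s`, in kernel form. -/
def commOp (φ : Euc d → ℝ) (η : Euc d → Euc d) (s : ℝ) (σ : Euc d → ℝ) (x : Euc d) : ℝ :=
  ∫ y, commKer φ η s x y * σ y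

variable {Mσ : ℝ} {σ : Euc d → ℝ}

theorem InCa.nonneg {F : Type*} [NormedAddCommGroup F] {f : Euc d → F} (hf : InCa α M f) : 0 ≤ M :=
  (norm_nonneg _).trans (hf.1 0)

theorem commOp_eq_integral_sub (hα : 0 < α) (hη : InC1a α M η) (hφ : ContDiff ℝ (⊤ : ℕ∞) φ)
    (hsupp : ∀ z, 2 < ‖z‖ → φ z = 0) (hs : 0 < s) (hσ : Continuous σ) (x : Euc d) (c : ℝ) :
    commOp φ η s σ x = ∫ y, commKer φ η s x y * (σ y - c) := by
  simp only [mul_sub]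
  rw [integral_sub (integrable_commKer_mul hα hη hφ hsupp hs x hσ)
    (integrable_commKer_mul hα hη hφ hsupp hs x continuous_const), integral_mul_const,
    integral_commKer_eq_zero hα hη hφ hsupp hs, zero_mul, sub_zero, commOp]

theorem abs_commOp_le (hα : 0 < α) (hη : InC1a α M η) (hB : SmoothBound φ B)
    (hφ : ContDiff ℝ (⊤ : ℕ∞) φ) (hsupp : ∀ z, 2 < ‖z‖ → φ z = 0) (hs : 0 < s)
    (hσ : InCa α Mσ σ) (x : Euc d) :
    |commOp φ η s σ x| ≤ (4 ^ d * (2 + d) * B) * M * Mσ * (2 * s) ^ α := by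
  have hM := hη.nonneg
  have hB0 := hB.pos
  have hMσ := hσ.nonneg
  rw [commOp_eq_integral_sub hα hη hφ hsupp hs (hσ.continuous hα) x (σ x)]
  refine abs_integral_le_integral_abs.trans ?_
  refine (integral_norm_le_of_support_subset_closedBall (r := 2 * s)
    (B := (2 + d) * B * M * s⁻¹ ^ d * (Mσ * (2 * s) ^ α)) x (by positivity)
    (fun y => ?_) fun y hy => ?_).trans_eq ?_
  · rcases lt_or_ge (2 * s) ‖x - y‖ with h | h
    · rw [commKer_eq_zero hsupp hs h, zero_mul, abs_zero]
      positivity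
    · rw [abs_mul]
      gcongr
      · exact abs_commKer_le hη hB hφ hsupp hs x y
      · refine (hσ.2 y x).trans ?_
        gcongr
        rwa [norm_sub_rev]
  · rw [norm_sub_rev] at hy
    rw [commKer_eq_zero hsupp hs hy, zero_mul]
  · have e : (2 * (2 * s)) ^ d = 4 ^ d * s ^ d := by rw [← mul_pow]; congr 1; ring
    have e2 : s⁻¹ ^ d * s ^ d = 1 := by rw [← mul_pow, inv_mul_cancel₀ hs.ne', one_pow]
    rw [e]
    linear_combination (2 + d) * B * M * (Mσ * (2 * s) ^ α) * 4 ^ d * e2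

theorem abs_commOp_sub_le (hα : 0 < α) (hη : InC1a α M η) (hB : SmoothBound φ B)
    (hφ : ContDiff ℝ (⊤ : ℕ∞) φ) (hsupp : ∀ z, 2 < ‖z‖ → φ z = 0) (hs : 0 < s)
    (hσ : InCa α Mσ σ) {x x' : Euc d} (hx : ‖x - x'‖ ≤ s) :
    |commOp φ η s σ x - commOp φ η s σ x'| ≤
      (6 ^ d * (4 + d) * B) * M * Mσ * (s⁻¹ * ‖x - x'‖) * (3 * s) ^ α := by
  have hM := hη.nonneg
  have hB0 := hB.pos
  have hMσ := hσ.nonneg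
  have hσc := hσ.continuous hα
  have hσc' : Continuous fun y => σ y - σ x := hσc.sub continuous_const
  rw [commOp_eq_integral_sub hα hη hφ hsupp hs hσc x (σ x),
    commOp_eq_integral_sub hα hη hφ hsupp hs hσc x' (σ x), ← integral_sub
    (integrable_commKer_mul hα hη hφ hsupp hs x hσc')
    (integrable_commKer_mul hα hη hφ hsupp hs x' hσc')]
  refine abs_integral_le_integral_abs.trans ?_
  have hz : ∀ y, 3 * s < ‖x - y‖ → commKer φ η s x y = 0 ∧ commKer φ η s x' y = 0 := fun y h => by
    have htri : ‖x - y‖ ≤ ‖x - x'‖ + ‖x' - y‖ := by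
      simpa using norm_add_le (x - x') (x' - y)
    exact ⟨commKer_eq_zero hsupp hs (by linarith), commKer_eq_zero hsupp hs (by linarith)⟩
  refine (integral_norm_le_of_support_subset_closedBall (r := 3 * s)
    (B := (4 + d) * B * M * (s⁻¹ ^ d * (s⁻¹ * ‖x - x'‖)) * (Mσ * (3 * s) ^ α)) x (by positivity)
    (fun y => ?_) fun y hy => ?_).trans_eq ?_
  · rcases lt_or_ge (3 * s) ‖x - y‖ with h | h
    · simp only [hz y h, zero_mul, sub_zero, abs_zero]
      positivity
    · rw [← sub_mul, abs_mul]
      gcongr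
      · exact abs_commKer_sub_le hη hB hφ hsupp hs hx y
      · refine (hσ.2 y x).trans ?_
        gcongr
        rwa [norm_sub_rev]
  · rw [norm_sub_rev] at hy
    simp only [hz y hy, zero_mul, sub_zero]
  · have e : (2 * (3 * s)) ^ d = 6 ^ d * s ^ d := by rw [← mul_pow]; congr 1; ring
    have e2 : s⁻¹ ^ d * s ^ d = 1 := by rw [← mul_pow, inv_mul_cancel₀ hs.ne', one_pow]
    rw [e]
    linear_combination (4 + d) * B * M * (s⁻¹ * ‖x - x'‖) * (Mσ * (3 * s) ^ α) * 6 ^ d * e2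

/-- Hölder bound for the commutators, uniform over finite sets of dyadic scales. -/
theorem exists_abs_sum_commOp_sub_le (hα : 0 < α) (hα1 : α < 1) (hφ : ContDiff ℝ (⊤ : ℕ∞) φ)
    (hsupp : ∀ z, 2 < ‖z‖ → φ z = 0) : ∃ C : ℝ, 0 < C ∧ ∀ (η : Euc d → Euc d) (M : ℝ),
      InC1a α M η → ∀ (σ : Euc d → ℝ) (Mσ : ℝ), InCa α Mσ σ → ∀ (J : Finset ℤ) (x x' : Euc d),
      |∑ j ∈ J, commOp φ η ((2 : ℝ) ^ j) σ x - ∑ j ∈ J, commOp φ η ((2 : ℝ) ^ j) σ x'| ≤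
        C * M * Mσ * ‖x - x'‖ ^ α := by
  obtain ⟨B, hB⟩ := exists_smoothBound hφ (hasCompactSupport_of_forall_norm hsupp)
  obtain ⟨C₁, hC₁, h₁⟩ := exists_sum_scale_le α hα
  obtain ⟨C₂, hC₂, h₂⟩ := exists_sum_scale_ge (1 - α) (by linarith)
  have hB0 := hB.pos
  set K₁ : ℝ := 2 * (4 ^ d * (2 + d) * B) * 2 with hK₁
  set K₂ : ℝ := (6 ^ d * (4 + d) * B) * 3 with hK₂
  have hK₁0 : 0 < K₁ := by positivity
  have hK₂0 : 0 < K₂ := by positivity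
  refine ⟨K₁ * C₁ + K₂ * C₂, by positivity, fun η M hη σ Mσ hσ J x x' => ?_⟩
  have hM := hη.nonneg
  have hMσ := hσ.nonneg
  rcases eq_or_ne x x' with rfl | hne
  · simp only [sub_self, abs_zero]
    positivity
  set r : ℝ := ‖x - x'‖ with hr
  have hr0 : 0 < r := norm_pos_iff.2 (sub_ne_zero.2 hne)
  have h2α : (2 : ℝ) ^ α ≤ 2 := by
    simpa using Real.rpow_le_rpow_of_exponent_le one_le_two hα1.le
  have h3α : (3 : ℝ) ^ α ≤ 3 := by
    simpa using Real.rpow_le_rpow_of_exponent_le (by norm_num : (1 : ℝ) ≤ 3) hα1.le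
  have hterm : ∀ j : ℤ, |commOp φ η ((2 : ℝ) ^ j) σ x - commOp φ η ((2 : ℝ) ^ j) σ x'| ≤
      M * Mσ * r ^ α * (K₁ * (if (2 : ℝ) ^ j ≤ r then ((2 : ℝ) ^ j / r) ^ α else 0) +
        K₂ * (if r ≤ (2 : ℝ) ^ j then (r / (2 : ℝ) ^ j) ^ (1 - α) else 0)) := by
    intro j
    have hs : (0 : ℝ) < 2 ^ j := by positivity
    set s : ℝ := (2 : ℝ) ^ j with hsdef
    have i1 : 0 ≤ (if s ≤ r then (s / r) ^ α else 0) := by split_ifs <;> positivity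
    have i2 : 0 ≤ (if r ≤ s then (r / s) ^ (1 - α) else 0) := by split_ifs <;> positivity
    rcases le_total s r with h | h
    · have e : K₁ * M * Mσ * s ^ α ≤ M * Mσ * r ^ α *
          (K₁ * (if s ≤ r then (s / r) ^ α else 0) +
          K₂ * (if r ≤ s then (r / s) ^ (1 - α) else 0)) := by
        rw [if_pos h]
        have : r ^ α * (s / r) ^ α = s ^ α := by
          rw [← Real.mul_rpow hr0.le (by positivity)]; congr 1; field_simp
        calc K₁ * M * Mσ * s ^ α = M * Mσ * r ^ α * (K₁ * (s / r) ^ α + 0) := by rw [← this]; ring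
          _ ≤ _ := by gcongr; positivity
      refine le_trans ?_ e
      have a1 := abs_commOp_le hα hη hB hφ hsupp hs hσ x
      have a2 := abs_commOp_le hα hη hB hφ hsupp hs hσ x'
      calc _ ≤ |commOp φ η s σ x| + |commOp φ η s σ x'| := abs_sub _ _
        _ ≤ 2 * ((4 ^ d * (2 + d) * B) * M * Mσ * (2 * s) ^ α) := by linarith
        _ = 2 * ((4 ^ d * (2 + d) * B) * M * Mσ * (2 ^ α * s ^ α)) := by
          rw [Real.mul_rpow zero_le_two hs.le]
        _ ≤ 2 * ((4 ^ d * (2 + d) * B) * M * Mσ * (2 * s ^ α)) := by gcongr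
        _ = _ := by rw [hK₁]; ring
    · have e : K₂ * M * Mσ * (s⁻¹ * r * s ^ α) ≤ M * Mσ * r ^ α *
          (K₁ * (if s ≤ r then (s / r) ^ α else 0) +
          K₂ * (if r ≤ s then (r / s) ^ (1 - α) else 0)) := by
        rw [if_pos h]
        have : r ^ α * (r / s) ^ (1 - α) = s⁻¹ * r * s ^ α := by
          have a : r = (r / s) * s := by field_simp
          have b : r ^ α = (r / s) ^ α * s ^ α := by
            rw [← Real.mul_rpow (by positivity) hs.le, ← a]
          rw [b, mul_right_comm, ← Real.rpow_add (by positivity)]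
          rw [add_sub_cancel, Real.rpow_one]
          ring
        calc K₂ * M * Mσ * (s⁻¹ * r * s ^ α) =
            M * Mσ * r ^ α * (0 + K₂ * (r / s) ^ (1 - α)) := by rw [← this]; ring
          _ ≤ _ := by gcongr; positivity
      refine le_trans ?_ e
      have a1 := abs_commOp_sub_le hα hη hB hφ hsupp hs hσ (x := x) (x' := x') h
      refine a1.trans ?_
      rw [Real.mul_rpow (by norm_num) hs.le]
      calc _ ≤ 6 ^ d * (4 + d) * B * M * Mσ * (s⁻¹ * r) * (3 * s ^ α) := by gcongr
        _ = _ := by rw [hK₂]; ring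
  rw [← Finset.sum_sub_distrib]
  refine (Finset.abs_sum_le_sum_abs _ _).trans ((Finset.sum_le_sum fun j _ => hterm j).trans ?_)
  rw [← Finset.mul_sum, Finset.sum_add_distrib, ← Finset.mul_sum, ← Finset.mul_sum]
  calc _ ≤ M * Mσ * r ^ α * (K₁ * C₁ + K₂ * C₂) := by
        gcongr
        · exact h₁ r hr0 J
        · exact h₂ r hr0 J
    _ = _ := by ring

end Pointwise

section LocalKernel

variable {d : ℕ}

theorem laverage_enorm_rpow_le {X : Type*} [MeasurableSpace X] {μ : Measure X} {p : ℝ} (hp : 1 ≤ p)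
    {f : X → ℝ} (hf : AEStronglyMeasurable f μ) {S : Set X} (h0 : μ S ≠ 0) (ht : μ S ≠ ⊤) :
    ((μ S)⁻¹ * ∫⁻ y in S, ‖f y‖ₑ ∂μ) ^ p ≤ (μ S)⁻¹ * ∫⁻ y in S, ‖f y‖ₑ ^ p ∂μ := by
  have hp0 : 0 < p := by linarith
  set ν : Measure X := (μ S)⁻¹ • μ.restrict S with hν
  have : IsProbabilityMeasure ν := ⟨by simp [hν, ENNReal.inv_mul_cancel h0 ht]⟩
  have hfν : AEStronglyMeasurable f ν := hf.restrict.smul_measure _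
  have h := eLpNorm_le_eLpNorm_of_exponent_le (μ := ν) (p := 1) (q := ENNReal.ofReal p)
    (by simpa using hp) hfν
  rw [eLpNorm_one_eq_lintegral_enorm, eLpNorm_ofReal_eq_lintegral hp0, one_div,
    ENNReal.le_rpow_inv_iff hp0, hν, lintegral_smul_measure, lintegral_smul_measure] at h
  exact h

variable {R : Euc d → Euc d → ℝ} {A s p : ℝ} {σ : Euc d → ℝ}

theorem volume_closedBall_two_mul (hs : 0 < s) (x : Euc d) :
    volume (Metric.closedBall x (2 * s)) = ENNReal.ofReal ((4 * s) ^ d) := by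
  rw [Real.volume_pi_closedBall _ (by positivity), Fintype.card_fin]
  congr 2
  ring

theorem enorm_integral_mul_le (hs : 0 < s) (hA : ∀ x y, |R x y| ≤ A * s⁻¹ ^ d)
    (hR : ∀ x y, 2 * s < ‖x - y‖ → R x y = 0) (x : Euc d) :
    ‖∫ y, R x y * σ y‖ₑ ≤ ENNReal.ofReal (4 ^ d * A) *
      ((volume (Metric.closedBall x (2 * s)))⁻¹ *
        ∫⁻ y in Metric.closedBall x (2 * s), ‖σ y‖ₑ) := by
  have hA0 : 0 ≤ A := by
    by_contra h
    have := (abs_nonneg _).trans (hA 0 0)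
    have h2 : 0 < s⁻¹ ^ d := by positivity
    nlinarith
  have e : ENNReal.ofReal (4 ^ d * A) * (volume (Metric.closedBall x (2 * s)))⁻¹ =
      ENNReal.ofReal (A * s⁻¹ ^ d) := by
    rw [volume_closedBall_two_mul hs, ← ENNReal.ofReal_inv_of_pos (by positivity),
      ← ENNReal.ofReal_mul (by positivity)]
    congr 1
    rw [mul_pow, mul_inv, inv_pow]
    field_simp
  rw [← mul_assoc, e, ← lintegral_const_mul' _ _ ENNReal.ofReal_ne_top,
    ← lintegral_indicator measurableSet_closedBall]
  refine (enorm_integral_le_lintegral_enorm _).trans (lintegral_mono fun y => ?_)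
  by_cases h : y ∈ Metric.closedBall x (2 * s)
  · rw [indicator_of_mem h, enorm_mul]
    gcongr
    rw [← ofReal_norm]
    exact ENNReal.ofReal_le_ofReal (hA x y)
  · rw [hR x y (by simpa [dist_eq_norm, norm_sub_rev] using h)]
    simp

theorem abs_integral_mul_le_of_eLpNorm_le (hd : 1 ≤ d) (hp : 1 < p) (hs : 1 ≤ s)
    (hA0 : 0 ≤ A) (hA : ∀ x y, |R x y| ≤ A * s⁻¹ ^ d) (hR : ∀ x y, 2 * s < ‖x - y‖ → R x y = 0)
    (hσ : Continuous σ) {Mσ : ℝ} (hM : 0 ≤ Mσ)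
    (hσp : eLpNorm σ (ENNReal.ofReal p) volume ≤ ENNReal.ofReal Mσ) (x : Euc d) :
    |∫ y, R x y * σ y| ≤ 4 ^ d * A * Mσ * (1 / s) ^ (1 / p) := by
  have hs0 : 0 < s := by linarith
  have hp0 : 0 < p := by linarith
  have hv := volume_closedBall_two_mul hs0 x
  have h1 := enorm_integral_mul_le (σ := σ) hs0 hA hR x
  have h2 := laverage_enorm_rpow_le hp.le hσ.aestronglyMeasurable (μ := volume)
    (S := Metric.closedBall x (2 * s)) (by rw [hv]; simp; positivity) (by rw [hv]; simp)
  rw [← ENNReal.le_rpow_inv_iff hp0] at h2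
  have h3 : ((volume (Metric.closedBall x (2 * s)))⁻¹ *
      ∫⁻ y in Metric.closedBall x (2 * s), ‖σ y‖ₑ ^ p) ^ p⁻¹ ≤
      ENNReal.ofReal ((1 / s) ^ (1 / p)) * ENNReal.ofReal Mσ := by
    rw [ENNReal.mul_rpow_of_nonneg _ _ (by positivity)]
    gcongr
    · rw [hv, ← ENNReal.ofReal_inv_of_pos (by positivity),
        ENNReal.ofReal_rpow_of_nonneg (by positivity) (by positivity), one_div p]
      refine ENNReal.ofReal_le_ofReal ?_
      gcongr
      rw [one_div]
      gcongr
      calc s ≤ 4 * s := by linarith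
        _ = (4 * s) ^ 1 := (pow_one _).symm
        _ ≤ (4 * s) ^ d := pow_le_pow_right₀ (by linarith) hd
    · refine le_trans ?_ hσp
      rw [eLpNorm_ofReal_eq_lintegral hp0, one_div]
      gcongr
      exact Measure.restrict_le_self
  have h4 := h1.trans (mul_le_mul_right (h2.trans h3) _)
  rw [← ENNReal.ofReal_mul (by positivity), ← ENNReal.ofReal_mul (by positivity),
    ← ofReal_norm, ENNReal.ofReal_le_ofReal_iff (by positivity)] at h4
  exact h4.trans_eq (by ring)

theorem stronglyMeasurable_integral_mul (hRc : Continuous (Function.uncurry R)) (hσ : Continuous σ) :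
    StronglyMeasurable fun x => ∫ y, R x y * σ y :=
  StronglyMeasurable.integral_prod_right
    (hRc.mul (hσ.comp continuous_snd) :
      Continuous (Function.uncurry fun x y => R x y * σ y)).stronglyMeasurable

theorem eLpNorm_integral_mul_le (hp : 1 < p) (hs : 0 < s)
    (hA : ∀ x y, |R x y| ≤ A * s⁻¹ ^ d) (hR : ∀ x y, 2 * s < ‖x - y‖ → R x y = 0)
    (hσ : Continuous σ) :
    eLpNorm (fun x => ∫ y, R x y * σ y) (ENNReal.ofReal p) volume ≤
      ENNReal.ofReal (4 ^ d * A) * eLpNorm σ (ENNReal.ofReal p) volume := by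
  have hp0 : 0 < p := by linarith
  have hv := volume_closedBall_two_mul (d := d) hs
  set V : ENNReal := ENNReal.ofReal ((4 * s) ^ d) with hV
  have hV0 : V ≠ 0 := by simp [hV]; positivity
  have hVt : V ≠ ⊤ := ENNReal.ofReal_ne_top
  have hpt : ∀ x, ‖∫ y, R x y * σ y‖ₑ ^ p ≤ ENNReal.ofReal (4 ^ d * A) ^ p *
      (V⁻¹ * ∫⁻ y, (Metric.closedBall x (2 * s)).indicator (fun y => ‖σ y‖ₑ ^ p) y) := fun x => by
    have h1 := enorm_integral_mul_le (σ := σ) hs hA hR x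
    have h2 := laverage_enorm_rpow_le hp.le hσ.aestronglyMeasurable (μ := volume)
      (S := Metric.closedBall x (2 * s)) (by rwa [hv]) (by rwa [hv])
    rw [hv] at h1 h2
    rw [lintegral_indicator measurableSet_closedBall]
    calc _ ≤ _ := ENNReal.rpow_le_rpow h1 hp0.le
      _ ≤ _ := by
        rw [ENNReal.mul_rpow_of_nonneg _ _ hp0.le]
        gcongr
  have hm : Measurable (Function.uncurry fun x y : Euc d =>
      (Metric.closedBall x (2 * s)).indicator (fun y => ‖σ y‖ₑ ^ p) y) := by
    have h1 : Measurable fun q : Euc d × Euc d => ‖σ q.2‖ₑ ^ p :=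
      ((hσ.comp continuous_snd).enorm.measurable).pow_const p
    have h2 : MeasurableSet {q : Euc d × Euc d | dist q.2 q.1 ≤ 2 * s} :=
      (isClosed_le (by fun_prop) continuous_const).measurableSet
    exact h1.indicator h2
  have htot : ∫⁻ x, ∫⁻ y, (Metric.closedBall x (2 * s)).indicator (fun y => ‖σ y‖ₑ ^ p) y =
      V * ∫⁻ y, ‖σ y‖ₑ ^ p := by
    rw [lintegral_lintegral_swap hm.aemeasurable, ← lintegral_const_mul' _ _ hVt]
    refine lintegral_congr fun y => ?_
    have : ∀ x, (Metric.closedBall x (2 * s)).indicator (fun y => ‖σ y‖ₑ ^ p) y =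
        (Metric.closedBall y (2 * s)).indicator (fun _ => ‖σ y‖ₑ ^ p) x := fun x => by
      simp only [indicator, Metric.mem_closedBall, dist_comm]
    simp only [this]
    rw [lintegral_indicator measurableSet_closedBall, setLIntegral_const, hv, mul_comm]
  rw [eLpNorm_ofReal_eq_lintegral hp0, eLpNorm_ofReal_eq_lintegral hp0,
    one_div, ENNReal.rpow_inv_le_iff hp0, ENNReal.mul_rpow_of_nonneg _ _ hp0.le, ← ENNReal.rpow_mul,
    inv_mul_cancel₀ hp0.ne', ENNReal.rpow_one]
  refine (lintegral_mono hpt).trans_eq ?_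
  rw [lintegral_const_mul' _ _ (by finiteness), lintegral_const_mul' _ _ (by finiteness), htot,
    ← mul_assoc V⁻¹, ENNReal.inv_mul_cancel hV0 hVt, one_mul]

end LocalKernel

section Sums

variable {d : ℕ} {φ : Euc d → ℝ} {α p : ℝ}

/-- Uniform bound for the commutators over finite sets of dyadic scales. -/
theorem exists_abs_sum_commOp_le (hd : 1 ≤ d) (hα : 0 < α) (hα1 : α < 1) (hp : 1 < p)
    (hφ : ContDiff ℝ (⊤ : ℕ∞) φ) (hsupp : ∀ z, 2 < ‖z‖ → φ z = 0) :
    ∃ C : ℝ, 0 < C ∧ ∀ (η : Euc d → Euc d) (M : ℝ),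
      InC1a α M η → ∀ (σ : Euc d → ℝ) (Mσ : ℝ), InCap α p Mσ σ → ∀ (J : Finset ℤ) (x : Euc d),
      |∑ j ∈ J, commOp φ η ((2 : ℝ) ^ j) σ x| ≤ C * M * Mσ := by
  obtain ⟨B, hB⟩ := exists_smoothBound hφ (hasCompactSupport_of_forall_norm hsupp)
  obtain ⟨C₁, hC₁, h₁⟩ := exists_sum_scale_le α hα
  obtain ⟨C₂, hC₂, h₂⟩ := exists_sum_scale_ge (1 / p) (by positivity)
  have hB0 := hB.pos
  set K : ℝ := 4 ^ d * (2 + d) * B with hK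
  have hK0 : 0 < K := by positivity
  refine ⟨K * 2 * C₁ + K * C₂, by positivity, fun η M hη σ Mσ hσ J x => ?_⟩
  have hM := hη.nonneg
  have hMσ := hσ.1.nonneg
  have h2α : (2 : ℝ) ^ α ≤ 2 := by
    simpa using Real.rpow_le_rpow_of_exponent_le one_le_two hα1.le
  have hterm : ∀ j : ℤ, |commOp φ η ((2 : ℝ) ^ j) σ x| ≤
      M * Mσ * (K * 2 * (if (2 : ℝ) ^ j ≤ 1 then ((2 : ℝ) ^ j / 1) ^ α else 0) +
        K * (if 1 ≤ (2 : ℝ) ^ j then (1 / (2 : ℝ) ^ j) ^ (1 / p) else 0)) := by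
    intro j
    have hs : (0 : ℝ) < 2 ^ j := by positivity
    set s : ℝ := (2 : ℝ) ^ j with hsdef
    have i1 : 0 ≤ (if s ≤ 1 then (s / 1) ^ α else 0) := by split_ifs <;> positivity
    have i2 : 0 ≤ (if 1 ≤ s then (1 / s) ^ (1 / p) else 0) := by split_ifs <;> positivity
    rcases le_total s 1 with h | h
    · rw [if_pos h, div_one]
      calc _ ≤ K * M * Mσ * (2 * s) ^ α := abs_commOp_le hα hη hB hφ hsupp hs hσ.1 x
        _ = K * M * Mσ * (2 ^ α * s ^ α) := by rw [Real.mul_rpow zero_le_two hs.le]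
        _ ≤ K * M * Mσ * (2 * s ^ α) := by gcongr
        _ = M * Mσ * (K * 2 * s ^ α + 0) := by ring
        _ ≤ _ := by gcongr; positivity
    · rw [if_pos h]
      calc _ ≤ 4 ^ d * ((2 + d) * B * M) * Mσ * (1 / s) ^ (1 / p) :=
            abs_integral_mul_le_of_eLpNorm_le hd hp h (by positivity)
              (abs_commKer_le hη hB hφ hsupp hs) (fun _ _ => commKer_eq_zero hsupp hs)
              (hσ.1.continuous hα) hMσ hσ.2 x
        _ = M * Mσ * (0 + K * (1 / s) ^ (1 / p)) := by rw [hK]; ring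
        _ ≤ _ := by gcongr; positivity
  refine (Finset.abs_sum_le_sum_abs _ _).trans ((Finset.sum_le_sum fun j _ => hterm j).trans ?_)
  rw [← Finset.mul_sum, Finset.sum_add_distrib, ← Finset.mul_sum, ← Finset.mul_sum]
  calc _ ≤ M * Mσ * (K * 2 * C₁ + K * C₂) := by
        gcongr
        · exact h₁ 1 one_pos J
        · exact h₂ 1 one_pos J
    _ = _ := by ring

/-- The first moment `z_l ∂_i φ(z)` of the gradient of `φ`. -/
def gradMoment (φ : Euc d → ℝ) (i l : Fin d) (z : Euc d) : ℝ := z l * fderiv ℝ φ z (Pi.single i 1)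

theorem contDiff_gradMoment (hφ : ContDiff ℝ (⊤ : ℕ∞) φ) (i l : Fin d) :
    ContDiff ℝ (⊤ : ℕ∞) (gradMoment φ i l) :=
  (contDiff_apply ℝ ℝ l).mul ((hφ.fderiv_right (by simp)).clm_apply contDiff_const)

theorem gradMoment_eq_zero (hsupp : ∀ z, 2 < ‖z‖ → φ z = 0) (i l : Fin d) (z : Euc d)
    (hz : 2 < ‖z‖) : gradMoment φ i l z = 0 := by
  have e : dil φ 1 = φ := by ext; simp [dil]
  have := fderiv_dil_eq_zero hsupp one_pos (z := z) (by simpa using hz)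
  rw [e] at this
  simp [gradMoment, this]

theorem integral_gradMoment (hφ : ContDiff ℝ (⊤ : ℕ∞) φ) (hsupp : ∀ z, 2 < ‖z‖ → φ z = 0)
    (h0 : ∫ z, φ z = 0) (i l : Fin d) : ∫ z, gradMoment φ i l z = 0 := by
  have hc := hasCompactSupport_of_forall_norm hsupp
  have hφ1 : ContDiff ℝ 1 φ := hφ.of_le (by simp)
  have hl : ContDiff ℝ 1 fun z : Euc d => z l := contDiff_apply ℝ ℝ l
  have hcl : HasCompactSupport fun z : Euc d => z l * φ z := hc.mul_left
  have hdl : ∀ z v : Euc d, fderiv ℝ (fun z : Euc d => z l) z v = v l := fun z v => by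
    have := fderiv_apply_coord (V := fun z : Euc d => z) (y := z) differentiableAt_id l v
    simpa using this
  have h := integral_fderiv_eq_zero (hl.mul hφ1) hcl (Pi.single i 1)
  have e : ∀ z, fderiv ℝ (fun z : Euc d => z l * φ z) z (Pi.single i 1) =
      gradMoment φ i l z + (Pi.single i (1 : ℝ) : Euc d) l * φ z := fun z => by
    rw [fderiv_fun_mul (hl.differentiable one_ne_zero z) (hφ1.differentiable one_ne_zero z)]
    simp only [add_apply, smul_apply, smul_eq_mul, hdl, gradMoment]
    ring
  have hi : Integrable (gradMoment φ i l) :=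
    (contDiff_gradMoment hφ i l).continuous.integrable_of_hasCompactSupport
      (hasCompactSupport_of_forall_norm (gradMoment_eq_zero hsupp i l))
  have h' : ∫ z, fderiv ℝ (fun z : Euc d => z l * φ z) z (Pi.single i 1) = 0 := h
  simp only [e] at h'
  rw [integral_add hi ((hφ.continuous.integrable_of_hasCompactSupport hc).const_mul _),
    integral_const_mul, h0, mul_zero, add_zero] at h'
  exact h'

theorem dil_gradMoment (hφ : ContDiff ℝ (⊤ : ℕ∞) φ) (i l : Fin d) (s : ℝ) (z : Euc d) :
    dil (gradMoment φ i l) s z = z l * fderiv ℝ (dil φ s) z (Pi.single i 1) := by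
  rw [fderiv_dil hφ]
  simp only [dil, gradMoment, Pi.smul_apply, smul_apply, smul_eq_mul]
  ring

theorem fderiv_dil_apply_clm (hφ : ContDiff ℝ (⊤ : ℕ∞) φ) (s : ℝ) (z : Euc d)
    (A : Euc d →L[ℝ] Euc d) :
    fderiv ℝ (dil φ s) z (A z) =
      ∑ i, ∑ l, dil (gradMoment φ i l) s z * A (Pi.single l 1) i := by
  rw [clm_apply_eq_sum]
  refine Finset.sum_congr rfl fun i _ => ?_
  have h := clm_apply_eq_sum ((ContinuousLinearMap.proj i : Euc d →L[ℝ] ℝ).comp A) z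
  simp only [ContinuousLinearMap.comp_apply, ContinuousLinearMap.proj_apply] at h
  rw [h, Finset.mul_sum]
  refine Finset.sum_congr rfl fun l _ => ?_
  rw [dil_gradMoment hφ]
  ring

/-- The part of the commutator kernel at scale `s` which is absolutely summable over the dyadic
scales: at small scales the linear part of `η` is removed. -/
def remKer (φ : Euc d → ℝ) (η : Euc d → Euc d) (s : ℝ) (x y : Euc d) : ℝ :=
  fderiv ℝ (dil φ s) (x - y) (η x - η y - if s ≤ 1 then fderiv ℝ η y (x - y) else 0)

variable {M B s : ℝ} {η : Euc d → Euc d} {σ : Euc d → ℝ}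

theorem continuous_remKer (hα : 0 < α) (hη : InC1a α M η) (hφ : ContDiff ℝ (⊤ : ℕ∞) φ) (s : ℝ) :
    Continuous (Function.uncurry (remKer φ η s)) := by
  have h1 : Continuous fun q : Euc d × Euc d => q.1 - q.2 := continuous_fst.sub continuous_snd
  have h2 := (hη.contDiff hα).continuous
  have h3 : Continuous fun q : Euc d × Euc d => η q.1 - η q.2 :=
    (h2.comp continuous_fst).sub (h2.comp continuous_snd)
  have h4 : Continuous fun q : Euc d × Euc d => fderiv ℝ η q.2 (q.1 - q.2) :=
    ((hη.2.2.continuous hα).comp continuous_snd).clm_apply h1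
  refine ((continuous_fderiv_dil hφ s).comp h1).clm_apply (h3.sub ?_)
  by_cases hs : s ≤ 1
  · simpa [hs] using h4
  · simpa [hs] using continuous_const

theorem remKer_eq_zero (hsupp : ∀ z, 2 < ‖z‖ → φ z = 0) (hs : 0 < s) (x y : Euc d)
    (hxy : 2 * s < ‖x - y‖) : remKer φ η s x y = 0 := by
  rw [remKer, fderiv_dil_eq_zero hsupp hs hxy]
  simp

theorem abs_remKer_le (hα : 0 < α) (hα1 : α < 1) (hη : InC1a α M η) (hB : SmoothBound φ B)
    (hφ : ContDiff ℝ (⊤ : ℕ∞) φ) (hsupp : ∀ z, 2 < ‖z‖ → φ z = 0) (hs : 0 < s) (x y : Euc d) :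
    |remKer φ η s x y| ≤ 4 * B * M * ((if s ≤ 1 then (s / 1) ^ α else 0) +
      if 1 ≤ s then (1 / s) ^ (1 : ℝ) else 0) * s⁻¹ ^ d := by
  have hM := hη.nonneg
  have hB0 := hB.pos
  have h2α : (2 : ℝ) ^ α ≤ 2 := by
    simpa using Real.rpow_le_rpow_of_exponent_le one_le_two hα1.le
  have i1 : 0 ≤ (if s ≤ 1 then (s / 1) ^ α else 0) := by split_ifs <;> positivity
  have i2 : 0 ≤ (if 1 ≤ s then (1 / s) ^ (1 : ℝ) else 0) := by split_ifs <;> positivity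
  have hss : s⁻¹ * s = 1 := inv_mul_cancel₀ hs.ne'
  rcases lt_or_ge (2 * s) ‖x - y‖ with h | h
  · rw [remKer_eq_zero hsupp hs x y h, abs_zero]
    positivity
  · have hop : ∀ v, |fderiv ℝ (dil φ s) (x - y) v| ≤ s⁻¹ ^ d * s⁻¹ * B * ‖v‖ := fun v =>
      ((fderiv ℝ (dil φ s) (x - y)).le_opNorm v).trans
        (by gcongr; exact hB.norm_fderiv_dil_le hφ hs _)
    rw [remKer]
    refine (hop _).trans ?_
    by_cases h1 : s ≤ 1
    · rw [if_pos h1, if_pos h1, div_one]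
      calc _ ≤ s⁻¹ ^ d * s⁻¹ * B * (M * (2 * s) ^ α * (2 * s)) := by
            gcongr
            exact (hη.norm_sub_sub_le hα x y).trans (by gcongr)
        _ = s⁻¹ ^ d * s⁻¹ * B * (M * (2 ^ α * s ^ α) * (2 * s)) := by
            rw [Real.mul_rpow zero_le_two hs.le]
        _ ≤ s⁻¹ ^ d * s⁻¹ * B * (M * (2 * s ^ α) * (2 * s)) := by gcongr
        _ = 4 * B * M * (s ^ α + 0) * s⁻¹ ^ d := by
            linear_combination 4 * s⁻¹ ^ d * B * M * s ^ α * hss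
        _ ≤ _ := by gcongr
    · rw [if_neg h1, if_neg h1, if_pos (le_of_not_ge h1), sub_zero, Real.rpow_one, zero_add]
      have h3 : ‖η x - η y‖ ≤ 4 * M := by
        have := norm_sub_le (η x) (η y)
        linarith [hη.2.1 x, hη.2.1 y]
      calc _ ≤ s⁻¹ ^ d * s⁻¹ * B * (4 * M) := by gcongr
        _ = _ := by ring

theorem integrable_dil_mul (hφ : ContDiff ℝ (⊤ : ℕ∞) φ) (hsupp : ∀ z, 2 < ‖z‖ → φ z = 0)
    (hs : 0 < s) {f : Euc d → ℝ} (hf : Continuous f) (x : Euc d) :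
    Integrable fun y => dil φ s (x - y) * f y :=
  (((contDiff_dil hφ s).continuous.comp (continuous_const.sub continuous_id)).mul
    hf).integrable_of_hasCompactSupport (hasCompactSupport_dil_sub hsupp hs x).mul_right

theorem dyadicConv_eq_sum (hφ : ContDiff ℝ (⊤ : ℕ∞) φ) (hsupp : ∀ z, 2 < ‖z‖ → φ z = 0)
    {f : Euc d → ℝ} (hf : Continuous f) (J : Finset ℤ) (x : Euc d) :
    dyadicConv φ J f x = ∑ j ∈ J, ∫ y, dil φ ((2 : ℝ) ^ j) (x - y) * f y := by
  rw [← integral_finsetSum _ fun j _ => integrable_dil_mul hφ hsupp (by positivity) hf x]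
  simp only [dyadicConv, dyadicKer, Finset.sum_mul]

theorem commOp_eq (hα : 0 < α) (hη : InC1a α M η) (hφ : ContDiff ℝ (⊤ : ℕ∞) φ)
    (hsupp : ∀ z, 2 < ‖z‖ → φ z = 0) (hs : 0 < s) (hσ : Continuous σ) (x : Euc d) :
    commOp φ η s σ x = (∫ y, remKer φ η s x y * σ y) +
      (∫ y, dil φ s (x - y) * (divVec η y * σ y)) +
      if s ≤ 1 then ∑ i, ∑ l, ∫ y, dil (gradMoment φ i l) s (x - y) *
        (fderiv ℝ η y (Pi.single l 1) i * σ y) else 0 := by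
  have hrem : Integrable fun y => remKer φ η s x y * σ y := by
    refine (((continuous_remKer hα hη hφ s).comp (Continuous.prodMk_right x)).mul
      hσ).integrable_of_hasCompactSupport (HasCompactSupport.mul_right ?_)
    exact HasCompactSupport.intro (isCompact_closedBall x (2 * s)) fun y hy =>
      remKer_eq_zero hsupp hs x y (by simpa [dist_eq_norm, norm_sub_rev] using hy)
  have hdiv : Integrable fun y => dil φ s (x - y) * (divVec η y * σ y) :=
      integrable_dil_mul hφ hsupp hs ((hη.continuous_divVec hα).mul hσ) x
  have hmom : ∀ i l, Integrable fun y => dil (gradMoment φ i l) s (x - y) *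
      (fderiv ℝ η y (Pi.single l 1) i * σ y) := fun i l =>
    integrable_dil_mul (contDiff_gradMoment hφ i l) (gradMoment_eq_zero hsupp i l) hs
      ((hη.continuous_fderiv_single hα l i).mul hσ) x
  have hmom' : ∀ i, Integrable fun y => ∑ l, dil (gradMoment φ i l) s (x - y) *
      (fderiv ℝ η y (Pi.single l 1) i * σ y) := fun i => integrable_finsetSum _ fun l _ => hmom i l
  rw [← integral_add hrem hdiv, commOp]
  have hadd : Integrable fun y => remKer φ η s x y * σ y +
    dil φ s (x - y) * (divVec η y * σ y) := hrem.add hdiv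
  by_cases h1 : s ≤ 1
  · simp only [if_pos h1]
    have e : ∑ i, ∑ l, ∫ y, dil (gradMoment φ i l) s (x - y) *
        (fderiv ℝ η y (Pi.single l 1) i * σ y) = ∫ y, ∑ i, ∑ l, dil (gradMoment φ i l) s (x - y) *
        (fderiv ℝ η y (Pi.single l 1) i * σ y) := by
      rw [integral_finsetSum _ fun i _ => hmom' i]
      exact Finset.sum_congr rfl fun i _ => (integral_finsetSum _ fun l _ => hmom i l).symm
    rw [e, ← integral_add hadd (integrable_finsetSum _ fun i _ => hmom' i)]
    refine integral_congr_ae (ae_of_all _ fun y => ?_)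
    have h2 := fderiv_dil_apply_clm hφ s (x - y) (fderiv ℝ η y)
    simp only [← mul_assoc, ← Finset.sum_mul]
    rw [← h2, remKer, if_pos h1, map_sub, commKer]
    ring
  · simp only [if_neg h1, add_zero]
    refine integral_congr_ae (ae_of_all _ fun y => ?_)
    simp only [remKer, if_neg h1, sub_zero, commKer]
    ring

/-- `L^p` bound for the commutators, uniform over finite sets of dyadic scales. -/
theorem exists_eLpNorm_sum_commOp_le (hd : 1 ≤ d) (hα : 0 < α) (hα1 : α < 1) (hp : 1 < p)
    (hφ : ContDiff ℝ (⊤ : ℕ∞) φ) (hsupp : ∀ z, 2 < ‖z‖ → φ z = 0) (h0 : ∫ z, φ z = 0) :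
    ∃ C : ℝ, 0 < C ∧ ∀ (η : Euc d → Euc d) (M : ℝ),
      InC1a α M η → ∀ σ : Euc d → ℝ, Continuous σ → HasCompactSupport σ → ∀ J : Finset ℤ,
      AEStronglyMeasurable (fun x => ∑ j ∈ J, commOp φ η ((2 : ℝ) ^ j) σ x) volume ∧
      eLpNorm (fun x => ∑ j ∈ J, commOp φ η ((2 : ℝ) ^ j) σ x) (ENNReal.ofReal p) volume ≤
        ENNReal.ofReal (C * M) * eLpNorm σ (ENNReal.ofReal p) volume := by
  obtain ⟨B, hB⟩ := exists_smoothBound hφ (hasCompactSupport_of_forall_norm hsupp)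
  obtain ⟨C₁, hC₁, h₁⟩ := exists_sum_scale_le α hα
  obtain ⟨C₂, hC₂, h₂⟩ := exists_sum_scale_ge 1 one_pos
  obtain ⟨C₃, hC₃, h₃⟩ := exists_eLpNorm_dyadicConv_le hd hp hφ hsupp h0
  have hmom : ∀ i l : Fin d, ∃ C, 0 < C ∧ ∀ J f, Continuous f → HasCompactSupport f →
      eLpNorm (dyadicConv (gradMoment φ i l) J f) (ENNReal.ofReal p) volume ≤
        ENNReal.ofReal C * eLpNorm f (ENNReal.ofReal p) volume := fun i l =>
    exists_eLpNorm_dyadicConv_le hd hp (contDiff_gradMoment hφ i l) (gradMoment_eq_zero hsupp i l)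
      (integral_gradMoment hφ hsupp h0 i l)
  choose C₄ hC₄ h₄ using hmom
  have hB0 := hB.pos
  have hC₄s : 0 ≤ ∑ i, ∑ l, C₄ i l :=
    Finset.sum_nonneg fun i _ => Finset.sum_nonneg fun l _ => (hC₄ i l).le
  refine ⟨4 ^ d * (4 * B * (C₁ + C₂)) + C₃ * d + ∑ i, ∑ l, C₄ i l, by positivity,
    fun η M hη σ hσ hσc J => ?_⟩
  have hM := hη.nonneg
  have hp1 : 1 ≤ ENNReal.ofReal p := by simpa using hp.le
  set J₁ := J.filter fun j : ℤ => (2 : ℝ) ^ j ≤ 1 with hJ₁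
  set a : ℤ → ℝ := fun j => (if (2 : ℝ) ^ j ≤ 1 then ((2 : ℝ) ^ j / 1) ^ α else 0) +
    if 1 ≤ (2 : ℝ) ^ j then (1 / (2 : ℝ) ^ j) ^ (1 : ℝ) else 0 with ha
  have ha0 : ∀ j, 0 ≤ a j := fun j => by
    simp only [ha]
    split_ifs <;> positivity
  have hasum : ∑ j ∈ J, a j ≤ C₁ + C₂ := by
    rw [Finset.sum_add_distrib]
    exact add_le_add (h₁ 1 one_pos J) (h₂ 1 one_pos J)
  set f₀ : Euc d → ℝ := fun y => divVec η y * σ y with hf₀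
  set f : Fin d → Fin d → Euc d → ℝ := fun i l y => fderiv ℝ η y (Pi.single l 1) i * σ y with hf
  have hf₀c : Continuous f₀ := (hη.continuous_divVec hα).mul hσ
  have hfc : ∀ i l, Continuous (f i l) := fun i l => (hη.continuous_fderiv_single hα l i).mul hσ
  have hfcs : ∀ i l, HasCompactSupport (f i l) := fun i l => hσc.mul_left
  set E : ℤ → Euc d → ℝ := fun j x => ∫ y, remKer φ η ((2 : ℝ) ^ j) x y * σ y with hE
  have hdec : (fun x => ∑ j ∈ J, commOp φ η ((2 : ℝ) ^ j) σ x) =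
      (∑ j ∈ J, E j) + dyadicConv φ J f₀ +
        ∑ i, ∑ l, dyadicConv (gradMoment φ i l) J₁ (f i l) := by
    ext x
    simp only [Pi.add_apply, Finset.sum_apply]
    rw [dyadicConv_eq_sum hφ hsupp hf₀c]
    have e : ∑ i, ∑ l, dyadicConv (gradMoment φ i l) J₁ (f i l) x =
        ∑ j ∈ J, if (2 : ℝ) ^ j ≤ 1 then ∑ i, ∑ l, ∫ y, dil (gradMoment φ i l) ((2 : ℝ) ^ j)
          (x - y) * f i l y else 0 := by
      rw [← Finset.sum_filter, ← hJ₁, Finset.sum_comm' (t' := Finset.univ) (s' := fun _ => J₁)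
        (by simp)]
      refine Finset.sum_congr rfl fun i _ => ?_
      rw [Finset.sum_comm]
      exact Finset.sum_congr rfl fun l _ => dyadicConv_eq_sum (contDiff_gradMoment hφ i l)
        (gradMoment_eq_zero hsupp i l) (hfc i l) J₁ x
    rw [e, ← Finset.sum_add_distrib, ← Finset.sum_add_distrib]
    exact Finset.sum_congr rfl fun j _ => commOp_eq hα hη hφ hsupp (by positivity) hσ x
  have mE : ∀ j, AEStronglyMeasurable (E j) volume := fun j =>
    (stronglyMeasurable_integral_mul (continuous_remKer hα hη hφ _) hσ).aestronglyMeasurable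
  have m₀ : AEStronglyMeasurable (dyadicConv φ J f₀) volume :=
    (continuous_dyadicConv hφ hsupp J hf₀c).aestronglyMeasurable
  have m : ∀ i l, AEStronglyMeasurable (dyadicConv (gradMoment φ i l) J₁ (f i l)) volume :=
    fun i l => (continuous_dyadicConv (contDiff_gradMoment hφ i l) (gradMoment_eq_zero hsupp i l)
      J₁ (hfc i l)).aestronglyMeasurable
  have mEs := Finset.aestronglyMeasurable_sum J fun j _ => mE j
  have mi : ∀ i, AEStronglyMeasurable (∑ l, dyadicConv (gradMoment φ i l) J₁ (f i l)) volume :=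
    fun i => Finset.aestronglyMeasurable_sum _ fun l _ => m i l
  have ms := Finset.aestronglyMeasurable_sum Finset.univ fun i _ => mi i
  rw [hdec]
  refine ⟨(mEs.add m₀).add ms, ?_⟩
  set N := eLpNorm σ (ENNReal.ofReal p) volume with hN
  have hmulN : ∀ (g : Euc d → ℝ) (b : ℝ), (∀ y, |g y| ≤ b) →
      eLpNorm (fun y => g y * σ y) (ENNReal.ofReal p) volume ≤ ENNReal.ofReal b * N := by
    intro g b hg
    refine eLpNorm_le_mul_eLpNorm_of_ae_le_mul (ae_of_all _ fun y => ?_) _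
    rw [norm_mul]
    gcongr
    exact hg y
  have bE : eLpNorm (∑ j ∈ J, E j) (ENNReal.ofReal p) volume ≤
      ENNReal.ofReal (4 ^ d * (4 * B * (C₁ + C₂)) * M) * N := by
    calc _ ≤ ∑ j ∈ J, eLpNorm (E j) (ENNReal.ofReal p) volume := eLpNorm_sum_le (fun j _ => mE j) hp1
      _ ≤ ∑ j ∈ J, ENNReal.ofReal (4 ^ d * (4 * B * M * a j)) * N := by
          refine Finset.sum_le_sum fun j _ => ?_
          exact eLpNorm_integral_mul_le hp (by positivity)
            (abs_remKer_le hα hα1 hη hB hφ hsupp (by positivity))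
            (remKer_eq_zero hsupp (by positivity)) hσ
      _ = ENNReal.ofReal (∑ j ∈ J, 4 ^ d * (4 * B * M * a j)) * N := by
          rw [← Finset.sum_mul, ENNReal.ofReal_sum_of_nonneg]
          intro j _
          have := ha0 j
          positivity
      _ ≤ _ := by
          gcongr
          rw [← Finset.mul_sum, ← Finset.mul_sum]
          calc _ ≤ 4 ^ d * (4 * B * M * (C₁ + C₂)) := by gcongr
            _ = _ := by ring
  have b₀ : eLpNorm (dyadicConv φ J f₀) (ENNReal.ofReal p) volume ≤
      ENNReal.ofReal (C₃ * d * M) * N := by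
    refine (h₃ J f₀ hf₀c hσc.mul_left).trans ?_
    rw [mul_assoc, ENNReal.ofReal_mul hC₃.le, mul_assoc]
    gcongr
    exact hmulN _ _ hη.abs_divVec_le
  have bs : eLpNorm (∑ i, ∑ l, dyadicConv (gradMoment φ i l) J₁ (f i l)) (ENNReal.ofReal p)
      volume ≤ ENNReal.ofReal ((∑ i, ∑ l, C₄ i l) * M) * N := by
    calc _ ≤ ∑ i, eLpNorm (∑ l, dyadicConv (gradMoment φ i l) J₁ (f i l)) (ENNReal.ofReal p)
            volume := eLpNorm_sum_le (fun i _ => mi i) hp1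
      _ ≤ ∑ i, ∑ l, eLpNorm (dyadicConv (gradMoment φ i l) J₁ (f i l)) (ENNReal.ofReal p)
            volume := Finset.sum_le_sum fun i _ => eLpNorm_sum_le (fun l _ => m i l) hp1
      _ ≤ ∑ i, ∑ l, ENNReal.ofReal (C₄ i l) * (ENNReal.ofReal M * N) := by
          refine Finset.sum_le_sum fun i _ => Finset.sum_le_sum fun l _ => ?_
          refine (h₄ i l J₁ _ (hfc i l) (hfcs i l)).trans ?_
          gcongr
          exact hmulN _ _ fun y => hη.abs_fderiv_single_le y l i
      _ = _ := by
          rw [ENNReal.ofReal_mul hC₄s, mul_assoc, ENNReal.ofReal_sum_of_nonneg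
            fun i _ => Finset.sum_nonneg fun l _ => (hC₄ i l).le, Finset.sum_mul]
          refine Finset.sum_congr rfl fun i _ => ?_
          rw [ENNReal.ofReal_sum_of_nonneg fun l _ => (hC₄ i l).le, Finset.sum_mul]
  refine (eLpNorm_add_le (mEs.add m₀) ms hp1).trans ?_
  refine (add_le_add ((eLpNorm_add_le mEs m₀ hp1).trans (add_le_add bE b₀)) bs).trans_eq ?_
  rw [← add_mul, ← add_mul, ← ENNReal.ofReal_add (by positivity) (by positivity),
    ← ENNReal.ofReal_add (by positivity) (by positivity)]
  congr 2
  ring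

end Sums

section
variable {d : ℕ} {F : Type*} [NormedAddCommGroup F] {L M R ρ : ℝ} {f : Euc d → F}

/-- The truncated weakly singular majorant `‖z‖^{1-d}` on the ball of radius `R`. -/
def weakSing (d : ℕ) (R : ℝ) (z : Euc d) : ℝ := if ‖z‖ ≤ R then (‖z‖ ^ d)⁻¹ * ‖z‖ else 0

theorem integrable_weakSing (hd : 1 ≤ d) (R : ℝ) : Integrable (weakSing d R) := by
  have : Nonempty (Fin d) := ⟨⟨0, hd⟩⟩
  have h := (integrable_fun_norm_addHaar (E := Euc d) volume
    (f := fun r : ℝ => if r ≤ R then (r ^ d)⁻¹ * r else 0)).2 ?_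
  · exact h
  have h1 : IntegrableOn (fun _ : ℝ => (1 : ℝ)) (Ioc 0 R) := by simp
  have h2 : IntegrableOn ((Ioc 0 R).indicator fun _ : ℝ => (1 : ℝ)) (Ioi 0) :=
    (h1.integrable_indicator measurableSet_Ioc).integrableOn
  refine h2.congr_fun (fun r hr => ?_) measurableSet_Ioi
  have hr : (0 : ℝ) < r := hr
  by_cases hR : r ≤ R
  · have : r ^ d = r ^ (d - 1) * r := by rw [← pow_succ, Nat.sub_add_cancel hd]
    simp only [indicator, mem_Ioc, hr, hR, and_self, if_true, Module.finrank_fin_fun, smul_eq_mul,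
      this]
    field_simp
  · simp [indicator, hR]

/-- The regularized difference that replaces the density in a principal value integral. -/
def pvDiff (f : Euc d → F) (x z : Euc d) : F := f (x - z) - if ‖z‖ ≤ 1 then f x else 0

theorem norm_pvDiff_le (hL : ∀ x y, ‖f x - f y‖ ≤ L * ‖x - y‖) (hM : ∀ x, ‖f x‖ ≤ M)
    (hL0 : 0 ≤ L) (hρ : ∀ y, ρ < ‖y‖ → f y = 0) (hR : 1 ≤ R) {x : Euc d} (hx : ‖x‖ + ρ ≤ R)
    (z : Euc d) : ‖pvDiff f x z‖ ≤ if ‖z‖ ≤ R then (L + M) * ‖z‖ else 0 := by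
  have hM0 : 0 ≤ M := (norm_nonneg _).trans (hM 0)
  rw [pvDiff]
  by_cases h1 : ‖z‖ ≤ 1
  · rw [if_pos h1, if_pos (h1.trans hR)]
    have := hL (x - z) x
    rw [sub_sub_cancel_left, norm_neg] at this
    nlinarith [norm_nonneg z]
  rw [if_neg h1, sub_zero]
  split_ifs with h2
  · have := hM (x - z)
    nlinarith
  · rw [hρ, norm_zero]
    have := norm_sub_norm_le z x
    rw [norm_sub_rev] at this
    linarith

variable {k : Euc d → ℝ} {B : ℝ} [NormedSpace ℝ F]

theorem norm_smul_pvDiff_le (hB : ∀ z ≠ 0, |k z| ≤ B * (‖z‖ ^ d)⁻¹)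
    (hL : ∀ x y, ‖f x - f y‖ ≤ L * ‖x - y‖) (hM : ∀ x, ‖f x‖ ≤ M)
    (hL0 : 0 ≤ L) (hρ : ∀ y, ρ < ‖y‖ → f y = 0) (hR : 1 ≤ R) {x : Euc d} (hx : ‖x‖ + ρ ≤ R)
    (z : Euc d) : ‖k z • pvDiff f x z‖ ≤ B * (L + M) * weakSing d R z := by
  have h := norm_pvDiff_le hL hM hL0 hρ hR hx z
  have hM0 : 0 ≤ M := (norm_nonneg _).trans (hM 0)
  rcases eq_or_ne z 0 with rfl | hz
  · simp [pvDiff, weakSing]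
  rw [norm_smul, Real.norm_eq_abs, weakSing]
  calc |k z| * ‖pvDiff f x z‖ ≤ B * (‖z‖ ^ d)⁻¹ * (if ‖z‖ ≤ R then (L + M) * ‖z‖ else 0) := by
        gcongr
        · exact (abs_nonneg _).trans (hB z hz)
        · exact hB z hz
    _ = _ := by
        split_ifs <;> ring

theorem aestronglyMeasurable_smul_pvDiff (hk : AEStronglyMeasurable k volume) (hf : Continuous f)
    (x : Euc d) : AEStronglyMeasurable (fun z => k z • pvDiff f x z) volume := by
  refine hk.smul ((hf.comp (continuous_const.sub continuous_id)).aestronglyMeasurable.sub ?_)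
  exact (StronglyMeasurable.ite (measurableSet_le measurable_norm measurable_const)
    stronglyMeasurable_const stronglyMeasurable_const).aestronglyMeasurable

theorem integrable_smul_pvDiff (hd : 1 ≤ d) (hk : AEStronglyMeasurable k volume)
    (hB : ∀ z ≠ 0, |k z| ≤ B * (‖z‖ ^ d)⁻¹) (hf : Continuous f)
    (hL : ∀ x y, ‖f x - f y‖ ≤ L * ‖x - y‖) (hM : ∀ x, ‖f x‖ ≤ M)
    (hL0 : 0 ≤ L) (hρ : ∀ y, ρ < ‖y‖ → f y = 0) (x : Euc d) :
    Integrable fun z => k z • pvDiff f x z :=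
  ((integrable_weakSing hd (max 1 (‖x‖ + ρ))).const_mul (B * (L + M))).mono'
    (aestronglyMeasurable_smul_pvDiff hk hf x) (ae_of_all _
      (norm_smul_pvDiff_le hB hL hM hL0 hρ (le_max_left _ _) (le_max_right _ _)))

theorem setIntegral_annulus_eq_zero
    (hk_mean : ∀ r₁ r₂ : ℝ, 0 < r₁ → r₁ ≤ r₂ →
      (∫ z in {z : Euc d | r₁ ≤ ‖z‖ ∧ ‖z‖ ≤ r₂}, k z) = 0) {ε : ℝ} (hε : 0 < ε) (hε1 : ε ≤ 1) :
    ∫ z in {z : Euc d | ε < ‖z‖ ∧ ‖z‖ ≤ 1}, k z = 0 := by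
  rw [← hk_mean ε 1 hε hε1]
  refine setIntegral_congr_set ?_
  have hs : ∀ᵐ z : Euc d, ‖z‖ ≠ ε := by
    rw [ae_iff]
    simpa [Metric.sphere] using Measure.addHaar_sphere_of_ne_zero (volume : Measure (Euc d)) 0 hε.ne'
  filter_upwards [hs] with z hz
  exact propext ⟨fun h => ⟨h.1.le, h.2⟩, fun h => ⟨lt_of_le_of_ne h.1 hz.symm, h.2⟩⟩

theorem setIntegral_truncation_eq [CompleteSpace F] (hk : AEStronglyMeasurable k volume)
    (hB0 : 0 < B) (hB : ∀ z ≠ 0, |k z| ≤ B * (‖z‖ ^ d)⁻¹)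
    (hk_mean : ∀ r₁ r₂ : ℝ, 0 < r₁ → r₁ ≤ r₂ →
      (∫ z in {z : Euc d | r₁ ≤ ‖z‖ ∧ ‖z‖ ≤ r₂}, k z) = 0)
    {x : Euc d} (hInt : Integrable fun z => k z • pvDiff f x z) {ε : ℝ} (hε : 0 < ε)
    (hε1 : ε ≤ 1) :
    ∫ y in {y : Euc d | ε < ‖x - y‖}, k (x - y) • f y =
      ∫ z in {z : Euc d | ε < ‖z‖}, k z • pvDiff f x z := by
  have hm : MeasurableSet {z : Euc d | ε < ‖z‖} := measurableSet_lt measurable_const measurable_norm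
  have hmx : MeasurableSet {y : Euc d | ε < ‖x - y‖} :=
    measurableSet_lt measurable_const (measurable_const.sub measurable_id).norm
  have hma : MeasurableSet {z : Euc d | ε < ‖z‖ ∧ ‖z‖ ≤ 1} :=
    hm.inter (measurableSet_le measurable_norm measurable_const)
  have hfin : volume {z : Euc d | ε < ‖z‖ ∧ ‖z‖ ≤ 1} ≠ ⊤ := by
    refine ne_top_of_le_ne_top (isCompact_closedBall (0 : Euc d) 1).measure_lt_top.ne
      (measure_mono fun z hz => ?_)
    simpa using hz.2
  have hka : IntegrableOn k {z : Euc d | ε < ‖z‖ ∧ ‖z‖ ≤ 1} := by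
    refine Measure.integrableOn_of_bounded hfin hk (M := B * (ε ^ d)⁻¹) ?_
    refine (ae_restrict_iff' hma).2 (ae_of_all _ fun z hz => ?_)
    have hz0 : z ≠ 0 := norm_pos_iff.1 (hε.trans hz.1)
    refine (hB z hz0).trans ?_
    have := hz.1.le
    gcongr
  have e1 : ∫ y in {y : Euc d | ε < ‖x - y‖}, k (x - y) • f y =
      ∫ z in {z : Euc d | ε < ‖z‖}, k z • f (x - z) := by
    rw [← integral_indicator hm, ← integral_indicator hmx,
      ← integral_sub_left_eq_self _ volume x]
    congr 1 with y
    simp [indicator]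
  have e2 : ∫ z in {z : Euc d | ε < ‖z‖}, {z : Euc d | ε < ‖z‖ ∧ ‖z‖ ≤ 1}.indicator
      (fun z => k z • f x) z = 0 := by
    rw [setIntegral_indicator hma, inter_eq_self_of_subset_right fun z hz => hz.1,
      integral_smul_const, setIntegral_annulus_eq_zero hk_mean hε hε1, zero_smul]
  rw [e1, ← add_zero (∫ z in {z : Euc d | ε < ‖z‖}, k z • pvDiff f x z), ← e2,
    ← integral_add hInt.integrableOn
      ((integrable_indicator_iff hma).2 (hka.smul_const (f x))).integrableOn]
  refine setIntegral_congr_fun hm fun z hz => ?_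
  have hz : ε < ‖z‖ := hz
  by_cases h1 : ‖z‖ ≤ 1
  · simp [pvDiff, indicator, h1, hz, smul_sub]
  · simp [pvDiff, indicator, h1]

theorem pvConv_eq_integral_pvDiff [CompleteSpace F]
    (hk : AEStronglyMeasurable k volume)
    (hB0 : 0 < B) (hB : ∀ z ≠ 0, |k z| ≤ B * (‖z‖ ^ d)⁻¹)
    (hk_mean : ∀ r₁ r₂ : ℝ, 0 < r₁ → r₁ ≤ r₂ →
      (∫ z in {z : Euc d | r₁ ≤ ‖z‖ ∧ ‖z‖ ≤ r₂}, k z) = 0)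
    {x : Euc d} (hInt : Integrable fun z => k z • pvDiff f x z) :
    pvConv k f x = ∫ z, k z • pvDiff f x z := by
  refine Tendsto.limUnder_eq ?_
  have hlim : Tendsto (fun ε : ℝ => ∫ z, {z : Euc d | ε < ‖z‖}.indicator
      (fun z => k z • pvDiff f x z) z) (𝓝[>] 0) (𝓝 (∫ z, k z • pvDiff f x z)) := by
    refine tendsto_integral_filter_of_dominated_convergence (fun z => ‖k z • pvDiff f x z‖)
      (Eventually.of_forall fun ε => ?_) (Eventually.of_forall fun ε => ae_of_all _ fun z =>
        norm_indicator_le_norm_self _ _) hInt.norm (ae_of_all _ fun z => ?_)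
    · exact hInt.aestronglyMeasurable.indicator (measurableSet_lt measurable_const measurable_norm)
    · rcases eq_or_ne z 0 with rfl | hz
      · simp [pvDiff, indicator]
      · refine tendsto_const_nhds.congr' ?_
        filter_upwards [nhdsWithin_le_nhds (eventually_lt_nhds (norm_pos_iff.2 hz))] with ε hε
        exact (indicator_of_mem (s := {z : Euc d | ε < ‖z‖}) hε fun z => k z • pvDiff f x z).symm
  refine hlim.congr' ?_
  filter_upwards [Ioc_mem_nhdsGT one_pos] with ε hε
  rw [integral_indicator (measurableSet_lt measurable_const measurable_norm),
    setIntegral_truncation_eq hk hB0 hB hk_mean hInt hε.1 hε.2]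

theorem exists_regularity_bounds (hf : ContDiff ℝ 1 f) (hc : HasCompactSupport f) :
    ∃ L M ρ : ℝ, 0 ≤ L ∧ (∀ x y, ‖f x - f y‖ ≤ L * ‖x - y‖) ∧ (∀ x, ‖f x‖ ≤ M) ∧
      ∀ y, ρ < ‖y‖ → f y = 0 := by
  obtain ⟨L, hL⟩ := ContDiff.lipschitzWith_of_hasCompactSupport hc hf one_ne_zero
  obtain ⟨M, hM⟩ := hc.exists_bound_of_continuous hf.continuous
  obtain ⟨ρ, hρ⟩ := hc.isCompact.isBounded.exists_norm_le
  refine ⟨L, M, ρ, L.2, fun x y => hL.norm_sub_le x y, hM, fun y hy => ?_⟩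
  by_contra h
  exact absurd (hρ y (subset_tsupport f h)) (not_le.2 hy)

theorem hasFDerivAt_integral_pvDiff (hd : 1 ≤ d)
    (hk : AEStronglyMeasurable k volume) (hB : ∀ z ≠ 0, |k z| ≤ B * (‖z‖ ^ d)⁻¹)
    (hf : ContDiff ℝ 2 f) (hc : HasCompactSupport f) (x : Euc d) :
    HasFDerivAt (fun x => ∫ z, k z • pvDiff f x z) (∫ z, k z • pvDiff (fderiv ℝ f) x z) x := by
  have hf1 : ContDiff ℝ 1 (fderiv ℝ f) := hf.fderiv_right (m := 1) le_rfl
  have hfc : ContDiff ℝ 1 f := hf.of_le one_le_two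
  obtain ⟨L, M, ρ, hL0, hL, hM, hρ⟩ := exists_regularity_bounds hfc hc
  obtain ⟨L', M', ρ', hL0', hL', hM', hρ'⟩ := exists_regularity_bounds hf1 (hc.fderiv ℝ)
  refine hasFDerivAt_integral_of_dominated_of_fderiv_le
    (F' := fun x z => k z • pvDiff (fderiv ℝ f) x z)
    (bound := fun z => B * (L' + M') * weakSing d (max 1 (‖x‖ + 1 + ρ')) z)
    (Metric.ball_mem_nhds x one_pos)
    (Eventually.of_forall fun y => aestronglyMeasurable_smul_pvDiff hk hf.continuous y)
    (integrable_smul_pvDiff hd hk hB hf.continuous hL hM hL0 hρ x)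
    (aestronglyMeasurable_smul_pvDiff hk hf1.continuous x)
    (ae_of_all _ fun z y hy => norm_smul_pvDiff_le hB hL' hM' hL0' hρ' (le_max_left _ _) ?_ z)
    ((integrable_weakSing hd _).const_mul _) (ae_of_all _ fun z y _ => ?_)
  · refine le_max_of_le_right ?_
    have h1 := norm_sub_norm_le y x
    have h2 : ‖y - x‖ < 1 := by simpa [dist_eq_norm] using hy
    linarith
  · have hd' : Differentiable ℝ f := hf.differentiable two_ne_zero
    refine HasFDerivAt.fun_const_smul (.sub ?_ ?_) (k z)
    · exact (hasFDerivAt_comp_sub z).2 (hd' (y - z)).hasFDerivAt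
    · split_ifs
      · exact (hd' y).hasFDerivAt
      · exact hasFDerivAt_const _ _

end

section
variable {d : ℕ} {k : Euc d → ℝ} {α M : ℝ} {η : Euc d → Euc d} {σ : Euc d → ℝ}

theorem commutator_eq_integral (hd : 1 ≤ d)
    (hk : ContDiffOn ℝ (⊤ : ℕ∞) k {x : Euc d | x ≠ 0})
    (hk_hom : ∀ c : ℝ, 0 < c → ∀ x : Euc d, x ≠ 0 → k (c • x) = c ^ (-(d : ℝ)) * k x)
    (hk_mean : ∀ r₁ r₂ : ℝ, 0 < r₁ → r₁ ≤ r₂ →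
      (∫ z in {z : Euc d | r₁ ≤ ‖z‖ ∧ ‖z‖ ≤ r₂}, k z) = 0)
    (hη : ContDiff ℝ 1 η) (hσ : ContDiff ℝ 2 σ) (hc : HasCompactSupport σ) (x : Euc d) :
    (Integrable fun y => k (x - y) * fderiv ℝ σ y (η x - η y)) ∧
      fderiv ℝ (pvConv k σ) x (η x) - pvConv k (fun y => fderiv ℝ σ y (η y)) x =
        ∫ y, k (x - y) * fderiv ℝ σ y (η x - η y) := by
  have hkm := aestronglyMeasurable_of_contDiffOn_ne_zero hd hk
  obtain ⟨B, hB0, hB⟩ := exists_abs_le_inv_norm_pow hk hk_hom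
  have hInt {F : Type} [NormedAddCommGroup F] [NormedSpace ℝ F] {f : Euc d → F}
      (hf : ContDiff ℝ 1 f) (hfc : HasCompactSupport f) (x : Euc d) :
      Integrable fun z => k z • pvDiff f x z := by
    obtain ⟨L, M, ρ, hL0, hL, hM, hρ⟩ := exists_regularity_bounds hf hfc
    exact integrable_smul_pvDiff hd hkm hB hf.continuous hL hM hL0 hρ x
  have hf1 : ContDiff ℝ 1 (fderiv ℝ σ) := hσ.fderiv_right (m := 1) le_rfl
  have hI1 := hInt hf1 (hc.fderiv ℝ) x
  have hcη : HasCompactSupport fun y => fderiv ℝ σ y (η y) :=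
    (hc.fderiv ℝ).mono' fun y hy => subset_tsupport _ fun h => hy (by simp [h])
  have hI2 := hInt (hf1.clm_apply hη) hcη x
  have e1 : pvConv k σ = fun x => ∫ z, k z • pvDiff σ x z := funext fun x =>
    pvConv_eq_integral_pvDiff hkm hB0 hB hk_mean (hInt (hσ.of_le one_le_two) hc x)
  have e2 := pvConv_eq_integral_pvDiff hkm hB0 hB hk_mean hI2
  have e3 (y : Euc d) : (k (x - y) • pvDiff (fderiv ℝ σ) x (x - y)) (η x) -
      k (x - y) • pvDiff (fun y => fderiv ℝ σ y (η y)) x (x - y) =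
      k (x - y) * fderiv ℝ σ y (η x - η y) := by
    simp only [pvDiff, sub_sub_cancel]
    split_ifs <;> simp <;> ring
  have hI := ((hI1.apply_continuousLinearMap (η x)).sub hI2).comp_sub_left x
  refine ⟨hI.congr (ae_of_all _ e3), ?_⟩
  rw [e2, e1, (hasFDerivAt_integral_pvDiff hd hkm hB hσ hc x).fderiv,
    ContinuousLinearMap.integral_apply hI1, ← integral_sub (hI1.apply_continuousLinearMap (η x)) hI2,
    ← integral_sub_left_eq_self _ volume x]
  exact integral_congr_ae (ae_of_all _ e3)

theorem tendsto_sum_commOp (hd : 1 ≤ d) (hα : 0 < α)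
    (hk : ContDiffOn ℝ (⊤ : ℕ∞) k {x : Euc d | x ≠ 0})
    (hk_hom : ∀ c : ℝ, 0 < c → ∀ x : Euc d, x ≠ 0 → k (c • x) = c ^ (-(d : ℝ)) * k x)
    (hk_mean : ∀ r₁ r₂ : ℝ, 0 < r₁ → r₁ ≤ r₂ →
      (∫ z in {z : Euc d | r₁ ≤ ‖z‖ ∧ ‖z‖ ≤ r₂}, k z) = 0)
    (hη : InC1a α M η) (hσ : ContDiff ℝ 2 σ) (hc : HasCompactSupport σ) (x : Euc d) :
    Tendsto (fun N : ℕ => ∑ j ∈ Finset.Icc (-(N : ℤ)) N, commOp (kerPiece k) η ((2 : ℝ) ^ j) σ x)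
      atTop (𝓝 (fderiv ℝ (pvConv k σ) x (η x) - pvConv k (fun y => fderiv ℝ σ y (η y)) x)) := by
  have hη1 := hη.contDiff hα
  have hφ := contDiff_kerPiece hk
  have hs : ∀ z, 2 < ‖z‖ → kerPiece k z = 0 := fun z hz => kerPiece_eq_zero hz
  obtain ⟨hI, he⟩ := commutator_eq_integral hd hk hk_hom hk_mean hη1 hσ hc x
  have hcont : Continuous fun y => fderiv ℝ σ y (η x - η y) :=
    (hσ.continuous_fderiv two_ne_zero).clm_apply (continuous_const.sub hη1.continuous)
  rw [he]
  have e (N : ℕ) : ∑ j ∈ Finset.Icc (-(N : ℤ)) N, commOp (kerPiece k) η ((2 : ℝ) ^ j) σ x =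
      ∫ y, dyadicKer (kerPiece k) (Finset.Icc (-(N : ℤ)) N) (x - y) *
        fderiv ℝ σ y (η x - η y) := by
    refine Eq.trans ?_ (dyadicConv_eq_sum hφ hs hcont (Finset.Icc (-(N : ℤ)) N) x).symm
    exact Finset.sum_congr rfl fun j _ =>
      (integral_dil_mul_fderiv_eq hα hη hφ hs (by positivity) (hσ.of_le one_le_two) x).symm
  simp only [e]
  refine tendsto_integral_of_dominated_convergence _ (fun N => ?_) hI.norm
    (fun N => ae_of_all _ fun y => ?_) (ae_of_all _ fun y => ?_)
  · exact (((contDiff_dyadicKer hφ _).continuous.comp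
      (continuous_const.sub continuous_id)).mul hcont).aestronglyMeasurable
  · rw [norm_mul, norm_mul]
    exact mul_le_mul_of_nonneg_right (abs_dyadicKer_kerPiece_le hk_hom N (x - y)) (norm_nonneg _)
  · rcases eq_or_ne y x with rfl | hy
    · simp
    · exact (tendsto_dyadicKer_kerPiece hk_hom (sub_ne_zero.2 hy.symm)).mul_const _

end

/-- Lemma `steadycomm`: if `k` is smooth away from the origin, homogeneous
of degree `-d` and has zero mean on spheres about the origin (equivalently, zero integral on
all annuli), and `𝕂` is the associated principal-value Calderón–Zygmund operator, then for
`η ∈ C^{1+α}` the commutator `[η·∇, 𝕂]` satisfies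
`‖[η·∇,𝕂]σ‖_{α,p} ≤ C ‖η‖_{C^{1+α}} ‖σ‖_{α,p}` on smooth compactly supported `σ`. -/
theorem stmt5 (d : ℕ) (hd : 1 ≤ d) (α p : ℝ) (hα0 : 0 < α) (hα1 : α < 1) (hp : 1 < p)
    (k : Euc d → ℝ)
    (hk_smooth : ContDiffOn ℝ (⊤ : ℕ∞) k {x : Euc d | x ≠ 0})
    (hk_hom : ∀ c : ℝ, 0 < c → ∀ x : Euc d, x ≠ 0 → k (c • x) = c ^ (-(d : ℝ)) * k x)
    (hk_mean : ∀ r₁ r₂ : ℝ, 0 < r₁ → r₁ ≤ r₂ →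
      (∫ z in {z : Euc d | r₁ ≤ ‖z‖ ∧ ‖z‖ ≤ r₂}, k z) = 0) :
    ∃ C > (0 : ℝ), ∀ (η : Euc d → Euc d) (Mη : ℝ), InC1a α Mη η →
      ∀ (σ : Euc d → ℝ) (Mσ : ℝ), ContDiff ℝ (⊤ : ℕ∞) σ → HasCompactSupport σ →
        InCap α p Mσ σ →
        InCap α p (C * Mη * Mσ)
          (fun x => fderiv ℝ (pvConv k σ) x (η x) -
            pvConv k (fun y => fderiv ℝ σ y (η y)) x) := by
  have hφ := contDiff_kerPiece hk_smooth
  have hs : ∀ z, 2 < ‖z‖ → kerPiece k z = 0 := fun z hz => kerPiece_eq_zero hz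
  obtain ⟨C₁, hC₁, h₁⟩ := exists_abs_sum_commOp_le hd hα0 hα1 hp hφ hs
  obtain ⟨C₂, hC₂, h₂⟩ := exists_abs_sum_commOp_sub_le hα0 hα1 hφ hs
  obtain ⟨C₃, hC₃, h₃⟩ := exists_eLpNorm_sum_commOp_le hd hα0 hα1 hp hφ hs
    (integral_kerPiece hd hk_smooth hk_hom hk_mean)
  refine ⟨C₁ + C₂ + C₃, by positivity, fun η Mη hη σ Mσ hσ hc hσM => ?_⟩
  have hη0 := hη.nonneg
  have hσ0 := hσM.1.nonneg
  have hlim := tendsto_sum_commOp hd hα0 hk_smooth hk_hom hk_mean hη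
    (hσ.of_le (WithTop.coe_le_coe.2 le_top)) hc
  refine ⟨⟨fun x => ?_, fun x y => ?_⟩, ?_⟩
  · refine le_of_tendsto (hlim x).norm (Eventually.of_forall fun N => (h₁ η Mη hη σ Mσ hσM _ x).trans ?_)
    gcongr
    linarith
  · refine le_of_tendsto ((hlim x).sub (hlim y)).norm (Eventually.of_forall fun N =>
      (h₂ η Mη hη σ Mσ hσM.1 _ x y).trans ?_)
    gcongr
    linarith
  · refine (Lp.eLpNorm_lim_le_liminf_eLpNorm (fun N => (h₃ η Mη hη σ hσ.continuous hc
      (Finset.Icc (-(N : ℤ)) N)).1) _ (ae_of_all _ hlim)).trans ?_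
    refine liminf_le_of_frequently_le' (Frequently.of_forall fun N =>
      (h₃ η Mη hη σ hσ.continuous hc _).2.trans ?_)
    rw [ENNReal.ofReal_mul (p := (C₁ + C₂ + C₃) * Mη) (by positivity)]
    refine mul_le_mul' (ENNReal.ofReal_le_ofReal ?_) hσM.2
    gcongr
    linarith

end
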